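/- Monotonicity of the solution in the reflection coefficient (proved inside Theorem A.1): Let η₁, η₂ : (0,∞) → [0,1] satisfy η₁(ω) ≥ η₂(ω) for all ω > 0, and let φ be a bounded nonnegative incoming datum. Let g₁ and g₂ be bounded solutions of the linearized phonon transport equation with zero initial data, the same incoming boundary condition φ at x = 0 for μ > 0, and reflective boundary conditions at x = 1 for μ < 0 with reflection coefficients η₁ and η₂ respectively. Then g₁(t,x,μ,ω) ≥ g₂(t,x,μ,ω) at every point of the domain. -/

import Mathlib

open MeasureTheory Set

/-- `g*(ω) = ω² eʷ/(eʷ−1)²`. -/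
noncomputable def gstar (ω : ℝ) : ℝ := ω ^ 2 * Real.exp ω / (Real.exp ω - 1) ^ 2

/-- Bracket: `⟨f⟩ = ∫_{ω>0} ∫_{μ∈[−1,1]} f(μ,ω) dμ dω`. -/
noncomputable def bracket (f : ℝ → ℝ → ℝ) : ℝ :=
  ∫ ω in Ioi (0:ℝ), ∫ μ in Icc (-1:ℝ) 1, f μ ω

/-- `⟨ω g*⟩ = 2 ∫_0^∞ ω g*(ω) dω`. -/
noncomputable def wgstar : ℝ := 2 * ∫ ω in Ioi (0:ℝ), ω * gstar ω

/-- Normalized Maxwellian `M(ω) = ω g*(ω)/⟨ω g*⟩`. -/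
noncomputable def Mw (ω : ℝ) : ℝ := ω * gstar ω / wgstar

/-- Linearized BGK collision operator `(𝓛g)(μ,ω) = −ω g(μ,ω) + M(ω) ⟨ω g⟩`. -/
noncomputable def coll (g : ℝ → ℝ → ℝ) (μ ω : ℝ) : ℝ :=
  -(ω * g μ ω) + Mw ω * bracket (fun μ' ω' => ω' * g μ' ω')

/-- Integrability of `f(μ,ω)` sufficient for the iterated bracket to be finite. -/
def BracketIntegrable (f : ℝ → ℝ → ℝ) : Prop :=
  (∀ ω ∈ Ioi (0:ℝ), IntegrableOn (fun μ => f μ ω) (Icc (-1:ℝ) 1)) ∧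
  IntegrableOn (fun ω => ∫ μ in Icc (-1:ℝ) 1, f μ ω) (Ioi (0:ℝ))

/-- The forward linearized phonon transport equation
`∂_t g + μ ω ∂_x g = −ω g + M(ω)⟨ω g⟩(t,x)` on `[0,T]×[0,1]×[−1,1]×(0,∞)`,
together with differentiability of the solution in `t` and `x`. -/
def SatisfiesPTE (Tmax : ℝ) (g : ℝ → ℝ → ℝ → ℝ → ℝ) : Prop :=
  ∀ t ∈ Icc (0:ℝ) Tmax, ∀ x ∈ Icc (0:ℝ) 1, ∀ μ ∈ Icc (-1:ℝ) 1, ∀ ω ∈ Ioi (0:ℝ),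
    DifferentiableAt ℝ (fun s => g s x μ ω) t ∧
    DifferentiableAt ℝ (fun y => g t y μ ω) x ∧
    deriv (fun s => g s x μ ω) t + μ * ω * deriv (fun y => g t y μ ω) x
      = coll (fun μ' ω' => g t x μ' ω') μ ω

/-- The adjoint equation `∂_t h + μ ω ∂_x h = ω h − M(ω)⟨ω h⟩ = −𝓛h`. -/
def SatisfiesAdjointPTE (Tmax : ℝ) (h : ℝ → ℝ → ℝ → ℝ → ℝ) : Prop :=
  ∀ t ∈ Icc (0:ℝ) Tmax, ∀ x ∈ Icc (0:ℝ) 1, ∀ μ ∈ Icc (-1:ℝ) 1, ∀ ω ∈ Ioi (0:ℝ),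
    DifferentiableAt ℝ (fun s => h s x μ ω) t ∧
    DifferentiableAt ℝ (fun y => h t y μ ω) x ∧
    deriv (fun s => h s x μ ω) t + μ * ω * deriv (fun y => h t y μ ω) x
      = -(coll (fun μ' ω' => h t x μ' ω') μ ω)

/-- Boundedness of a function of `(t,x,μ,ω)`. -/
def BoundedFn (g : ℝ → ℝ → ℝ → ℝ → ℝ) : Prop := ∃ B, ∀ t x μ ω, |g t x μ ω| ≤ B

/-- `ω g(t,x,·,·)` is integrable in `(μ,ω)` at every point of the domain, so
that `⟨ω g⟩(t,x)` is finite. -/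
def BracketIntegrableSol (Tmax : ℝ) (g : ℝ → ℝ → ℝ → ℝ → ℝ) : Prop :=
  ∀ t ∈ Icc (0:ℝ) Tmax, ∀ x ∈ Icc (0:ℝ) 1,
    BracketIntegrable (fun μ ω => ω * g t x μ ω)

/-- `g` is a bounded-domain solution of the forward problem with reflection
coefficient `η` and incoming datum `φ`: the PDE, zero initial data, incoming
boundary condition at `x = 0` for `μ > 0`, and reflective boundary condition
at `x = 1` for `μ < 0`. -/
def IsForwardSolution (Tmax : ℝ) (η : ℝ → ℝ) (φ : ℝ → ℝ → ℝ → ℝ)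
    (g : ℝ → ℝ → ℝ → ℝ → ℝ) : Prop :=
  SatisfiesPTE Tmax g ∧
  (∀ x ∈ Icc (0:ℝ) 1, ∀ μ ∈ Icc (-1:ℝ) 1, ∀ ω ∈ Ioi (0:ℝ), g 0 x μ ω = 0) ∧
  (∀ t ∈ Icc (0:ℝ) Tmax, ∀ μ ∈ Ioc (0:ℝ) 1, ∀ ω ∈ Ioi (0:ℝ), g t 0 μ ω = φ t μ ω) ∧
  (∀ t ∈ Icc (0:ℝ) Tmax, ∀ μ ∈ Ico (-1:ℝ) 0, ∀ ω ∈ Ioi (0:ℝ), g t 1 μ ω = η ω * g t 1 (-μ) ω)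

/-- `h` is a bounded-domain solution of the adjoint problem with reflection
coefficient `η` and measurement profile `ψ`: the adjoint PDE, zero final data
at `t = Tmax`, boundary condition `h(t,0,μ,ω) = ψ(t) g*(ω)/μ` for `μ < 0`,
and reflective boundary condition at `x = 1` for `μ > 0`. -/
def IsAdjointSolution (Tmax : ℝ) (η : ℝ → ℝ) (ψ : ℝ → ℝ)
    (h : ℝ → ℝ → ℝ → ℝ → ℝ) : Prop :=
  SatisfiesAdjointPTE Tmax h ∧
  (∀ x ∈ Icc (0:ℝ) 1, ∀ μ ∈ Icc (-1:ℝ) 1, ∀ ω ∈ Ioi (0:ℝ), h Tmax x μ ω = 0) ∧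
  (∀ t ∈ Icc (0:ℝ) Tmax, ∀ μ ∈ Ico (-1:ℝ) 0, ∀ ω ∈ Ioi (0:ℝ), h t 0 μ ω = ψ t * gstar ω / μ) ∧
  (∀ t ∈ Icc (0:ℝ) Tmax, ∀ μ ∈ Ioc (0:ℝ) 1, ∀ ω ∈ Ioi (0:ℝ), h t 1 μ ω = η ω * h t 1 (-μ) ω)

section

open Filter Topology

/-- Functions of two real variables that are continuous in each variable separately and locally
bounded. -/
structure SepReg (f : ℝ → ℝ → ℝ) : Prop where
  left : ∀ x, Continuous fun t => f t x
  right : ∀ t, Continuous (f t)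
  bdd : ∀ R, ∃ C, ∀ t x, |t| ≤ R → |x| ≤ R → |f t x| ≤ C

namespace SepReg

variable {f g : ℝ → ℝ → ℝ}

theorem swap (hf : SepReg f) : SepReg fun x t => f t x :=
  ⟨hf.right, hf.left, fun R => by
    obtain ⟨C, hC⟩ := hf.bdd R
    exact ⟨C, fun t x ht hx => hC x t hx ht⟩⟩

theorem of_bounded (h1 : ∀ x, Continuous fun t => f t x) (h2 : ∀ t, Continuous (f t)) (C : ℝ)
    (hC : ∀ t x, |f t x| ≤ C) : SepReg f :=
  ⟨h1, h2, fun _ => ⟨C, fun t x _ _ => hC t x⟩⟩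

theorem of_continuous (h : Continuous (Function.uncurry f)) : SepReg f := by
  refine ⟨fun x => by fun_prop, fun t => by fun_prop, fun R => ?_⟩
  obtain ⟨C, hC⟩ := ((isCompact_Icc (a := -R) (b := R)).prod
    (isCompact_Icc (a := -R) (b := R))).exists_bound_of_continuousOn h.continuousOn
  refine ⟨C, fun t x ht hx => ?_⟩
  simpa using hC (t, x) ⟨abs_le.1 ht, abs_le.1 hx⟩

theorem add (hf : SepReg f) (hg : SepReg g) : SepReg fun t x => f t x + g t x := by
  refine ⟨fun x => (hf.left x).add (hg.left x), fun t => (hf.right t).add (hg.right t),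
    fun R => ?_⟩
  obtain ⟨C, hC⟩ := hf.bdd R
  obtain ⟨D, hD⟩ := hg.bdd R
  exact ⟨C + D, fun t x ht hx => (abs_add_le _ _).trans (add_le_add (hC t x ht hx) (hD t x ht hx))⟩

theorem mul (hf : SepReg f) (hg : SepReg g) : SepReg fun t x => f t x * g t x := by
  refine ⟨fun x => (hf.left x).mul (hg.left x), fun t => (hf.right t).mul (hg.right t),
    fun R => ?_⟩
  obtain ⟨C, hC⟩ := hf.bdd R
  obtain ⟨D, hD⟩ := hg.bdd R
  refine ⟨C * D, fun t x ht hx => ?_⟩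
  rw [abs_mul]
  exact mul_le_mul (hC t x ht hx) (hD t x ht hx) (abs_nonneg _) ((abs_nonneg _).trans (hC t x ht hx))

theorem const (c : ℝ) : SepReg fun _ _ => c :=
  of_continuous (f := fun _ _ => c) (by fun_prop)

theorem const_mul (hf : SepReg f) (c : ℝ) : SepReg fun t x => c * f t x :=
  (const c).mul hf

theorem neg (hf : SepReg f) : SepReg fun t x => - f t x := by
  simpa using hf.const_mul (-1)

theorem sub (hf : SepReg f) (hg : SepReg g) : SepReg fun t x => f t x - g t x := by
  simpa [sub_eq_add_neg] using hf.add hg.neg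

theorem comp {u v : ℝ → ℝ} (hf : SepReg f) (hu : Continuous u) (hv : Continuous v) :
    SepReg fun t x => f (u t) (v x) := by
  refine ⟨fun x => (hf.left _).comp hu, fun t => (hf.right _).comp hv, fun R => ?_⟩
  obtain ⟨a, ha⟩ := (isCompact_Icc (a := -R) (b := R)).exists_bound_of_continuousOn hu.continuousOn
  obtain ⟨b, hb⟩ := (isCompact_Icc (a := -R) (b := R)).exists_bound_of_continuousOn hv.continuousOn
  obtain ⟨C, hC⟩ := hf.bdd (max a b)
  exact ⟨C, fun t x ht hx => hC _ _ ((ha t (abs_le.1 ht)).trans (le_max_left _ _))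
    ((hb x (abs_le.1 hx)).trans (le_max_right _ _))⟩

theorem measurable (hf : SepReg f) : Measurable (Function.uncurry f) := by
  exact (measurable_uncurry_of_continuous_of_measurable (u := fun t x => f x t)
    (fun x => hf.right x) (fun t => (hf.left t).measurable)).comp measurable_swap

theorem intLeft (hf : SepReg f) (x a b : ℝ) : IntervalIntegrable (fun t => f t x) volume a b :=
  (hf.left x).intervalIntegrable _ _

theorem intRight (hf : SepReg f) (t a b : ℝ) : IntervalIntegrable (fun x => f t x) volume a b :=
  (hf.right t).intervalIntegrable _ _

theorem _root_.abs_le_max_of_mem_uIcc {a b x : ℝ} (hx : x ∈ uIcc a b) : |x| ≤ max |a| |b| := by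
  rcases le_total a b with h | h
  · rw [uIcc_of_le h] at hx
    exact abs_le_max_abs_abs hx.1 hx.2
  · rw [uIcc_of_ge h] at hx
    rw [max_comm]
    exact abs_le_max_abs_abs hx.1 hx.2

theorem continuous_integral (hf : SepReg f) (a b : ℝ) : Continuous fun t => ∫ x in a..b, f t x := by
  refine continuous_iff_continuousAt.2 fun t => ?_
  obtain ⟨C, hC⟩ := hf.bdd (max (|t| + 1) (max |a| |b|))
  refine intervalIntegral.continuousAt_of_dominated_interval (bound := fun _ => C)
    (.of_forall fun s => (hf.right s).aestronglyMeasurable) ?_ (by simp)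
    (.of_forall fun x _ => (hf.left x).continuousAt)
  filter_upwards [Metric.ball_mem_nhds t one_pos] with s hs
  refine .of_forall fun x hx => hC s x ?_ ?_
  · rw [Metric.mem_ball, Real.dist_eq] at hs
    have := abs_sub_abs_le_abs_sub s t
    exact le_trans (by linarith) (le_max_left _ _)
  · exact (abs_le_max_of_mem_uIcc (uIoc_subset_uIcc hx)).trans (le_max_right _ _)

theorem integrableOn_prod (hf : SepReg f) (a b c d : ℝ) :
    IntegrableOn (Function.uncurry f) (Icc a b ×ˢ Icc c d) := by
  obtain ⟨C, hC⟩ := hf.bdd (max (max |a| |b|) (max |c| |d|))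
  refine Measure.integrableOn_of_bounded (M := C) (by
    rw [Measure.volume_eq_prod, Measure.prod_prod]; simp [ENNReal.mul_eq_top])
    hf.measurable.aestronglyMeasurable ?_
  refine (ae_restrict_mem (measurableSet_Icc.prod measurableSet_Icc)).mono fun p hp => ?_
  refine hC _ _ ((abs_le_max_abs_abs hp.1.1 hp.1.2).trans (le_max_left _ _))
    ((abs_le_max_abs_abs hp.2.1 hp.2.2).trans (le_max_right _ _))

theorem fubini (hf : SepReg f) {a b c d : ℝ} (hab : a ≤ b) (hcd : c ≤ d) :
    ∫ t in a..b, ∫ x in c..d, f t x = ∫ x in c..d, ∫ t in a..b, f t x := by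
  simp only [intervalIntegral.integral_of_le hab, intervalIntegral.integral_of_le hcd]
  refine integral_integral_swap ?_
  rw [Measure.prod_restrict]
  exact (hf.integrableOn_prod a b c d).mono_set (prod_mono Ioc_subset_Icc_self Ioc_subset_Icc_self)

theorem prim (hf : SepReg f) : SepReg fun t x => ∫ s in (0:ℝ)..t, f s x := by
  refine ⟨fun x => intervalIntegral.continuous_primitive (fun a b => hf.intLeft x a b) 0,
    fun t => hf.swap.continuous_integral 0 t, fun R => ?_⟩
  obtain ⟨C, hC⟩ := hf.bdd R
  refine ⟨C * R, fun t x ht hx => ?_⟩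
  have h0 : 0 ≤ C := (abs_nonneg _).trans (hC t x ht hx)
  refine (intervalIntegral.norm_integral_le_of_norm_le_const (C := C)
    (f := fun s => f s x) fun s hs => ?_).trans ?_
  · refine hC s x ?_ hx
    have := abs_le_max_of_mem_uIcc (uIoc_subset_uIcc hs)
    rw [abs_zero, max_eq_right (abs_nonneg _)] at this
    exact this.trans ht
  · simpa using mul_le_mul_of_nonneg_left ht h0

theorem hasDerivAt_prim (hf : SepReg f) (t x : ℝ) :
    HasDerivAt (fun t => ∫ s in (0:ℝ)..t, f s x) (f t x) t :=
  intervalIntegral.integral_hasDerivAt_right (hf.intLeft x 0 t)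
    ((hf.left x).stronglyMeasurableAtFilter _ _) (hf.left x).continuousAt

end SepReg

/-- At almost every point of a set where two functions that agree on the set are differentiable,
the derivatives agree. -/
theorem ae_deriv_eq_of_eqOn {h k h' k' : ℝ → ℝ} {C : Set ℝ} (heq : EqOn h k C) :
    ∀ᵐ t, t ∈ C → HasDerivAt h (h' t) t → HasDerivAt k (k' t) t → h' t = k' t := by
  have hc : ∀ᵐ t, t ∉ { x ∈ C | 𝓝[C ∩ Ioi x] x = ⊥ } :=
    measure_eq_zero_iff_ae_notMem.1 (countable_setOfPred_isolated_right_within.measure_zero _)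
  filter_upwards [hc] with t ht htC h1 h2
  have hne : (𝓝[C ∩ Ioi t] t).NeBot := ⟨fun hb => ht ⟨htC, hb⟩⟩
  have hacc : AccPt t (𝓟 C) := by
    rw [accPt_principal_iff_nhdsWithin]
    exact hne.mono (nhdsWithin_mono _ fun y hy => ⟨hy.1, fun h => (h ▸ hy.2 : t < t).false⟩)
  have h3 : HasDerivWithinAt h (k' t) C t :=
    h2.hasDerivWithinAt.congr heq (heq htC)
  exact (hacc.uniqueDiffWithinAt).eq_deriv _ h1.hasDerivWithinAt h3

theorem abs_sub_sub_setIntegral_le {h h' : ℝ → ℝ} {N α β : ℝ} {C : Set ℝ} (hαβ : α ≤ β)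
    (hN : 0 ≤ N)
    (hC : IsClosed C) (hCs : C ⊆ Icc α β) (hne : C.Nonempty)
    (hanch : ∀ t ∈ C, ∀ s, |h s - h t| ≤ N * |s - t|)
    (hd : ∀ t ∈ C, t ∈ Ioo α β → HasDerivAt h (h' t) t) :
    |h β - h α - ∫ t in C, h' t| ≤ N * volume.real (Icc α β \ C) := by
  lift N to NNReal using hN
  obtain ⟨t₀, ht₀⟩ := hne
  have hends : |h β - h α| ≤ N * |β - α| := by
    have h1 := hanch t₀ ht₀ α
    have h2 := hanch t₀ ht₀ β
    obtain ⟨h3, h4⟩ := hCs ht₀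
    rw [abs_sub_comm α, abs_of_nonneg (by linarith : 0 ≤ t₀ - α)] at h1
    rw [abs_of_nonneg (by linarith : 0 ≤ β - t₀)] at h2
    rw [abs_of_nonneg (by linarith : 0 ≤ β - α)]
    calc |h β - h α| ≤ |h β - h t₀| + |h t₀ - h α| := abs_sub_le _ _ _
      _ ≤ _ := by rw [abs_sub_comm (h t₀)]; linarith
  have hlip : LipschitzOnWith N h (insert α (insert β C)) := by
    refine LipschitzOnWith.of_dist_le_mul fun x hx y hy => ?_
    simp only [Real.dist_eq]
    rcases hx with rfl | rfl | hx <;> rcases hy with rfl | rfl | hy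
    · simp
    · rw [abs_sub_comm, abs_sub_comm x]; exact hends
    · exact hanch _ hy _
    · exact hends
    · simp
    · exact hanch _ hy _
    all_goals rw [abs_sub_comm, abs_sub_comm x]; exact hanch _ hx _
  obtain ⟨k, hk, hkh⟩ := hlip.extend_real
  have hac := (hk.lipschitzOnWith (s := uIcc α β)).absolutelyContinuousOnInterval
  have hint := hac.intervalIntegrable_deriv
  have hftc := hac.integral_deriv_eq_sub
  rw [intervalIntegral.integral_of_le hαβ, ← integral_Icc_eq_integral_Ioc] at hftc
  rw [intervalIntegrable_iff_integrableOn_Icc_of_le hαβ] at hint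
  have hCm := hC.measurableSet
  have hCint : ∫ t in C, h' t = ∫ t in C, deriv k t := by
    refine setIntegral_congr_ae hCm ?_
    have hEq : EqOn h k C := fun t ht => hkh (by simp [ht])
    have e1 : ∀ᵐ t : ℝ, t ≠ α := by simp [ae_iff]
    have e2 : ∀ᵐ t : ℝ, t ≠ β := by simp [ae_iff]
    filter_upwards [ae_deriv_eq_of_eqOn (h' := h') (k' := deriv k) hEq, hk.ae_differentiableAt,
      e1, e2] with t h1 h2 h3 h4 ht
    exact h1 ht (hd t ht ⟨lt_of_le_of_ne (hCs ht).1 h3.symm, lt_of_le_of_ne (hCs ht).2 h4⟩)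
      h2.hasDerivAt
  have hsplit : ∫ t in Icc α β, deriv k t = (∫ t in C, deriv k t) + ∫ t in Icc α β \ C, deriv k t := by
    rw [← setIntegral_union disjoint_sdiff_right (measurableSet_Icc.diff hCm)
      (hint.mono_set hCs) (hint.mono_set sdiff_subset), union_sdiff_cancel hCs]
  have : h β - h α - ∫ t in C, h' t = ∫ t in Icc α β \ C, deriv k t := by
    rw [hkh (by simp : α ∈ _), hkh (by simp : β ∈ _), ← hftc, hsplit, hCint]; ring
  rw [this, ← Real.norm_eq_abs]
  refine norm_setIntegral_le_of_norm_le_const ?_ fun t _ => norm_deriv_le_of_lipschitz hk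
  exact (measure_mono sdiff_subset).trans_lt measure_Icc_lt_top

/-- Defect of the Green formula for the field `(a, b)` with divergence `f` on the rectangle
`[t₁, t₂] × [x₁, x₂]`. -/
noncomputable def rectDefect (a b f : ℝ → ℝ → ℝ) (t₁ t₂ x₁ x₂ : ℝ) : ℝ :=
  (∫ x in x₁..x₂, (a t₂ x - a t₁ x)) + (∫ t in t₁..t₂, (b t x₂ - b t x₁))
    - ∫ t in t₁..t₂, ∫ x in x₁..x₂, f t x

section rectDefect
variable {a b f : ℝ → ℝ → ℝ}

theorem rectDefect_add_left (ha : SepReg a) (hb : SepReg b) (hf : SepReg f)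
    (t₁ t₂ t₃ x₁ x₂ : ℝ) :
    rectDefect a b f t₁ t₂ x₁ x₂ + rectDefect a b f t₂ t₃ x₁ x₂
      = rectDefect a b f t₁ t₃ x₁ x₂ := by
  have h1 := intervalIntegral.integral_add_adjacent_intervals
    ((hb.intLeft x₂ t₁ t₂).sub (hb.intLeft x₁ t₁ t₂)) ((hb.intLeft x₂ t₂ t₃).sub (hb.intLeft x₁ t₂ t₃))
  have h2 := intervalIntegral.integral_add_adjacent_intervals
    ((hf.continuous_integral x₁ x₂).intervalIntegrable (μ := volume) t₁ t₂)
    ((hf.continuous_integral x₁ x₂).intervalIntegrable (μ := volume) t₂ t₃)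
  have h3 := intervalIntegral.integral_add
    ((ha.intRight t₂ x₁ x₂).sub (ha.intRight t₁ x₁ x₂))
    ((ha.intRight t₃ x₁ x₂).sub (ha.intRight t₂ x₁ x₂))
  simp only [sub_add_sub_cancel'] at h3
  simp only [rectDefect]
  linarith

theorem rectDefect_add_right (ha : SepReg a) (hb : SepReg b) (hf : SepReg f)
    (t₁ t₂ x₁ x₂ x₃ : ℝ) :
    rectDefect a b f t₁ t₂ x₁ x₂ + rectDefect a b f t₁ t₂ x₂ x₃
      = rectDefect a b f t₁ t₂ x₁ x₃ := by
  have h1 := intervalIntegral.integral_add_adjacent_intervals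
    ((ha.intRight t₂ x₁ x₂).sub (ha.intRight t₁ x₁ x₂)) ((ha.intRight t₂ x₂ x₃).sub (ha.intRight t₁ x₂ x₃))
  have h2 := intervalIntegral.integral_add
    ((hf.continuous_integral x₁ x₂).intervalIntegrable (μ := volume) t₁ t₂)
    ((hf.continuous_integral x₂ x₃).intervalIntegrable (μ := volume) t₁ t₂)
  have h3 := intervalIntegral.integral_add
    ((hb.intLeft x₂ t₁ t₂).sub (hb.intLeft x₁ t₁ t₂))
    ((hb.intLeft x₃ t₁ t₂).sub (hb.intLeft x₂ t₁ t₂))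
  simp only [sub_add_sub_cancel'] at h3
  have h4 : ∀ t, (∫ x in x₁..x₂, f t x) + (∫ x in x₂..x₃, f t x) = ∫ x in x₁..x₃, f t x :=
    fun t => intervalIntegral.integral_add_adjacent_intervals (hf.intRight _ _ _) (hf.intRight _ _ _)
  simp only [h4] at h2
  simp only [rectDefect]
  linarith

theorem continuous_rectDefect_right (ha : SepReg a) (hb : SepReg b) (hf : SepReg f)
    (t₁ t₂ x₁ : ℝ) : Continuous fun x₂ => rectDefect a b f t₁ t₂ x₁ x₂ := by
  refine ((intervalIntegral.continuous_primitive (fun _ _ =>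
    ((ha.intRight _ _ _).sub (ha.intRight _ _ _))) _).add
    (SepReg.continuous_integral (f := fun x₂ t => b t x₂ - b t x₁) ?_ _ _)).sub ?_
  · exact hb.swap.sub (hb.comp continuous_id continuous_const).swap
  · have h : SepReg fun x₂ t => ∫ x in x₁..x₂, f t x := by
      have := hf.swap.prim.sub (hf.swap.prim.comp (continuous_const (y := x₁)) continuous_id)
      convert this using 3 with x₂ t
      simp only [id]
      rw [intervalIntegral.integral_interval_sub_left (hf.intRight _ _ _) (hf.intRight _ _ _)]
    exact h.continuous_integral t₁ t₂

theorem continuous_rectDefect_left (ha : SepReg a) (hb : SepReg b) (hf : SepReg f)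
    (t₁ x₁ x₂ : ℝ) : Continuous fun t₂ => rectDefect a b f t₁ t₂ x₁ x₂ := by
  refine (Continuous.add ?_ (intervalIntegral.continuous_primitive (fun _ _ =>
    ((hb.intLeft _ _ _).sub (hb.intLeft _ _ _))) _)).sub
    (intervalIntegral.continuous_primitive (fun _ _ =>
      ((hf.continuous_integral x₁ x₂).intervalIntegrable _ _)) _)
  exact SepReg.continuous_integral (f := fun t₂ x => a t₂ x - a t₁ x)
    (ha.sub (ha.comp continuous_const continuous_id)) _ _

end rectDefect

/-- Bisection of rectangles: a function of rectangles that is subadditive under division into four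
quarters and positive on a rectangle is positive on arbitrarily deep dyadic subrectangles
around some point. -/
theorem exists_forall_dyadic_pos {Ψ : ℝ → ℝ → ℝ → ℝ → ℝ}
    (hsub : ∀ t l x m, 0 ≤ l → 0 ≤ m → Ψ t (t + 2 * l) x (x + 2 * m) ≤
      Ψ t (t + l) x (x + m) + Ψ (t + l) (t + 2 * l) x (x + m) + Ψ t (t + l) (x + m) (x + 2 * m)
        + Ψ (t + l) (t + 2 * l) (x + m) (x + 2 * m))
    {t l x m : ℝ} (hl : 0 ≤ l) (hm : 0 ≤ m) (hpos : 0 < Ψ t (t + l) x (x + m)) :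
    ∃ p : ℝ × ℝ, ∀ n : ℕ, ∃ t' x', t ≤ t' ∧ t' + l / 2 ^ n ≤ t + l ∧ x ≤ x' ∧
      x' + m / 2 ^ n ≤ x + m ∧ p ∈ Icc t' (t' + l / 2 ^ n) ×ˢ Icc x' (x' + m / 2 ^ n) ∧
      0 < Ψ t' (t' + l / 2 ^ n) x' (x' + m / 2 ^ n) := by
  have step : ∀ (n : ℕ) (q : ℝ × ℝ),
      0 < Ψ q.1 (q.1 + l / 2 ^ n) q.2 (q.2 + m / 2 ^ n) → ∃ q' : ℝ × ℝ,
      q.1 ≤ q'.1 ∧ q'.1 + l / 2 ^ (n + 1) ≤ q.1 + l / 2 ^ n ∧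
      q.2 ≤ q'.2 ∧ q'.2 + m / 2 ^ (n + 1) ≤ q.2 + m / 2 ^ n ∧
      0 < Ψ q'.1 (q'.1 + l / 2 ^ (n + 1)) q'.2 (q'.2 + m / 2 ^ (n + 1)) := by
    intro n q hq
    set l' := l / 2 ^ (n + 1) with hl'
    set m' := m / 2 ^ (n + 1) with hm'
    have hl2 : l / 2 ^ n = 2 * l' := by rw [hl', pow_succ]; field_simp
    have hm2 : m / 2 ^ n = 2 * m' := by rw [hm', pow_succ]; field_simp
    have hl0 : 0 ≤ l' := by positivity
    have hm0 : 0 ≤ m' := by positivity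
    rw [hl2, hm2] at hq ⊢
    have h4 := hsub q.1 l' q.2 m' hl0 hm0
    have e1 : q.1 + 2 * l' = q.1 + l' + l' := by ring
    have e2 : q.2 + 2 * m' = q.2 + m' + m' := by ring
    by_contra! hcon
    have c1 := hcon (q.1, q.2) le_rfl (by simp; linarith) le_rfl (by simp; linarith)
    have c2 := hcon (q.1 + l', q.2) (by simp; linarith) (by simp; linarith) le_rfl (by simp; linarith)
    have c3 := hcon (q.1, q.2 + m') le_rfl (by simp; linarith) (by simp; linarith) (by simp; linarith)
    have c4 := hcon (q.1 + l', q.2 + m') (by simp; linarith) (by simp; linarith) (by simp; linarith)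
      (by simp; linarith)
    simp only at c1 c2 c3 c4
    rw [e1, e2] at h4 hq
    linarith
  choose! F hF using step
  let Q : ℕ → ℝ × ℝ := fun n => Nat.rec (t, x) (fun n q => F n q) n
  have hQ0 : Q 0 = (t, x) := rfl
  have hQs : ∀ n, Q (n + 1) = F n (Q n) := fun n => rfl
  have hQpos : ∀ n, 0 < Ψ (Q n).1 ((Q n).1 + l / 2 ^ n) (Q n).2 ((Q n).2 + m / 2 ^ n) := by
    intro n
    induction n with
    | zero => simpa [hQ0] using hpos
    | succ n ih => rw [hQs]; exact (hF n (Q n) ih).2.2.2.2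
  have hstep := fun n => hF n (Q n) (hQpos n)
  simp only [← hQs] at hstep
  have mono1 : Monotone fun n => (Q n).1 := monotone_nat_of_le_succ fun n => (hstep n).1
  have mono2 : Monotone fun n => (Q n).2 := monotone_nat_of_le_succ fun n => (hstep n).2.2.1
  have anti1 : Antitone fun n => (Q n).1 + l / 2 ^ n :=
    antitone_nat_of_succ_le fun n => (hstep n).2.1
  have anti2 : Antitone fun n => (Q n).2 + m / 2 ^ n :=
    antitone_nat_of_succ_le fun n => (hstep n).2.2.2.1
  have key : ∀ {u v : ℕ → ℝ}, Monotone u → Antitone v → (∀ n, u n ≤ v n) →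
      ∃ p, ∀ n, u n ≤ p ∧ p ≤ v n := by
    intro u v hu hv huv
    have hle : ∀ i j, u i ≤ v j := fun i j =>
      (hu (le_max_left i j)).trans ((huv _).trans (hv (le_max_right i j)))
    exact ⟨⨆ n, u n, fun n => ⟨le_ciSup ⟨v 0, by rintro _ ⟨i, rfl⟩; exact hle i 0⟩ n,
      ciSup_le fun i => hle i n⟩⟩
  obtain ⟨p₁, hp₁⟩ := key mono1 anti1 fun n => by
    have : 0 ≤ l / 2 ^ n := by positivity
    linarith
  obtain ⟨p₂, hp₂⟩ := key mono2 anti2 fun n => by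
    have : 0 ≤ m / 2 ^ n := by positivity
    linarith
  refine ⟨(p₁, p₂), fun n => ⟨(Q n).1, (Q n).2, ?_, ?_, ?_, ?_, ⟨hp₁ n, hp₂ n⟩, hQpos n⟩⟩
  · simpa [hQ0] using mono1 (Nat.zero_le n)
  · simpa [hQ0] using anti1 (Nat.zero_le n)
  · simpa [hQ0] using mono2 (Nat.zero_le n)
  · simpa [hQ0] using anti2 (Nat.zero_le n)

/-- `a` is Lipschitz with constant `N` relative to the point `p` along both coordinate lines
through `p`. -/
def Anchored (a : ℝ → ℝ → ℝ) (N : ℝ) (p : ℝ × ℝ) : Prop :=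
  (∀ s, |a s p.2 - a p.1 p.2| ≤ N * |s - p.1|) ∧ ∀ y, |a p.1 y - a p.1 p.2| ≤ N * |y - p.2|

theorem Anchored.mono {a : ℝ → ℝ → ℝ} {N N' : ℝ} {p : ℝ × ℝ} (h : Anchored a N p) (hN : N ≤ N') :
    Anchored a N' p :=
  ⟨fun s => (h.1 s).trans (mul_le_mul_of_nonneg_right hN (abs_nonneg _)),
    fun s => (h.2 s).trans (mul_le_mul_of_nonneg_right hN (abs_nonneg _))⟩

theorem Anchored.swap {a : ℝ → ℝ → ℝ} {N : ℝ} {p : ℝ × ℝ} (h : Anchored a N p) :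
    Anchored (fun x t => a t x) N p.swap :=
  ⟨h.2, h.1⟩

theorem isClosed_setOf_anchored {a : ℝ → ℝ → ℝ} (ha : SepReg a) (N : ℝ) :
    IsClosed {p | Anchored a N p} := by
  refine IsSeqClosed.isClosed fun q p hq hp => ?_
  have h1 : Tendsto (fun n => (q n).1) atTop (𝓝 p.1) := (continuous_fst.tendsto p).comp hp
  have h2 : Tendsto (fun n => (q n).2) atTop (𝓝 p.2) := (continuous_snd.tendsto p).comp hp
  have hA : Tendsto (fun n => a p.1 (q n).2) atTop (𝓝 (a p.1 p.2)) :=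
    ((ha.right p.1).tendsto _).comp h2
  have hB : Tendsto (fun n => N * |p.1 - (q n).1|) atTop (𝓝 0) := by
    have := ((tendsto_const_nhds (x := p.1)).sub h1).abs.const_mul N
    simpa using this
  have hC : Tendsto (fun n => a p.1 (q n).2 - a (q n).1 (q n).2) atTop (𝓝 0) :=
    squeeze_zero_norm (fun n => (hq n).1 p.1) hB
  have hD : Tendsto (fun n => a (q n).1 (q n).2) atTop (𝓝 (a p.1 p.2)) := by
    simpa using hA.sub hC
  refine ⟨fun s => ?_, fun y => ?_⟩
  · exact le_of_tendsto_of_tendsto' ((((ha.right s).tendsto _).comp h2).sub hD).abs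
      (((tendsto_const_nhds (x := s)).sub h1).abs.const_mul N) fun n => (hq n).1 s
  · exact le_of_tendsto_of_tendsto' ((((ha.left y).tendsto _).comp h1).sub hD).abs
      (((tendsto_const_nhds (x := y)).sub h2).abs.const_mul N) fun n => (hq n).2 y

/-- The partial derivative of `a` in the first variable, cut off outside `P`. -/
noncomputable def derivOn (P : Set (ℝ × ℝ)) (a : ℝ → ℝ → ℝ) (t x : ℝ) : ℝ :=
  P.indicator (fun p => deriv (fun s => a s p.2) p.1) (t, x)

theorem Icc_prod_ae_eq_Ioo_prod (t₁ t₂ x₁ x₂ : ℝ) :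
    (Ioo t₁ t₂ ×ˢ Ioo x₁ x₂ : Set (ℝ × ℝ)) =ᵐ[volume] Icc t₁ t₂ ×ˢ Icc x₁ x₂ :=
  Measure.set_prod_ae_eq Ioo_ae_eq_Icc Ioo_ae_eq_Icc

theorem volume_Icc_prod_lt_top (t₁ t₂ x₁ x₂ : ℝ) :
    volume (Icc t₁ t₂ ×ˢ Icc x₁ x₂ : Set (ℝ × ℝ)) < ⊤ := by
  rw [Measure.volume_eq_prod, Measure.prod_prod]
  simp [ENNReal.mul_lt_top]

theorem integral_Icc_prod {F : ℝ → ℝ → ℝ} {t₁ t₂ x₁ x₂ : ℝ} (ht : t₁ ≤ t₂) (hx : x₁ ≤ x₂)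
    (hF : IntegrableOn (Function.uncurry F) (Icc t₁ t₂ ×ˢ Icc x₁ x₂)) :
    ∫ p in Icc t₁ t₂ ×ˢ Icc x₁ x₂, F p.1 p.2 = ∫ x in x₁..x₂, ∫ t in t₁..t₂, F t x := by
  rw [Measure.volume_eq_prod] at *
  simp only [intervalIntegral.integral_of_le ht, intervalIntegral.integral_of_le hx,
    ← integral_Icc_eq_integral_Ioc]
  rw [setIntegral_prod (fun p => F p.1 p.2) hF]
  refine integral_integral_swap ?_
  rwa [Measure.prod_restrict]

theorem integrableOn_derivOn {P : Set (ℝ × ℝ)} {a : ℝ → ℝ → ℝ} {N t₁ t₂ x₁ x₂ : ℝ}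
    (ha : SepReg a) (hP : IsClosed P)
    (hanch : ∀ p ∈ P, p ∈ Icc t₁ t₂ ×ˢ Icc x₁ x₂ → Anchored a N p)
    (hd : ∀ t ∈ Ioo t₁ t₂, ∀ x ∈ Ioo x₁ x₂, DifferentiableAt ℝ (fun s => a s x) t) :
    IntegrableOn (Function.uncurry (derivOn P a)) (Icc t₁ t₂ ×ˢ Icc x₁ x₂) := by
  have : IsFiniteMeasure (volume.restrict (Icc t₁ t₂ ×ˢ Icc x₁ x₂ : Set (ℝ × ℝ))) :=
    ⟨by simpa using volume_Icc_prod_lt_top t₁ t₂ x₁ x₂⟩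
  refine Integrable.of_bound (C := |N|) ?_ ?_
  · rw [Measure.restrict_congr_set (Icc_prod_ae_eq_Ioo_prod t₁ t₂ x₁ x₂).symm]
    refine aestronglyMeasurable_of_tendsto_ae atTop
      (f := fun (n : ℕ) => P.indicator fun p : ℝ × ℝ =>
        (1 / ((n : ℝ) + 1))⁻¹ • (a (p.1 + 1 / ((n : ℝ) + 1)) p.2 - a p.1 p.2)) (fun n => ?_) ?_
    · refine (Measurable.indicator ?_ hP.measurableSet).aestronglyMeasurable
      have h1 := (ha.comp (continuous_id.add (continuous_const (y := 1 / ((n : ℝ) + 1))))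
        continuous_id).measurable
      exact (h1.sub ha.measurable).const_mul ((1 / ((n : ℝ) + 1))⁻¹)
    · refine (ae_restrict_mem (measurableSet_Ioo.prod measurableSet_Ioo)).mono fun p hp => ?_
      simp only [Function.uncurry, derivOn]
      by_cases hpP : p ∈ P
      · simp only [indicator_of_mem hpP]
        have h0 : Tendsto (fun n : ℕ => 1 / ((n : ℝ) + 1)) atTop (𝓝[≠] 0) :=
          tendsto_nhdsWithin_iff.2 ⟨tendsto_one_div_add_atTop_nhds_zero_nat,
            .of_forall fun n => by simp; positivity⟩
        exact (hasDerivAt_iff_tendsto_slope_zero.1 (hd _ hp.1 _ hp.2).hasDerivAt).comp h0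
      · simp [indicator_of_notMem hpP]
  · refine (ae_restrict_mem (measurableSet_Icc.prod measurableSet_Icc)).mono fun p hp => ?_
    simp only [Function.uncurry, derivOn]
    by_cases hpP : p ∈ P
    · rw [indicator_of_mem hpP]
      refine norm_deriv_le_of_lip' (abs_nonneg N) (.of_forall fun s => ?_)
      exact ((hanch p hpP hp).1 s).trans
        (mul_le_mul_of_nonneg_right (le_abs_self N) (abs_nonneg _))
    · rw [indicator_of_notMem hpP]
      simp

theorem abs_integral_sub_integral_derivOn_le {P : Set (ℝ × ℝ)} {a : ℝ → ℝ → ℝ}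
    {N κ t₁ t₂ x₁ x₂ α β γ δ : ℝ}
    (ha : SepReg a) (hP : IsClosed P) (hN : 0 ≤ N)
    (hanch : ∀ p ∈ P, p ∈ Icc t₁ t₂ ×ˢ Icc x₁ x₂ → Anchored a N p)
    (hd : ∀ t ∈ Ioo t₁ t₂, ∀ x ∈ Ioo x₁ x₂, DifferentiableAt ℝ (fun s => a s x) t)
    (hαβ : α ≤ β) (hγδ : γ ≤ δ) (hα : t₁ ≤ α) (hβ : β ≤ t₂) (hγ : x₁ ≤ γ) (hδ : δ ≤ x₂)
    (hbox : P ∩ Icc t₁ t₂ ×ˢ Icc x₁ x₂ ⊆ Icc α β ×ˢ Icc γ δ)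
    (hαP : ∃ y ∈ Icc γ δ, (α, y) ∈ P) (hβP : ∃ y ∈ Icc γ δ, (β, y) ∈ P)
    (hκ0 : 0 ≤ κ) (hκ : x₂ - x₁ ≤ κ * (t₂ - t₁)) :
    |(∫ x in γ..δ, (a β x - a α x)) - ∫ p in Icc t₁ t₂ ×ˢ Icc x₁ x₂, derivOn P a p.1 p.2|
      ≤ N * (1 + 3 * κ) * volume.real (Icc t₁ t₂ ×ˢ Icc x₁ x₂ \ P) := by
  have ht : t₁ ≤ t₂ := hα.trans (hαβ.trans hβ)
  have hx : x₁ ≤ x₂ := hγ.trans (hγδ.trans hδ)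
  set W : ℝ → ℝ → ℝ := fun t x => Pᶜ.indicator (fun _ => (1:ℝ)) (t, x) with hW
  have hWint : IntegrableOn (Function.uncurry W) (Icc t₁ t₂ ×ˢ Icc x₁ x₂) := by
    refine Integrable.indicator ?_ hP.measurableSet.compl
    exact integrableOn_const (volume_Icc_prod_lt_top _ _ _ _).ne
  have hJint := integrableOn_derivOn ha hP hanch hd
  have hvol : volume.real (Icc t₁ t₂ ×ˢ Icc x₁ x₂ \ P) = ∫ x in x₁..x₂, ∫ t in t₁..t₂, W t x := by
    rw [← integral_Icc_prod ht hx hWint]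
    simp only [hW]
    rw [setIntegral_indicator hP.measurableSet.compl, setIntegral_const, smul_eq_mul, mul_one,
      Set.sdiff_eq]
  have hslice : ∀ {F : ℝ → ℝ → ℝ}, IntegrableOn (Function.uncurry F) (Icc t₁ t₂ ×ˢ Icc x₁ x₂) →
      IntervalIntegrable (fun x => ∫ t in t₁..t₂, F t x) volume x₁ x₂ := by
    intro F hF
    rw [intervalIntegrable_iff_integrableOn_Icc_of_le hx]
    simp only [intervalIntegral.integral_of_le ht, ← integral_Icc_eq_integral_Ioc]
    rw [IntegrableOn, Measure.volume_eq_prod, ← Measure.prod_restrict] at hF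
    exact hF.integral_prod_right
  rw [integral_Icc_prod ht hx hJint, hvol]
  have hI := hslice hJint
  have hw := hslice hWint
  have hsub1 : uIcc γ δ ⊆ uIcc x₁ x₂ := by
    rw [uIcc_of_le hγδ, uIcc_of_le hx]; exact Icc_subset_Icc hγ hδ
  have hsub2 : uIcc x₁ γ ⊆ uIcc x₁ x₂ := by
    rw [uIcc_of_le hγ, uIcc_of_le hx]; exact Icc_subset_Icc le_rfl (hγδ.trans hδ)
  have hsub3 : uIcc δ x₂ ⊆ uIcc x₁ x₂ := by
    rw [uIcc_of_le hδ, uIcc_of_le hx]; exact Icc_subset_Icc (hγ.trans hγδ) le_rfl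
  have hzero : ∀ x ∈ Icc x₁ x₂, x ∉ Icc γ δ → ∫ t in t₁..t₂, derivOn P a t x = 0 := by
    intro x hx1 hx2
    refine intervalIntegral.integral_zero_ae (.of_forall fun t ht' => ?_)
    refine indicator_of_notMem (fun hp => hx2 ?_) _
    rw [uIoc_of_le ht] at ht'
    exact (hbox ⟨hp, Ioc_subset_Icc_self ht', hx1⟩).2
  have hz1 : ∫ x in x₁..γ, ∫ t in t₁..t₂, derivOn P a t x = 0 := by
    have e1 : ∀ᵐ t : ℝ, t ≠ γ := by simp [ae_iff]
    refine intervalIntegral.integral_zero_ae (e1.mono fun x hne hx' => ?_)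
    rw [uIoc_of_le hγ] at hx'
    exact hzero x ⟨hx'.1.le, hx'.2.trans (hγδ.trans hδ)⟩ fun h => hne (le_antisymm hx'.2 h.1)
  have hz2 : ∫ x in δ..x₂, ∫ t in t₁..t₂, derivOn P a t x = 0 := by
    refine intervalIntegral.integral_zero_ae (.of_forall fun x hx' => ?_)
    rw [uIoc_of_le hδ] at hx'
    exact hzero x ⟨(hγ.trans hγδ).trans hx'.1.le, hx'.2⟩ fun h => absurd h.2 (not_le.2 hx'.1)
  have hsplit : ∫ x in x₁..x₂, ∫ t in t₁..t₂, derivOn P a t x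
      = ∫ x in γ..δ, ∫ t in t₁..t₂, derivOn P a t x := by
    rw [← intervalIntegral.integral_add_adjacent_intervals (hI.mono_set hsub2)
      ((hI.mono_set hsub1).trans (hI.mono_set hsub3)),
      ← intervalIntegral.integral_add_adjacent_intervals (hI.mono_set hsub1) (hI.mono_set hsub3),
      hz1, hz2]
    ring
  have hw0 : ∀ x, 0 ≤ ∫ t in t₁..t₂, W t x := fun x =>
    intervalIntegral.integral_nonneg ht fun t _ => indicator_nonneg (fun _ _ => zero_le_one) _
  have hC0 : 0 ≤ N * (1 + 3 * κ) := by positivity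
  rw [hsplit, ← intervalIntegral.integral_sub ((ha.intRight _ _ _).sub (ha.intRight _ _ _))
    (hI.mono_set hsub1)]
  have hfib : ∀ x ∈ Ioo γ δ, |a β x - a α x - ∫ t in t₁..t₂, derivOn P a t x|
      ≤ N * (1 + 3 * κ) * ∫ t in t₁..t₂, W t x := by
    intro x hxγδ
    set C : Set ℝ := Icc t₁ t₂ ∩ (fun t => (t, x)) ⁻¹' P with hCdef
    have hC : IsClosed C := isClosed_Icc.inter (hP.preimage (by fun_prop))
    have hxQ : x ∈ Icc x₁ x₂ := ⟨hγ.trans hxγδ.1.le, hxγδ.2.le.trans hδ⟩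
    have hCs : C ⊆ Icc α β := fun t h => (hbox ⟨h.2, h.1, hxQ⟩).1
    have hJ : ∫ t in t₁..t₂, derivOn P a t x = ∫ t in C, deriv (fun s => a s x) t := by
      rw [intervalIntegral.integral_of_le ht, ← integral_Icc_eq_integral_Ioc, hCdef,
        ← setIntegral_indicator (hP.preimage (by fun_prop)).measurableSet]
      rfl
    have hWx : ∫ t in t₁..t₂, W t x = volume.real (Icc t₁ t₂ \ C) := by
      rw [intervalIntegral.integral_of_le ht, ← integral_Icc_eq_integral_Ioc]
      have : ∀ t, W t x = ((fun t => (t, x)) ⁻¹' P)ᶜ.indicator (fun _ => (1:ℝ)) t := fun t => rfl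
      simp only [this]
      rw [setIntegral_indicator (hP.preimage (by fun_prop)).measurableSet.compl,
        setIntegral_const, smul_eq_mul, mul_one, hCdef, sdiff_self_inter, Set.sdiff_eq]
    rw [hJ, hWx]
    rcases C.eq_empty_or_nonempty with hem | hne
    · obtain ⟨y, hy, hyP⟩ := hαP
      obtain ⟨z, hz, hzP⟩ := hβP
      have hyA := hanch _ hyP ⟨⟨hα, hαβ.trans hβ⟩, ⟨hγ.trans hy.1, hy.2.trans hδ⟩⟩
      have hzA := hanch _ hzP ⟨⟨hα.trans hαβ, hβ⟩, ⟨hγ.trans hz.1, hz.2.trans hδ⟩⟩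
      have h1 := hyA.2 x
      have h2 := hyA.1 β
      have h3 := hzA.2 x
      have h4 := hzA.2 y
      simp only at h1 h2 h3 h4
      have hb : ∀ u ∈ Icc γ δ, ∀ v ∈ Icc γ δ, |u - v| ≤ x₂ - x₁ := by
        intro u hu v hv
        rw [abs_le]
        constructor <;> linarith [hu.1, hu.2, hv.1, hv.2]
      have hxm : x ∈ Icc γ δ := Ioo_subset_Icc_self hxγδ
      have g1 := mul_le_mul_of_nonneg_left (hb x hxm y hy) hN
      have g3 := mul_le_mul_of_nonneg_left (hb x hxm z hz) hN
      have g4 := mul_le_mul_of_nonneg_left (hb y hy z hz) hN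
      have g2 : N * |β - α| ≤ N * (t₂ - t₁) := by
        rw [abs_of_nonneg (by linarith)]
        exact mul_le_mul_of_nonneg_left (by linarith) hN
      have g5 := mul_le_mul_of_nonneg_left hκ hN
      rw [hem]
      simp only [Measure.restrict_empty, integral_zero_measure, sub_zero, sdiff_empty,
        Real.volume_real_Icc_of_le ht]
      rw [abs_le] at *
      constructor <;> linarith
    · refine (abs_sub_sub_setIntegral_le (h := fun s => a s x) hαβ hN hC hCs hne ?_ ?_).trans ?_
      · intro t ht' s
        exact (hanch _ ht'.2 ⟨ht'.1, hxQ⟩).1 s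
      · intro t _ ht'
        exact (hd t ⟨hα.trans_lt ht'.1, ht'.2.trans_le hβ⟩ x
          ⟨hγ.trans_lt hxγδ.1, hxγδ.2.trans_le hδ⟩).hasDerivAt
      · have h1 : volume.real (Icc α β \ C) ≤ volume.real (Icc t₁ t₂ \ C) :=
          measureReal_mono (sdiff_subset_sdiff_left (Icc_subset_Icc hα hβ))
            ((measure_mono sdiff_subset).trans_lt measure_Icc_lt_top).ne
        refine mul_le_mul ?_ h1 measureReal_nonneg hC0
        nlinarith [mul_nonneg hN hκ0]
  calc _ ≤ ∫ x in γ..δ, N * (1 + 3 * κ) * ∫ t in t₁..t₂, W t x := by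
        have e1 : ∀ᵐ t : ℝ, t ≠ δ := by simp [ae_iff]
        rw [← Real.norm_eq_abs]
        refine intervalIntegral.norm_integral_le_of_norm_le hγδ (e1.mono fun x hne hx' => ?_)
          ((hw.mono_set hsub1).const_mul _)
        exact hfib x ⟨hx'.1, lt_of_le_of_ne hx'.2 hne⟩
    _ ≤ ∫ x in x₁..x₂, N * (1 + 3 * κ) * ∫ t in t₁..t₂, W t x :=
        intervalIntegral.integral_mono_interval hγ hγδ hδ
          (.of_forall fun x => mul_nonneg hC0 (hw0 x)) (hw.const_mul _)
    _ = _ := intervalIntegral.integral_const_mul _ _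

theorem eq_zero_of_forall_Ico {φ : ℝ → ℝ} (hφ : Continuous φ) {u v : ℝ} (huv : u < v)
    (h : ∀ s ∈ Ico u v, φ s = 0) : φ v = 0 := by
  have : IsClosed {s | φ s = 0} := isClosed_eq hφ continuous_const
  have h2 := this.closure_subset_iff.2 (fun s hs => h s hs : Ico u v ⊆ {s | φ s = 0})
  rw [closure_Ico huv.ne] at h2
  exact h2 ⟨huv.le, le_rfl⟩

theorem eq_zero_of_forall_Ioc {φ : ℝ → ℝ} (hφ : Continuous φ) {u v : ℝ} (huv : u < v)
    (h : ∀ s ∈ Ioc u v, φ s = 0) : φ u = 0 := by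
  have : IsClosed {s | φ s = 0} := isClosed_eq hφ continuous_const
  have h2 := this.closure_subset_iff.2 (fun s hs => h s hs : Ioc u v ⊆ {s | φ s = 0})
  rw [closure_Ioc huv.ne] at h2
  exact h2 ⟨le_rfl, huv.le⟩

theorem rectDefect_self_left (a b f : ℝ → ℝ → ℝ) (t x₁ x₂ : ℝ) :
    rectDefect a b f t t x₁ x₂ = 0 := by simp [rectDefect]

theorem rectDefect_self_right (a b f : ℝ → ℝ → ℝ) (t₁ t₂ x : ℝ) :
    rectDefect a b f t₁ t₂ x x = 0 := by simp [rectDefect]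

theorem setIntegral_prod_swap (F : ℝ × ℝ → ℝ) (s t : Set ℝ) :
    ∫ p in t ×ˢ s, F p.swap = ∫ p in s ×ˢ t, F p := by
  have h := (Measure.measurePreserving_swap (μ := (volume : Measure ℝ))
    (ν := (volume : Measure ℝ))).setIntegral_preimage_emb
      MeasurableEquiv.prodComm.measurableEmbedding F (s ×ˢ t)
  rw [preimage_swap_prod] at h
  exact h

theorem volume_real_preimage_swap {s : Set (ℝ × ℝ)} (hs : MeasurableSet s) :
    volume.real (Prod.swap ⁻¹' s) = volume.real s := by
  rw [Measure.real, Measure.real, Measure.volume_eq_prod,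
    Measure.measurePreserving_swap.measure_preimage hs.nullMeasurableSet]

/-- The defect of the Green formula on a rectangle is controlled by the measure of the complement
of any closed set of uniformly anchored points outside which the defect vanishes. -/
theorem abs_rectDefect_le {P : Set (ℝ × ℝ)} {a b f : ℝ → ℝ → ℝ} {N κ F t₁ t₂ x₁ x₂ : ℝ}
    (ha : SepReg a) (hb : SepReg b) (hf : SepReg f) (hP : IsClosed P) (hN : 0 ≤ N)
    (haN : ∀ p ∈ P, p ∈ Icc t₁ t₂ ×ˢ Icc x₁ x₂ → Anchored a N p)
    (hbN : ∀ p ∈ P, p ∈ Icc t₁ t₂ ×ˢ Icc x₁ x₂ → Anchored b N p)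
    (hda : ∀ t ∈ Ioo t₁ t₂, ∀ x ∈ Ioo x₁ x₂, DifferentiableAt ℝ (fun s => a s x) t)
    (hdb : ∀ t ∈ Ioo t₁ t₂, ∀ x ∈ Ioo x₁ x₂, DifferentiableAt ℝ (fun y => b t y) x)
    (heq : ∀ t ∈ Ioo t₁ t₂, ∀ x ∈ Ioo x₁ x₂,
      deriv (fun s => a s x) t + deriv (fun y => b t y) x = f t x)
    (hF : ∀ t ∈ Icc t₁ t₂, ∀ x ∈ Icc x₁ x₂, |f t x| ≤ F)
    (hκ0 : 0 ≤ κ) (hκ1 : x₂ - x₁ ≤ κ * (t₂ - t₁)) (hκ2 : t₂ - t₁ ≤ κ * (x₂ - x₁))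
    (hne : (P ∩ Icc t₁ t₂ ×ˢ Icc x₁ x₂).Nonempty)
    (hzero : ∀ s₁ s₂ y₁ y₂, t₁ ≤ s₁ → s₁ ≤ s₂ → s₂ ≤ t₂ → x₁ ≤ y₁ → y₁ ≤ y₂ → y₂ ≤ x₂ →
      P ∩ Icc s₁ s₂ ×ˢ Icc y₁ y₂ = ∅ → rectDefect a b f s₁ s₂ y₁ y₂ = 0) :
    |rectDefect a b f t₁ t₂ x₁ x₂| ≤
      (2 * (N * (1 + 3 * κ)) + F) * volume.real (Icc t₁ t₂ ×ˢ Icc x₁ x₂ \ P) := by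
  set Q : Set (ℝ × ℝ) := Icc t₁ t₂ ×ˢ Icc x₁ x₂ with hQ
  have hQm : MeasurableSet Q := measurableSet_Icc.prod measurableSet_Icc
  have hcpt : IsCompact (P ∩ Q) := (isCompact_Icc.prod isCompact_Icc).inter_left hP
  obtain ⟨pα, hpα, hα⟩ := hcpt.exists_isMinOn hne continuous_fst.continuousOn
  obtain ⟨pβ, hpβ, hβ⟩ := hcpt.exists_isMaxOn hne continuous_fst.continuousOn
  obtain ⟨pγ, hpγ, hγ⟩ := hcpt.exists_isMinOn hne continuous_snd.continuousOn
  obtain ⟨pδ, hpδ, hδ⟩ := hcpt.exists_isMaxOn hne continuous_snd.continuousOn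
  set α := pα.1
  set β := pβ.1
  set γ := pγ.2
  set δ := pδ.2
  have hbox : P ∩ Q ⊆ Icc α β ×ˢ Icc γ δ := fun p hp =>
    ⟨⟨hα hp, hβ hp⟩, ⟨hγ hp, hδ hp⟩⟩
  have hαβ : α ≤ β := hα hpβ
  have hγδ : γ ≤ δ := hγ hpδ
  have htα : t₁ ≤ α := hpα.2.1.1
  have htβ : β ≤ t₂ := hpβ.2.1.2
  have hxγ : x₁ ≤ γ := hpγ.2.2.1
  have hxδ : δ ≤ x₂ := hpδ.2.2.2
  have ht : t₁ ≤ t₂ := htα.trans (hαβ.trans htβ)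
  have hx : x₁ ≤ x₂ := hxγ.trans (hγδ.trans hxδ)
  have hdisj : ∀ s₁ s₂ y₁ y₂, t₁ ≤ s₁ → s₂ ≤ t₂ → x₁ ≤ y₁ → y₂ ≤ x₂ →
      (s₂ < α ∨ β < s₁ ∨ y₂ < γ ∨ δ < y₁) → P ∩ Icc s₁ s₂ ×ˢ Icc y₁ y₂ = ∅ := by
    intro s₁ s₂ y₁ y₂ h1 h2 h3 h4 h5
    rw [eq_empty_iff_forall_notMem]
    rintro p ⟨hpP, hp1, hp2⟩
    obtain ⟨⟨g1, g2⟩, g3, g4⟩ := hbox ⟨hpP, ⟨h1.trans hp1.1, hp1.2.trans h2⟩,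
      ⟨h3.trans hp2.1, hp2.2.trans h4⟩⟩
    rcases h5 with h | h | h | h
    · linarith [hp1.2]
    · linarith [hp1.1]
    · linarith [hp2.2]
    · linarith [hp2.1]
  have z1 : rectDefect a b f t₁ α x₁ x₂ = 0 := by
    rcases htα.eq_or_lt with h | h
    · rw [← h, rectDefect_self_left]
    · refine eq_zero_of_forall_Ico (continuous_rectDefect_left ha hb hf t₁ x₁ x₂) h fun s hs => ?_
      exact hzero _ _ _ _ le_rfl hs.1 (hs.2.le.trans (hαβ.trans htβ)) le_rfl hx le_rfl
        (hdisj _ _ _ _ le_rfl (hs.2.le.trans (hαβ.trans htβ)) le_rfl le_rfl (Or.inl hs.2))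
  have z2 : rectDefect a b f β t₂ x₁ x₂ = 0 := by
    rcases htβ.eq_or_lt with h | h
    · rw [← h, rectDefect_self_left]
    · have hc : Continuous fun s => rectDefect a b f s t₂ x₁ x₂ := by
        have := (continuous_const (y := rectDefect a b f t₁ t₂ x₁ x₂)).sub
          (continuous_rectDefect_left ha hb hf t₁ x₁ x₂)
        refine this.congr fun s => ?_
        rw [Pi.sub_apply, ← rectDefect_add_left ha hb hf t₁ s t₂]
        ring
      refine eq_zero_of_forall_Ioc hc h fun s hs => ?_
      exact hzero _ _ _ _ (htα.trans (hαβ.trans hs.1.le)) hs.2 le_rfl le_rfl hx le_rfl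
        (hdisj _ _ _ _ (htα.trans (hαβ.trans hs.1.le)) le_rfl le_rfl le_rfl (Or.inr (Or.inl hs.1)))
  have z3 : rectDefect a b f α β x₁ γ = 0 := by
    rcases hxγ.eq_or_lt with h | h
    · rw [← h, rectDefect_self_right]
    · refine eq_zero_of_forall_Ico (continuous_rectDefect_right ha hb hf α β x₁) h fun s hs => ?_
      exact hzero _ _ _ _ htα hαβ htβ le_rfl hs.1 (hs.2.le.trans (hγδ.trans hxδ))
        (hdisj _ _ _ _ htα htβ le_rfl (hs.2.le.trans (hγδ.trans hxδ)) (Or.inr (Or.inr (Or.inl hs.2))))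
  have z4 : rectDefect a b f α β δ x₂ = 0 := by
    rcases hxδ.eq_or_lt with h | h
    · rw [← h, rectDefect_self_right]
    · have hc : Continuous fun s => rectDefect a b f α β s x₂ := by
        have := (continuous_const (y := rectDefect a b f α β x₁ x₂)).sub
          (continuous_rectDefect_right ha hb hf α β x₁)
        refine this.congr fun s => ?_
        rw [Pi.sub_apply, ← rectDefect_add_right ha hb hf α β x₁ s x₂]
        ring
      refine eq_zero_of_forall_Ioc hc h fun s hs => ?_
      exact hzero _ _ _ _ htα hαβ htβ (hxγ.trans (hγδ.trans hs.1.le)) hs.2 le_rfl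
        (hdisj _ _ _ _ htα htβ (hxγ.trans (hγδ.trans hs.1.le)) le_rfl (Or.inr (Or.inr (Or.inr hs.1))))
  have hZ : rectDefect a b f t₁ t₂ x₁ x₂ = rectDefect a b f α β γ δ := by
    rw [← rectDefect_add_left ha hb hf t₁ α t₂, ← rectDefect_add_left ha hb hf α β t₂,
      ← rectDefect_add_right ha hb hf α β x₁ γ x₂, ← rectDefect_add_right ha hb hf α β γ δ x₂,
      z1, z2, z3, z4]
    ring
  have E1 := abs_integral_sub_integral_derivOn_le ha hP hN haN hda hαβ hγδ htα htβ hxγ hxδ hbox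
    ⟨pα.2, (hbox hpα).2, hpα.1⟩ ⟨pβ.2, (hbox hpβ).2, hpβ.1⟩ hκ0 hκ1
  have E2 := abs_integral_sub_integral_derivOn_le (P := Prod.swap ⁻¹' P) (a := fun x t => b t x)
    (t₁ := x₁) (t₂ := x₂) (x₁ := t₁) (x₂ := t₂) (α := γ) (β := δ) (γ := α) (δ := β) (κ := κ)
    hb.swap (hP.preimage continuous_swap) hN
    (fun p hp hpQ => (hbN p.swap hp ⟨hpQ.2, hpQ.1⟩).swap)
    (fun x hx t ht => hdb t ht x hx) hγδ hαβ hxγ hxδ htα htβ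
    (fun p hp => (hbox ⟨hp.1, hp.2.2, hp.2.1⟩).symm)
    ⟨pγ.1, (hbox hpγ).1, hpγ.1⟩ ⟨pδ.1, (hbox hpδ).1, hpδ.1⟩ hκ0 hκ2
  have hJa : IntegrableOn (fun p : ℝ × ℝ => derivOn P a p.1 p.2) Q :=
    integrableOn_derivOn ha hP haN hda
  set Jb : ℝ × ℝ → ℝ := fun p => derivOn (Prod.swap ⁻¹' P) (fun x t => b t x) p.2 p.1 with hJbdef
  have hJb : IntegrableOn Jb Q := by
    have h := integrableOn_derivOn (P := Prod.swap ⁻¹' P) (a := fun x t => b t x)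
      (t₁ := x₁) (t₂ := x₂) (x₁ := t₁) (x₂ := t₂) hb.swap (hP.preimage continuous_swap)
      (fun p hp hpQ => (hbN p.swap hp ⟨hpQ.2, hpQ.1⟩).swap) (fun x hx t ht => hdb t ht x hx)
    have h' := (Measure.measurePreserving_swap (μ := (volume : Measure ℝ))
      (ν := (volume : Measure ℝ))).integrableOn_comp_preimage
      MeasurableEquiv.prodComm.measurableEmbedding (f := Function.uncurry (derivOn (Prod.swap ⁻¹' P)
      (fun x t => b t x))) (s := Icc x₁ x₂ ×ˢ Icc t₁ t₂)
    rw [preimage_swap_prod] at h'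
    exact h'.2 h
  have hswap : ∫ p in Icc x₁ x₂ ×ˢ Icc t₁ t₂, derivOn (Prod.swap ⁻¹' P) (fun x t => b t x) p.1 p.2
      = ∫ p in Q, Jb p := setIntegral_prod_swap Jb (Icc t₁ t₂) (Icc x₁ x₂)
  have hvol : volume.real (Icc x₁ x₂ ×ˢ Icc t₁ t₂ \ Prod.swap ⁻¹' P) = volume.real (Q \ P) := by
    rw [← volume_real_preimage_swap (hQm.diff hP.measurableSet), preimage_sdiff, hQ,
      preimage_swap_prod]
  rw [hswap, hvol] at E2
  have hfQ : IntegrableOn (fun p : ℝ × ℝ => f p.1 p.2) Q := hf.integrableOn_prod _ _ _ _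
  have hsum : (∫ p in Q, derivOn P a p.1 p.2) + ∫ p in Q, Jb p = ∫ p in P ∩ Q, f p.1 p.2 := by
    rw [← integral_add hJa hJb, inter_comm, ← setIntegral_indicator hP.measurableSet,
      hQ, setIntegral_congr_set (Icc_prod_ae_eq_Ioo_prod t₁ t₂ x₁ x₂).symm,
      setIntegral_congr_set (Icc_prod_ae_eq_Ioo_prod t₁ t₂ x₁ x₂).symm]
    refine setIntegral_congr_fun (measurableSet_Ioo.prod measurableSet_Ioo) fun p hp => ?_
    simp only [hJbdef, derivOn]
    by_cases hpP : p ∈ P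
    · have h1 : (p.1, p.2) ∈ P := hpP
      have h2 : (p.2, p.1) ∈ Prod.swap ⁻¹' P := hpP
      rw [indicator_of_mem h1, indicator_of_mem h2, indicator_of_mem hpP]
      exact heq _ hp.1 _ hp.2
    · have h1 : (p.1, p.2) ∉ P := hpP
      have h2 : (p.2, p.1) ∉ Prod.swap ⁻¹' P := hpP
      rw [indicator_of_notMem h1, indicator_of_notMem h2, indicator_of_notMem hpP, add_zero]
  have hRQ : Icc α β ×ˢ Icc γ δ ⊆ Q :=
    prod_mono (Icc_subset_Icc htα htβ) (Icc_subset_Icc hxγ hxδ)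
  have hfR : ∫ t in α..β, ∫ x in γ..δ, f t x
      = (∫ p in P ∩ Q, f p.1 p.2) + ∫ p in (Icc α β ×ˢ Icc γ δ) \ P, f p.1 p.2 := by
    rw [hf.fubini hαβ hγδ, ← integral_Icc_prod hαβ hγδ (hf.integrableOn_prod _ _ _ _)]
    have hPQ : P ∩ Q = (Icc α β ×ˢ Icc γ δ) ∩ P :=
      Subset.antisymm (fun p hp => ⟨hbox hp, hp.1⟩) fun p hp => ⟨hp.2, hRQ hp.1⟩
    rw [hPQ, integral_inter_add_sdiff hP.measurableSet (hfQ.mono_set hRQ)]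
  have E3 : |∫ p in (Icc α β ×ˢ Icc γ δ) \ P, f p.1 p.2| ≤ F * volume.real (Q \ P) := by
    have hfin : volume (Q \ P) < ⊤ := (measure_mono sdiff_subset).trans_lt
      (volume_Icc_prod_lt_top _ _ _ _)
    have hF0 : 0 ≤ F := (abs_nonneg _).trans (hF t₁ ⟨le_rfl, ht⟩ x₁ ⟨le_rfl, hx⟩)
    rw [← Real.norm_eq_abs]
    refine (norm_setIntegral_le_of_norm_le_const (C := F)
      ((measure_mono (sdiff_subset_sdiff_left hRQ)).trans_lt hfin) fun p hp => ?_).trans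
      (mul_le_mul_of_nonneg_left (measureReal_mono (sdiff_subset_sdiff_left hRQ) hfin.ne) hF0)
    exact hF _ (hRQ hp.1).1 _ (hRQ hp.1).2
  rw [hZ, rectDefect, hfR, ← hsum]
  rw [abs_le] at *
  constructor <;> linarith [E1.1, E1.2, E2.1, E2.2, E3.1, E3.2]

theorem rectDefect_quarter {a b f : ℝ → ℝ → ℝ} (ha : SepReg a) (hb : SepReg b) (hf : SepReg f)
    (t₁ t₂ t₃ x₁ x₂ x₃ : ℝ) :
    rectDefect a b f t₁ t₃ x₁ x₃ = rectDefect a b f t₁ t₂ x₁ x₂ + rectDefect a b f t₂ t₃ x₁ x₂ +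
      rectDefect a b f t₁ t₂ x₂ x₃ + rectDefect a b f t₂ t₃ x₂ x₃ := by
  rw [← rectDefect_add_right ha hb hf t₁ t₃ x₁ x₂ x₃, ← rectDefect_add_left ha hb hf t₁ t₂ t₃,
    ← rectDefect_add_left ha hb hf t₁ t₂ t₃]
  ring

theorem volume_real_Ioc_prod_quarter {S : Set (ℝ × ℝ)} (hS : MeasurableSet S)
    {t₁ t₂ t₃ x₁ x₂ x₃ : ℝ} (h1 : t₁ ≤ t₂) (h2 : t₂ ≤ t₃) (h3 : x₁ ≤ x₂) (h4 : x₂ ≤ x₃) :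
    volume.real (Ioc t₁ t₃ ×ˢ Ioc x₁ x₃ \ S) =
      volume.real (Ioc t₁ t₂ ×ˢ Ioc x₁ x₂ \ S) + volume.real (Ioc t₂ t₃ ×ˢ Ioc x₁ x₂ \ S) +
      volume.real (Ioc t₁ t₂ ×ˢ Ioc x₂ x₃ \ S) + volume.real (Ioc t₂ t₃ ×ˢ Ioc x₂ x₃ \ S) := by
  have hfin : ∀ u v y z : ℝ, volume (Ioc u v ×ˢ Ioc y z \ S : Set (ℝ × ℝ)) ≠ ⊤ := fun u v y z =>
    ((measure_mono (sdiff_subset.trans (Set.prod_mono Ioc_subset_Icc_self Ioc_subset_Icc_self))).trans_lt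
      (volume_Icc_prod_lt_top u v y z)).ne
  have hm : ∀ u v y z : ℝ, MeasurableSet (Ioc u v ×ˢ Ioc y z \ S : Set (ℝ × ℝ)) := fun u v y z =>
    (measurableSet_Ioc.prod measurableSet_Ioc).diff hS
  have A : ∀ y z, volume.real (Ioc t₁ t₃ ×ˢ Ioc y z \ S) =
      volume.real (Ioc t₁ t₂ ×ˢ Ioc y z \ S) + volume.real (Ioc t₂ t₃ ×ˢ Ioc y z \ S) := by
    intro y z
    rw [← measureReal_union _ (hm _ _ _ _) (hfin _ _ _ _) (hfin _ _ _ _), ← union_sdiff_distrib,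
      ← union_prod, Ioc_union_Ioc_eq_Ioc h1 h2]
    refine disjoint_left.2 fun p hp hq => ?_
    exact absurd hp.1.1.2 (not_le.2 hq.1.1.1)
  have B : volume.real (Ioc t₁ t₃ ×ˢ Ioc x₁ x₃ \ S) =
      volume.real (Ioc t₁ t₃ ×ˢ Ioc x₁ x₂ \ S) + volume.real (Ioc t₁ t₃ ×ˢ Ioc x₂ x₃ \ S) := by
    rw [← measureReal_union _ (hm _ _ _ _) (hfin _ _ _ _) (hfin _ _ _ _), ← union_sdiff_distrib,
      ← prod_union, Ioc_union_Ioc_eq_Ioc h3 h4]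
    refine disjoint_left.2 fun p hp hq => ?_
    exact absurd hp.1.2.2 (not_le.2 hq.1.2.1)
  rw [B, A, A]
  ring

theorem exists_pow_div_lt {l m ε : ℝ} (hε : 0 < ε) : ∃ n : ℕ, l / 2 ^ n < ε ∧ m / 2 ^ n < ε := by
  have h : ∀ c : ℝ, Tendsto (fun n : ℕ => c / 2 ^ n) atTop (𝓝 0) := fun c => by
    simpa [div_eq_mul_inv] using
      (tendsto_pow_atTop_nhds_zero_of_lt_one (by norm_num : (0:ℝ) ≤ 2⁻¹) (by norm_num)).const_mul c
  exact (((h l).eventually_lt_const hε).and ((h m).eventually_lt_const hε)).exists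

theorem Icc_prod_subset_ball {p : ℝ × ℝ} {t l x m ε : ℝ}
    (hp : p ∈ Icc t (t + l) ×ˢ Icc x (x + m)) (hl : l < ε) (hm : m < ε) :
    Icc t (t + l) ×ˢ Icc x (x + m) ⊆ Metric.ball p ε := by
  intro q hq
  rw [Metric.mem_ball, Prod.dist_eq, max_lt_iff, Real.dist_eq, Real.dist_eq, abs_lt, abs_lt]
  obtain ⟨⟨a1, a2⟩, a3, a4⟩ := hp
  obtain ⟨⟨b1, b2⟩, b3, b4⟩ := hq
  refine ⟨⟨?_, ?_⟩, ?_, ?_⟩ <;> linarith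

/-- Green formula for separately differentiable fields: a theorem of Looman–Menchoff type. -/
theorem rectDefect_eq_zero {a b f : ℝ → ℝ → ℝ} {A B C D : ℝ}
    (ha : SepReg a) (hb : SepReg b) (hf : SepReg f)
    (haN : ∀ p, ∃ N, Anchored a N p) (hbN : ∀ p, ∃ N, Anchored b N p)
    (hda : ∀ t ∈ Ioo A B, ∀ x ∈ Ioo C D, DifferentiableAt ℝ (fun s => a s x) t)
    (hdb : ∀ t ∈ Ioo A B, ∀ x ∈ Ioo C D, DifferentiableAt ℝ (fun y => b t y) x)
    (heq : ∀ t ∈ Ioo A B, ∀ x ∈ Ioo C D,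
      deriv (fun s => a s x) t + deriv (fun y => b t y) x = f t x)
    {t₁ t₂ x₁ x₂ : ℝ} (h1 : A ≤ t₁) (h2 : t₁ ≤ t₂) (h3 : t₂ ≤ B)
    (h4 : C ≤ x₁) (h5 : x₁ ≤ x₂) (h6 : x₂ ≤ D) :
    rectDefect a b f t₁ t₂ x₁ x₂ = 0 := by
  set Good : Set (ℝ × ℝ) := {p | ∃ ε > 0, ∀ s₁ s₂ y₁ y₂, A ≤ s₁ → s₁ ≤ s₂ → s₂ ≤ B → C ≤ y₁ →
    y₁ ≤ y₂ → y₂ ≤ D → Icc s₁ s₂ ×ˢ Icc y₁ y₂ ⊆ Metric.ball p ε →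
    rectDefect a b f s₁ s₂ y₁ y₂ = 0} with hGood
  have hGo : IsOpen Good := by
    rw [Metric.isOpen_iff]
    rintro p ⟨ε, hε, hp⟩
    refine ⟨ε / 2, by positivity, fun q hq => ⟨ε / 2, by positivity, ?_⟩⟩
    intro s₁ s₂ y₁ y₂ g1 g2 g3 g4 g5 g6 g7
    refine hp s₁ s₂ y₁ y₂ g1 g2 g3 g4 g5 g6 (g7.trans ?_)
    refine Metric.ball_subset_ball' ?_
    rw [Metric.mem_ball] at hq
    linarith
  set P : Set (ℝ × ℝ) := (Icc A B ×ˢ Icc C D) \ Good with hPdef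
  have hP : IsClosed P := (isClosed_Icc.prod isClosed_Icc).sdiff hGo
  have hsubZ : ∀ t l x m, |rectDefect a b f t (t + 2 * l) x (x + 2 * m)| ≤
      |rectDefect a b f t (t + l) x (x + m)| + |rectDefect a b f (t + l) (t + 2 * l) x (x + m)| +
      |rectDefect a b f t (t + l) (x + m) (x + 2 * m)| +
      |rectDefect a b f (t + l) (t + 2 * l) (x + m) (x + 2 * m)| := by
    intro t l x m
    rw [rectDefect_quarter ha hb hf t (t + l) (t + 2 * l) x (x + m)]
    exact (abs_add_le _ _).trans (add_le_add_left ((abs_add_le _ _).trans (add_le_add_left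
      (abs_add_le _ _) _)) _)
  have hloc : ∀ s₁ s₂ y₁ y₂, A ≤ s₁ → s₁ ≤ s₂ → s₂ ≤ B → C ≤ y₁ → y₁ ≤ y₂ → y₂ ≤ D →
      P ∩ Icc s₁ s₂ ×ˢ Icc y₁ y₂ = ∅ → rectDefect a b f s₁ s₂ y₁ y₂ = 0 := by
    intro s₁ s₂ y₁ y₂ g1 g2 g3 g4 g5 g6 g7
    by_contra hne
    obtain ⟨l, rfl⟩ : ∃ l, s₂ = s₁ + l := ⟨s₂ - s₁, by ring⟩
    obtain ⟨m, rfl⟩ : ∃ m, y₂ = y₁ + m := ⟨y₂ - y₁, by ring⟩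
    have hl : 0 ≤ l := by linarith
    have hm : 0 ≤ m := by linarith
    obtain ⟨p, hp⟩ := exists_forall_dyadic_pos (Ψ := fun s₁ s₂ y₁ y₂ => |rectDefect a b f s₁ s₂ y₁ y₂|)
      (fun t l x m _ _ => hsubZ t l x m) hl hm (abs_pos.2 hne)
    have hpQ : p ∈ Icc s₁ (s₁ + l) ×ˢ Icc y₁ (y₁ + m) := by
      obtain ⟨t', x', k1, k2, k3, k4, k5, -⟩ := hp 0
      exact ⟨⟨k1.trans k5.1.1, k5.1.2.trans k2⟩, ⟨k3.trans k5.2.1, k5.2.2.trans k4⟩⟩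
    have hpG : p ∈ Good := by
      by_contra hpG
      have : p ∈ P ∩ Icc s₁ (s₁ + l) ×ˢ Icc y₁ (y₁ + m) :=
        ⟨⟨⟨⟨g1.trans hpQ.1.1, hpQ.1.2.trans g3⟩, ⟨g4.trans hpQ.2.1, hpQ.2.2.trans g6⟩⟩, hpG⟩, hpQ⟩
      rw [g7] at this
      exact this
    obtain ⟨ε, hε, hpε⟩ := hpG
    obtain ⟨n, hn1, hn2⟩ := exists_pow_div_lt (l := l) (m := m) hε
    obtain ⟨t', x', k1, k2, k3, k4, k5, k6⟩ := hp n
    refine k6.ne' (abs_eq_zero.2 (hpε _ _ _ _ (g1.trans k1) ?_ (k2.trans g3) (g4.trans k3) ?_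
      (k4.trans g6) (Icc_prod_subset_ball k5 hn1 hn2)))
    · exact le_add_of_nonneg_right (by positivity)
    · exact le_add_of_nonneg_right (by positivity)
  have hPe : P = ∅ := by
    by_contra hPne
    have hPne : P.Nonempty := nonempty_iff_ne_empty.2 hPne
    have : CompleteSpace P := hP.completeSpace_coe
    have : Nonempty P := hPne.to_subtype
    obtain ⟨n, ⟨p₀, hp₀⟩⟩ := nonempty_interior_of_iUnion_of_closed
      (f := fun n : ℕ => {p : P | Anchored a n p.1 ∧ Anchored b n p.1})
      (fun n => ((isClosed_setOf_anchored ha n).inter (isClosed_setOf_anchored hb n)).preimage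
        continuous_subtype_val) (by
        refine eq_univ_of_forall fun p => mem_iUnion.2 ?_
        obtain ⟨N₁, hN₁⟩ := haN p.1
        obtain ⟨N₂, hN₂⟩ := hbN p.1
        obtain ⟨n, hn⟩ := exists_nat_ge (max N₁ N₂)
        exact ⟨n, hN₁.mono ((le_max_left _ _).trans hn), hN₂.mono ((le_max_right _ _).trans hn)⟩)
    rw [mem_interior_iff_mem_nhds, Metric.mem_nhds_iff] at hp₀
    obtain ⟨r, hr, hball⟩ := hp₀
    obtain ⟨F, hF⟩ := hf.bdd (max (max |A| |B|) (max |C| |D|))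
    refine p₀.2.2 ⟨r, hr, ?_⟩
    intro s₁ s₂ y₁ y₂ g1 g2 g3 g4 g5 g6 g7
    rcases g2.eq_or_lt with rfl | g2'
    · exact rectDefect_self_left _ _ _ _ _ _
    rcases g5.eq_or_lt with rfl | g5'
    · exact rectDefect_self_right _ _ _ _ _ _
    by_contra hne
    obtain ⟨l, rfl⟩ : ∃ l, s₂ = s₁ + l := ⟨s₂ - s₁, by ring⟩
    obtain ⟨m, rfl⟩ : ∃ m, y₂ = y₁ + m := ⟨y₂ - y₁, by ring⟩
    have hl : 0 < l := by linarith
    have hm : 0 < m := by linarith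
    set Q : Set (ℝ × ℝ) := Icc s₁ (s₁ + l) ×ˢ Icc y₁ (y₁ + m) with hQ
    set κ := l / m + m / l with hκ
    have hκ1 : m ≤ κ * l := by
      rw [hκ, add_mul, div_mul_cancel₀ _ hl.ne']
      exact le_add_of_nonneg_left (by positivity)
    have hκ2 : l ≤ κ * m := by
      rw [hκ, add_mul, div_mul_cancel₀ _ hm.ne']
      exact le_add_of_nonneg_right (by positivity)
    set K := 2 * ((n : ℝ) * (1 + 3 * κ)) + F with hK
    have hF' : ∀ t ∈ Icc A B, ∀ x ∈ Icc C D, |f t x| ≤ F := fun t ht x hx =>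
      hF t x ((abs_le_max_abs_abs ht.1 ht.2).trans (le_max_left _ _))
        ((abs_le_max_abs_abs hx.1 hx.2).trans (le_max_right _ _))
    have hF0 : 0 ≤ F := (abs_nonneg _).trans (hF' s₁ ⟨g1, g2.trans g3⟩ y₁ ⟨g4, g5.trans g6⟩)
    have hK0 : 0 ≤ K := by positivity
    have hQP : MeasurableSet (Q \ P) := (measurableSet_Icc.prod measurableSet_Icc).diff hP.measurableSet
    have hQfin : volume (Q \ P) ≠ ⊤ :=
      ((measure_mono sdiff_subset).trans_lt (volume_Icc_prod_lt_top _ _ _ _)).ne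
    set z := |rectDefect a b f s₁ (s₁ + l) y₁ (y₁ + m)| with hz
    have hz0 : 0 < z := abs_pos.2 hne
    obtain ⟨L, hLsub, hL, hLlt⟩ := hQP.exists_isCompact_sdiff_lt hQfin
      (ε := ENNReal.ofReal (z / (K + 1))) (by simp only [ne_eq, ENNReal.ofReal_eq_zero, not_le]; positivity)
    have hS : MeasurableSet (P ∪ L) := (hP.union hL.isClosed).measurableSet
    have hae : ∀ (S : Set (ℝ × ℝ)) (t l x m : ℝ), volume.real (Ioc t l ×ˢ Ioc x m \ S)
        = volume.real (Icc t l ×ˢ Icc x m \ S) := fun S t l x m =>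
      measureReal_congr ((Measure.set_prod_ae_eq Ioc_ae_eq_Icc Ioc_ae_eq_Icc).diff (ae_eq_refl S))
    obtain ⟨p, hp⟩ := exists_forall_dyadic_pos (Ψ := fun s₁ s₂ y₁ y₂ =>
        |rectDefect a b f s₁ s₂ y₁ y₂| - K * volume.real (Ioc s₁ s₂ ×ˢ Ioc y₁ y₂ \ (P ∪ L)))
      (t := s₁) (l := l) (x := y₁) (m := m) (fun t l x m hl hm => by
        have q1 := hsubZ t l x m
        have q2 := volume_real_Ioc_prod_quarter hS (t₁ := t) (t₂ := t + l) (t₃ := t + 2 * l)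
          (x₁ := x) (x₂ := x + m) (x₃ := x + 2 * m)
          (by linarith) (by linarith) (by linarith) (by linarith)
        simp only [q2]
        linarith) hl.le hm.le (by
        simp only [hae, sub_pos]
        rw [← sdiff_sdiff]
        have hlt : volume.real ((Q \ P) \ L) < z / (K + 1) :=
          (ENNReal.lt_ofReal_iff_toReal_lt (ne_top_of_lt hLlt)).1 hLlt
        rw [lt_div_iff₀ (by positivity)] at hlt
        have : 0 ≤ volume.real ((Q \ P) \ L) := measureReal_nonneg
        change K * volume.real ((Q \ P) \ L) < z
        linarith)
    have hpQ : p ∈ Q := by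
      obtain ⟨t', x', k1, k2, k3, k4, k5, -⟩ := hp 0
      exact ⟨⟨k1.trans k5.1.1, k5.1.2.trans k2⟩, ⟨k3.trans k5.2.1, k5.2.2.trans k4⟩⟩
    by_cases hpP : p ∈ P
    · have hpL : p ∉ L := fun h => (hLsub h).2 hpP
      obtain ⟨ε, hε, hεL⟩ := Metric.isOpen_iff.1 hL.isClosed.isOpen_compl p hpL
      obtain ⟨N, hN1, hN2⟩ := exists_pow_div_lt (l := l) (m := m) hε
      obtain ⟨t', x', k1, k2, k3, k4, k5, k6⟩ := hp N
      have hQL := Icc_prod_subset_ball k5 hN1 hN2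
      have hsubQ : Icc t' (t' + l / 2 ^ N) ×ˢ Icc x' (x' + m / 2 ^ N) ⊆ Q :=
        Set.prod_mono (Icc_subset_Icc k1 k2) (Icc_subset_Icc k3 k4)
      have hanch : ∀ q ∈ P, q ∈ Icc t' (t' + l / 2 ^ N) ×ˢ Icc x' (x' + m / 2 ^ N) →
          Anchored a n q ∧ Anchored b n q := by
        intro q hqP hq
        exact hball (show (⟨q, hqP⟩ : P) ∈ Metric.ball p₀ r from g7 (hsubQ hq))
      have hdiff : Icc t' (t' + l / 2 ^ N) ×ˢ Icc x' (x' + m / 2 ^ N) \ (P ∪ L)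
          = Icc t' (t' + l / 2 ^ N) ×ˢ Icc x' (x' + m / 2 ^ N) \ P := by
        ext q
        simp only [Set.mem_sdiff, mem_union, not_or]
        exact ⟨fun h => ⟨h.1, h.2.1⟩, fun h => ⟨h.1, h.2, hεL (hQL h.1)⟩⟩
      have hIoo1 : Ioo t' (t' + l / 2 ^ N) ⊆ Ioo A B :=
        Ioo_subset_Ioo (g1.trans k1) (k2.trans g3)
      have hIoo2 : Ioo x' (x' + m / 2 ^ N) ⊆ Ioo C D :=
        Ioo_subset_Ioo (g4.trans k3) (k4.trans g6)
      have key := abs_rectDefect_le (N := n) (κ := κ) (F := F) ha hb hf hP (Nat.cast_nonneg n)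
        (fun q hqP hq => (hanch q hqP hq).1) (fun q hqP hq => (hanch q hqP hq).2)
        (fun t ht x hx => hda t (hIoo1 ht) x (hIoo2 hx))
        (fun t ht x hx => hdb t (hIoo1 ht) x (hIoo2 hx))
        (fun t ht x hx => heq t (hIoo1 ht) x (hIoo2 hx))
        (fun t ht x hx => hF' t (Icc_subset_Icc (g1.trans k1) (k2.trans g3) ht) x
          (Icc_subset_Icc (g4.trans k3) (k4.trans g6) hx))
        (by positivity)
        (by rw [add_sub_cancel_left, add_sub_cancel_left, ← mul_div_assoc]; gcongr)
        (by rw [add_sub_cancel_left, add_sub_cancel_left, ← mul_div_assoc]; gcongr)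
        ⟨p, hpP, k5⟩
        (fun u₁ u₂ v₁ v₂ w1 w2 w3 w4 w5 w6 w7 => hloc u₁ u₂ v₁ v₂ (g1.trans (k1.trans w1)) w2
          (w3.trans (k2.trans g3)) (g4.trans (k3.trans w4)) w5 (w6.trans (k4.trans g6)) w7)
      simp only [hae, hdiff] at k6
      linarith
    · have hpG : p ∈ Good := by
        by_contra hpG
        exact hpP ⟨⟨⟨g1.trans hpQ.1.1, hpQ.1.2.trans g3⟩, ⟨g4.trans hpQ.2.1, hpQ.2.2.trans g6⟩⟩, hpG⟩
      obtain ⟨ε, hε, hpε⟩ := hpG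
      obtain ⟨N, hn1, hn2⟩ := exists_pow_div_lt (l := l) (m := m) hε
      obtain ⟨t', x', k1, k2, k3, k4, k5, k6⟩ := hp N
      have h0 := hpε _ _ _ _ (g1.trans k1) (le_add_of_nonneg_right (by positivity)) (k2.trans g3)
        (g4.trans k3) (le_add_of_nonneg_right (by positivity))
        (k4.trans g6) (Icc_prod_subset_ball k5 hn1 hn2)
      simp only [h0, abs_zero] at k6
      have : 0 ≤ K * volume.real (Ioc t' (t' + l / 2 ^ N) ×ˢ Ioc x' (x' + m / 2 ^ N) \ (P ∪ L)) :=
        mul_nonneg hK0 measureReal_nonneg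
      linarith
  exact hloc _ _ _ _ h1 h2 h3 h4 h5 h6 (by rw [hPe, empty_inter])

/-- Time primitive from time `0`. -/
noncomputable def tprim (f : ℝ → ℝ → ℝ) (t x : ℝ) : ℝ := ∫ s in (0:ℝ)..t, f s x

/-- `p` is the spatial derivative of `f` on `(-∞, T] × [0, 1]`, in integrated form. -/
def XDeriv (T : ℝ) (f p : ℝ → ℝ → ℝ) : Prop :=
  ∀ t ≤ T, ∀ x ∈ Icc (0:ℝ) 1, f t x - f t 0 = ∫ z in (0:ℝ)..x, p t z

theorem tprim_zero (f : ℝ → ℝ → ℝ) (x : ℝ) : tprim f 0 x = 0 := by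
  simp [tprim]

theorem tprim_eq_zero {f : ℝ → ℝ → ℝ} (h : ∀ t ≤ 0, ∀ x, f t x = 0) {t : ℝ} (ht : t ≤ 0) (x : ℝ) :
    tprim f t x = 0 := by
  rw [tprim, intervalIntegral.integral_congr (g := fun _ => 0), intervalIntegral.integral_zero]
  intro s hs
  rw [uIcc_of_ge ht] at hs
  exact h s hs.2 x

namespace SepReg

variable {f p : ℝ → ℝ → ℝ}

theorem continuous_tprim (hf : SepReg f) : Continuous (Function.uncurry (tprim f)) := by
  refine continuous_iff_continuousAt.2 fun q => ?_
  obtain ⟨t, x⟩ := q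
  obtain ⟨C, hC⟩ := hf.bdd (max (|t| + 1) (|x| + 1))
  have key : ContinuousAt (fun q : ℝ × ℝ => ∫ s in (0:ℝ)..q.2, f s q.1) (x, t) := by
    refine intervalIntegral.continuousAt_parametric_primitive_of_dominated (F := fun x s => f s x)
      (fun _ => C) (-(|t| + 1)) (|t| + 1) (fun y => (hf.left y).aestronglyMeasurable) ?_ (by simp)
      (.of_forall fun s => (hf.right s).continuousAt) ?_ ?_ (by simp)
    · filter_upwards [Metric.ball_mem_nhds x one_pos] with y hy
      refine (ae_restrict_mem measurableSet_uIoc).mono fun s hs => hC s y ?_ ?_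
      · have h0 : -(|t| + 1) ≤ |t| + 1 := by linarith [abs_nonneg t]
        rw [uIoc_of_le h0] at hs
        exact (abs_le.2 ⟨hs.1.le, hs.2⟩).trans (le_max_left _ _)
      · rw [Metric.mem_ball, Real.dist_eq] at hy
        have := abs_sub_abs_le_abs_sub y x
        exact le_trans (by linarith) (le_max_right _ _)
    · constructor <;> linarith [abs_nonneg t]
    · constructor <;> linarith [neg_abs_le t, le_abs_self t]
  exact ContinuousAt.comp (x := (t, x)) (f := fun q : ℝ × ℝ => (q.2, q.1)) key (by fun_prop)

theorem sepReg_tprim (hf : SepReg f) : SepReg (tprim f) := hf.prim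

theorem hasDerivAt_tprim (hf : SepReg f) (t x : ℝ) :
    HasDerivAt (fun t => tprim f t x) (f t x) t := hf.hasDerivAt_prim t x

end SepReg

namespace XDeriv

variable {T : ℝ} {f p : ℝ → ℝ → ℝ}

theorem hasDerivAt (h : XDeriv T f p) (hp : SepReg p) {t x : ℝ} (ht : t ≤ T) (hx : x ∈ Ioo (0:ℝ) 1) :
    HasDerivAt (f t) (p t x) x := by
  have h1 : HasDerivAt (fun y => f t 0 + ∫ z in (0:ℝ)..y, p t z) (p t x) x :=
    (intervalIntegral.integral_hasDerivAt_right (hp.intRight t 0 x)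
      ((hp.right t).stronglyMeasurableAtFilter _ _) (hp.right t).continuousAt).const_add _
  refine h1.congr_of_eventuallyEq ?_
  filter_upwards [Ioo_mem_nhds hx.1 hx.2] with y hy
  rw [← h t ht y (Ioo_subset_Icc_self hy)]
  ring

theorem tprim_tprim (h : XDeriv T f p) (hT : 0 ≤ T) (hf : SepReg f) (hp : SepReg p) :
    XDeriv T (tprim f) (tprim p) := by
  intro t ht x hx
  have h1 : ∀ {a b : ℝ}, a ≤ b → b ≤ T →
      ∫ s in a..b, (f s x - f s 0) = ∫ z in (0:ℝ)..x, ∫ s in a..b, p s z := fun {a b} hab hb => by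
    rw [← hp.fubini hab hx.1]
    refine intervalIntegral.integral_congr fun s hs => ?_
    rw [uIcc_of_le hab] at hs
    exact h s (hs.2.trans hb) x hx
  unfold tprim
  rw [← intervalIntegral.integral_sub (hf.intLeft _ _ _) (hf.intLeft _ _ _)]
  rcases le_total 0 t with h0 | h0
  · exact h1 h0 ht
  · rw [intervalIntegral.integral_symm, h1 h0 hT, ← intervalIntegral.integral_neg]
    simp only [intervalIntegral.integral_symm t 0]

end XDeriv

theorem hasDerivAt_uncurry_line {f f₁ f₂ : ℝ → ℝ → ℝ} {α : ℝ → ℝ} {α' z : ℝ}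
    (hα : HasDerivAt α α' z)
    (h1 : ∀ᶠ q in 𝓝 (α z, z), HasDerivAt (fun s => f s q.2) (f₁ q.1 q.2) q.1)
    (h2 : ∀ᶠ q in 𝓝 (α z, z), HasDerivAt (f q.1) (f₂ q.1 q.2) q.2)
    (c1 : ContinuousAt (Function.uncurry f₁) (α z, z))
    (c2 : ContinuousAt (Function.uncurry f₂) (α z, z)) :
    HasDerivAt (fun z => f (α z) z) (f₁ (α z) z * α' + f₂ (α z) z) z := by
  have key := hasStrictFDerivAt_uncurry_coprod (𝕜 := ℝ) (u := (α z, z)) (f := f)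
    (f₁ := fun s x => ContinuousLinearMap.toSpanSingleton ℝ (f₁ s x))
    (f₂ := fun s x => ContinuousLinearMap.toSpanSingleton ℝ (f₂ s x))
    (h1.mono fun q hq => hq.hasFDerivAt) (h2.mono fun q hq => hq.hasFDerivAt)
    ((ContinuousLinearMap.toSpanSingletonCLE (𝕜 := ℝ) (E := ℝ)).continuous.continuousAt.comp c1)
    ((ContinuousLinearMap.toSpanSingletonCLE (𝕜 := ℝ) (E := ℝ)).continuous.continuousAt.comp c2)
  have : HasDerivAt (fun z => f (α z) z) _ z := HasFDerivAt.comp_hasDerivAt (f := fun z => (α z, z)) z key.hasFDerivAt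
    (hα.prodMk (hasDerivAt_id z))
  convert this using 1
  simp [Function.HasUncurry.uncurry, mul_comm]

theorem eqOn_of_integral_eq {f g : ℝ → ℝ} (hf : Continuous f) (hg : Continuous g) {T : ℝ}
    (hT : 0 < T) (h : ∀ t ∈ Icc 0 T, ∫ s in (0:ℝ)..t, f s = ∫ s in (0:ℝ)..t, g s) :
    EqOn f g (Icc 0 T) := by
  intro t ht
  have d : ∀ {f : ℝ → ℝ}, Continuous f → HasDerivAt (fun t => ∫ s in (0:ℝ)..t, f s) (f t) t :=
    fun {f} hf => intervalIntegral.integral_hasDerivAt_right (hf.intervalIntegrable _ _)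
      (hf.stronglyMeasurableAtFilter _ _) hf.continuousAt
  exact (uniqueDiffOn_Icc hT t ht).eq_deriv _ (d hf).hasDerivWithinAt
    ((d hg).hasDerivWithinAt.congr_of_mem h ht)

/-- Data of a transport equation `y_t + c y_x = -ω y + M G_t`, integrated once in time. -/
structure Transp (T c ω M B K : ℝ) (y G : ℝ → ℝ → ℝ) : Prop where
  hT : 0 < T
  hc : 0 < c
  hω : 0 < ω
  hM : 0 ≤ M
  hy : SepReg y
  hG : SepReg G
  y0 : ∀ t ≤ 0, ∀ x, y t x = 0
  G0 : ∀ t ≤ 0, ∀ x, G t x = 0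
  yB : ∀ t x, |y t x| ≤ B
  GB : ∀ t x, |G t x| ≤ K
  tp : XDeriv T (tprim y) fun t z => (M * G t z - y t z - ω * tprim y t z) / c

/-- Attenuated integral of `G` along the backward characteristic. -/
noncomputable def lineInt (c ω : ℝ) (G : ℝ → ℝ → ℝ) (t x : ℝ) : ℝ :=
  ∫ z in (0:ℝ)..x, Real.exp (-(ω / c) * (x - z)) * G (t - (x - z) / c) z

/-- The part of `y` that does not stem from the boundary `x = 0`. -/
noncomputable def scat (c ω : ℝ) (y : ℝ → ℝ → ℝ) (t x : ℝ) : ℝ :=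
  y t x - Real.exp (-(ω / c) * x) * y (t - x / c) 0

theorem SepReg.line_bdd {G : ℝ → ℝ → ℝ} (hG : SepReg G) (c ω R : ℝ) :
    ∃ C, ∀ t x z, |t| ≤ R → |x| ≤ R → |z| ≤ R →
      |Real.exp (-(ω / c) * (x - z)) * G (t - (x - z) / c) z| ≤ C := by
  obtain ⟨C, hC⟩ := hG.bdd (R + (R + R) * |c|⁻¹)
  refine ⟨Real.exp (|ω / c| * (R + R)) * C, fun t x z ht hx hz => ?_⟩
  have hR : 0 ≤ R := (abs_nonneg _).trans ht
  have hxz : |x - z| ≤ R + R := (abs_sub _ _).trans (add_le_add hx hz)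
  rw [abs_mul, Real.abs_exp]
  refine mul_le_mul (Real.exp_le_exp.2 ?_) (hC _ _ ?_ ?_) (abs_nonneg _) (Real.exp_pos _).le
  · refine (le_abs_self _).trans ?_
    rw [abs_mul, abs_neg]
    gcongr
  · refine (abs_sub _ _).trans (add_le_add ht ?_)
    rw [abs_div, div_eq_mul_inv]
    gcongr
  · exact hz.trans (le_add_of_nonneg_right (by positivity))

theorem SepReg.measurable_line {G : ℝ → ℝ → ℝ} (hG : SepReg G) (c ω : ℝ) :
    Measurable fun p : ℝ × ℝ × ℝ =>
      Real.exp (-(ω / c) * (p.2.1 - p.2.2)) * G (p.1 - (p.2.1 - p.2.2) / c) p.2.2 :=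
  Measurable.mul (by fun_prop)
    (hG.measurable.comp (g := Function.uncurry G)
      (f := fun p : ℝ × ℝ × ℝ => (p.1 - (p.2.1 - p.2.2) / c, p.2.2)) (by fun_prop))

theorem SepReg.continuous_lineInt {G : ℝ → ℝ → ℝ} (hG : SepReg G) (c ω x : ℝ) :
    Continuous fun t => lineInt c ω G t x := by
  refine continuous_iff_continuousAt.2 fun t => ?_
  obtain ⟨C, hC⟩ := hG.line_bdd c ω (max (|t| + 1) |x|)
  refine intervalIntegral.continuousAt_of_dominated_interval (bound := fun _ => C)
    (.of_forall fun s => ?_) ?_ (by simp) (.of_forall fun z _ => ?_)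
  · exact ((hG.measurable_line c ω).comp
      (f := fun z : ℝ => (s, x, z)) (by fun_prop)).aestronglyMeasurable
  · filter_upwards [Metric.ball_mem_nhds t one_pos] with s hs
    refine .of_forall fun z hz => hC s x z ?_ (le_max_right _ _) ?_
    · rw [Metric.mem_ball, Real.dist_eq] at hs
      have := abs_sub_abs_le_abs_sub s t
      exact le_trans (by linarith) (le_max_left _ _)
    · have := abs_le_max_of_mem_uIcc (uIoc_subset_uIcc hz)
      rw [abs_zero, max_eq_right (abs_nonneg _)] at this
      exact this.trans (le_max_right _ _)
  · exact (continuous_const.mul ((hG.left z).comp (continuous_sub_right _))).continuousAt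

theorem SepReg.integral_lineInt {G : ℝ → ℝ → ℝ} (hG : SepReg G) (G0 : ∀ t ≤ 0, ∀ x, G t x = 0)
    {c : ℝ} (hc : 0 < c) (ω : ℝ) {t x : ℝ} (ht : 0 ≤ t) (hx : 0 ≤ x) :
    ∫ s in (0:ℝ)..t, lineInt c ω G s x = lineInt c ω (tprim G) t x := by
  unfold lineInt
  obtain ⟨C, hC⟩ := hG.line_bdd c ω (max t x)
  simp only [intervalIntegral.integral_of_le ht, intervalIntegral.integral_of_le hx]
  rw [integral_integral_swap]
  · refine setIntegral_congr_fun measurableSet_Ioc fun z hz => ?_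
    simp only [integral_const_mul]
    rw [← intervalIntegral.integral_of_le ht,
      intervalIntegral.integral_comp_sub_right (f := fun s => G s z)]
    have ha : 0 ≤ (x - z) / c := div_nonneg (by linarith [hz.2]) hc.le
    have h2 := tprim_eq_zero G0 (t := 0 - (x - z) / c) (by linarith) z
    rw [tprim, intervalIntegral.integral_symm, neg_eq_zero] at h2
    rw [tprim, ← intervalIntegral.integral_add_adjacent_intervals (hG.intLeft z _ 0)
      (hG.intLeft z 0 _), h2, zero_add]
  · rw [Measure.prod_restrict]
    refine Measure.integrableOn_of_bounded (M := C) ?_ ?_ ?_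
    · rw [← Measure.volume_eq_prod, Measure.volume_eq_prod, Measure.prod_prod]
      simp [ENNReal.mul_eq_top]
    · exact ((hG.measurable_line c ω).comp
        (f := fun p : ℝ × ℝ => (p.1, x, p.2)) (by fun_prop)).aestronglyMeasurable
    · refine (ae_restrict_mem (measurableSet_Ioc.prod measurableSet_Ioc)).mono fun p hp => ?_
      refine hC _ _ _ ?_ ?_ ?_
      · rw [abs_of_pos hp.1.1]; exact hp.1.2.trans (le_max_left _ _)
      · rw [abs_of_nonneg hx]; exact le_max_right _ _
      · rw [abs_of_pos hp.2.1]; exact hp.2.2.trans (le_max_right _ _)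

namespace Transp

variable {T c ω M B K : ℝ} {y G : ℝ → ℝ → ℝ}

theorem tprim_tprim_eq (h : Transp T c ω M B K y G) {t x : ℝ} (ht : t ≤ T) (hx : x ∈ Icc (0:ℝ) 1) :
    tprim (tprim y) t x = Real.exp (-(ω / c) * x) * tprim (tprim y) (t - x / c) 0 +
      M / c * lineInt c ω (tprim G) t x := by
  have hc := h.hc
  have hV := h.hy.sepReg_tprim
  have hp : SepReg fun t z => (M * G t z - y t z - ω * tprim y t z) / c := by
    simpa [div_eq_inv_mul] using
      (((h.hG.const_mul M).sub h.hy).sub (hV.const_mul ω)).const_mul c⁻¹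
  have hX := h.tp.tprim_tprim h.hT.le hV hp
  have hpe : tprim (fun t z => (M * G t z - y t z - ω * tprim y t z) / c) =
      fun t z => (M * tprim G t z - tprim y t z - ω * tprim (tprim y) t z) / c := by
    funext t z
    unfold tprim
    rw [intervalIntegral.integral_div, intervalIntegral.integral_sub, intervalIntegral.integral_sub,
      intervalIntegral.integral_const_mul, intervalIntegral.integral_const_mul]
    · exact (h.hG.const_mul M).intLeft _ _ _
    · exact h.hy.intLeft _ _ _
    · exact ((h.hG.const_mul M).sub h.hy).intLeft _ _ _
    · exact (hV.const_mul ω).intLeft _ _ _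
  rw [hpe] at hX
  have hp2 : SepReg fun t z => (M * tprim G t z - tprim y t z - ω * tprim (tprim y) t z) / c :=
    hpe ▸ hp.sepReg_tprim
  have cG := h.hG.continuous_tprim
  have cV := h.hy.continuous_tprim
  have cV2 := hV.continuous_tprim
  have cp2 : Continuous (Function.uncurry fun t z =>
      (M * tprim G t z - tprim y t z - ω * tprim (tprim y) t z) / c) :=
    (((continuous_const.mul cG).sub cV).sub (continuous_const.mul cV2)).div_const c
  have hline : Continuous fun z : ℝ => (t - (x - z) / c, z) := by fun_prop
  have hα : ∀ z : ℝ, HasDerivAt (fun z => t - (x - z) / c) (1 / c) z := fun z => by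
    simpa [neg_div] using ((((hasDerivAt_id z).const_sub x).div_const c).const_sub t)
  have hexp : ∀ z : ℝ, HasDerivAt (fun z => Real.exp (-(ω / c) * (x - z)))
      (Real.exp (-(ω / c) * (x - z)) * (ω / c)) z := fun z => by
    simpa using (((hasDerivAt_id z).const_sub x).const_mul (-(ω / c))).exp
  have key := intervalIntegral.integral_eq_sub_of_hasDerivAt_of_le (a := 0) (b := x)
    (f := fun z => Real.exp (-(ω / c) * (x - z)) * tprim (tprim y) (t - (x - z) / c) z)
    (f' := fun z => M / c * (Real.exp (-(ω / c) * (x - z)) * tprim G (t - (x - z) / c) z)) hx.1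
    ((by fun_prop : Continuous fun z : ℝ => Real.exp (-(ω / c) * (x - z))).mul
      (cV2.comp hline)).continuousOn
    (fun z hz => by
      have hz1 : t - (x - z) / c < T := by
        have : 0 < (x - z) / c := div_pos (by linarith [hz.2]) hc
        linarith
      have hd := hasDerivAt_uncurry_line (f := tprim (tprim y)) (f₁ := tprim y) (hα z)
        (.of_forall fun q => hV.hasDerivAt_tprim q.1 q.2)
        (by
          filter_upwards [(continuous_fst.tendsto _).eventually_lt_const hz1,
            (continuous_snd.tendsto _).eventually (Ioo_mem_nhds hz.1 (hz.2.trans_le hx.2))] with q h1 h2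
          exact hX.hasDerivAt hp2 h1.le h2) cV.continuousAt cp2.continuousAt
      refine ((hexp z).mul hd).congr_deriv ?_
      ring)
    (((continuous_const.mul ((by fun_prop : Continuous fun z : ℝ => Real.exp (-(ω / c) * (x - z))).mul
      (cG.comp hline))).intervalIntegrable _ _))
  rw [intervalIntegral.integral_const_mul] at key
  simp only [sub_self, zero_div, sub_zero, mul_zero, Real.exp_zero, one_mul] at key
  rw [lineInt]
  linarith

theorem continuous_scat_left (h : Transp T c ω M B K y G) (x : ℝ) :
    Continuous fun t => scat c ω y t x :=
  (h.hy.left x).sub (continuous_const.mul ((h.hy.left 0).comp (continuous_sub_right _)))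

theorem tprim_eq (h : Transp T c ω M B K y G) {t x : ℝ} (ht : t ≤ T) (hx : x ∈ Icc (0:ℝ) 1) :
    tprim y t x = Real.exp (-(ω / c) * x) * tprim y (t - x / c) 0 + M / c * lineInt c ω G t x := by
  have hxc : 0 ≤ x / c := div_nonneg hx.1 h.hc.le
  rcases le_total t 0 with h0 | h0
  · rw [tprim_eq_zero h.y0 h0, tprim_eq_zero h.y0 (by linarith), lineInt,
      intervalIntegral.integral_congr (g := fun _ => 0)]
    · simp
    · intro z hz
      rw [uIcc_of_le hx.1] at hz
      have : 0 ≤ (x - z) / c := div_nonneg (by linarith [hz.2]) h.hc.le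
      simp [h.G0 (t - (x - z) / c) (by linarith)]
  have hV := h.hy.sepReg_tprim
  refine eqOn_of_integral_eq (f := fun t => tprim y t x) (g := fun t =>
    Real.exp (-(ω / c) * x) * tprim y (t - x / c) 0 + M / c * lineInt c ω G t x)
    (hV.left x) ((continuous_const.mul ((hV.left 0).comp (continuous_sub_right _))).add
      (continuous_const.mul (h.hG.continuous_lineInt c ω x))) h.hT (fun s hs => ?_) ⟨h0, ht⟩
  have i1 : IntervalIntegrable (fun t => Real.exp (-(ω / c) * x) * tprim y (t - x / c) 0) volume 0 s :=
    (continuous_const.mul ((hV.left 0).comp (continuous_sub_right _))).intervalIntegrable _ _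
  have i2 : IntervalIntegrable (fun t => M / c * lineInt c ω G t x) volume 0 s :=
    (continuous_const.mul (h.hG.continuous_lineInt c ω x)).intervalIntegrable _ _
  rw [intervalIntegral.integral_add i1 i2, intervalIntegral.integral_const_mul,
    intervalIntegral.integral_const_mul, h.hG.integral_lineInt h.G0 h.hc ω hs.1 hx.1,
    intervalIntegral.integral_comp_sub_right (f := fun t => tprim y t 0)]
  have h2 := tprim_eq_zero (f := tprim y) (fun t ht x => tprim_eq_zero h.y0 ht x)
    (t := 0 - x / c) (by linarith) 0
  rw [tprim, intervalIntegral.integral_symm, neg_eq_zero] at h2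
  rw [← intervalIntegral.integral_add_adjacent_intervals (hV.intLeft 0 _ 0) (hV.intLeft 0 0 _),
    h2, zero_add]
  exact h.tprim_tprim_eq hs.2 hx

theorem tprim_scat (h : Transp T c ω M B K y G) {t x : ℝ} (ht : t ≤ T) (hx : x ∈ Icc (0:ℝ) 1) :
    tprim (scat c ω y) t x = M / c * lineInt c ω G t x := by
  have hxc : 0 ≤ x / c := div_nonneg hx.1 h.hc.le
  have h2 := tprim_eq_zero h.y0 (t := 0 - x / c) (by linarith) 0
  have h1 := h.tprim_eq ht hx
  unfold scat
  unfold tprim at h1 h2 ⊢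
  rw [intervalIntegral.integral_symm, neg_eq_zero] at h2
  have i : IntervalIntegrable (fun s => Real.exp (-(ω / c) * x) * y (s - x / c) 0) volume 0 t :=
    (continuous_const.mul ((h.hy.left 0).comp (continuous_sub_right _))).intervalIntegrable _ _
  simp only []
  rw [intervalIntegral.integral_sub (h.hy.intLeft _ _ _) i,
    intervalIntegral.integral_const_mul,
    intervalIntegral.integral_comp_sub_right (f := fun t => y t 0),
    ← intervalIntegral.integral_add_adjacent_intervals (h.hy.intLeft 0 _ 0) (h.hy.intLeft 0 0 _),
    h2, h1]
  ring

end Transp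

theorem integral_exp_line_le {a x : ℝ} (ha : 0 < a) :
    ∫ z in (0:ℝ)..x, Real.exp (-a * (x - z)) ≤ 1 / a := by
  have hd : ∀ z ∈ uIcc 0 x, HasDerivAt (fun z => Real.exp (-a * (x - z)) / a)
      (Real.exp (-a * (x - z))) z := fun z _ => by
    refine ((((hasDerivAt_id z).const_sub x).const_mul (-a)).exp.div_const a).congr_deriv ?_
    simp only [id]
    field_simp
  rw [intervalIntegral.integral_eq_sub_of_hasDerivAt hd
    ((by fun_prop : Continuous fun z : ℝ => Real.exp (-a * (x - z))).intervalIntegrable _ _)]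
  simp only [sub_self, mul_zero, Real.exp_zero]
  exact sub_le_self _ (by positivity)

theorem SepReg.intervalIntegrable_line {G : ℝ → ℝ → ℝ} (hG : SepReg G) (c ω t x : ℝ) :
    IntervalIntegrable (fun z => Real.exp (-(ω / c) * (x - z)) * G (t - (x - z) / c) z)
      volume 0 x := by
  obtain ⟨C, hC⟩ := hG.line_bdd c ω (max |t| |x|)
  rw [intervalIntegrable_iff]
  refine Measure.integrableOn_of_bounded (M := C) (by simp [uIoc, Real.volume_Ioc])
    ((hG.measurable_line c ω).comp (f := fun z : ℝ => (t, x, z))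
      (by fun_prop)).aestronglyMeasurable ?_
  refine (ae_restrict_mem measurableSet_uIoc).mono fun z hz =>
    hC t x z (le_max_left _ _) (le_max_right _ _) ?_
  have := abs_le_max_of_mem_uIcc (uIoc_subset_uIcc hz)
  rw [abs_zero, max_eq_right (abs_nonneg _)] at this
  exact this.trans (le_max_right _ _)

theorem abs_lineInt_le {c ω K t x : ℝ} {G : ℝ → ℝ → ℝ} (hc : 0 < c) (hω : 0 < ω)
    (hK : ∀ t x, |G t x| ≤ K) (hx : 0 ≤ x) : |lineInt c ω G t x| ≤ K * (c / ω) := by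
  have hK0 : 0 ≤ K := (abs_nonneg _).trans (hK 0 0)
  have i : IntervalIntegrable (fun z => K * Real.exp (-(ω / c) * (x - z))) volume 0 x :=
    (by fun_prop : Continuous fun z : ℝ => K * Real.exp (-(ω / c) * (x - z))).intervalIntegrable _ _
  refine (intervalIntegral.norm_integral_le_of_norm_le (f := fun z =>
    Real.exp (-(ω / c) * (x - z)) * G (t - (x - z) / c) z) (g := fun z =>
    K * Real.exp (-(ω / c) * (x - z))) hx (.of_forall fun z _ => ?_) i).trans ?_
  · rw [Real.norm_eq_abs, abs_mul, Real.abs_exp, mul_comm]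
    exact mul_le_mul_of_nonneg_right (hK _ _) (Real.exp_pos _).le
  · rw [intervalIntegral.integral_const_mul]
    refine mul_le_mul_of_nonneg_left ?_ hK0
    simpa using integral_exp_line_le (x := x) (div_pos hω hc)

theorem lineInt_sub_ge {T c ω L l s t x : ℝ} {G : ℝ → ℝ → ℝ} (hG : SepReg G) (hc : 0 < c)
    (hω : 0 < ω) (hl : 0 < l) (hL : 0 ≤ L)
    (h : ∀ s t, s ≤ t → t ≤ T → ∀ z ∈ Icc (0:ℝ) 1, -(L * Real.exp (l * t)) ≤ G t z - G s z)
    (hst : s ≤ t) (ht : t ≤ T) (hx : x ∈ Icc (0:ℝ) 1) :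
    -(c / l * (L * Real.exp (l * t))) ≤ lineInt c ω G t x - lineInt c ω G s x := by
  have i : IntervalIntegrable (fun z => -(L * Real.exp (l * t)) * Real.exp (-(l / c) * (x - z)))
      volume 0 x := (by fun_prop : Continuous fun z : ℝ =>
        -(L * Real.exp (l * t)) * Real.exp (-(l / c) * (x - z))).intervalIntegrable _ _
  unfold lineInt
  rw [← intervalIntegral.integral_sub (hG.intervalIntegrable_line c ω t x)
    (hG.intervalIntegrable_line c ω s x)]
  calc -(c / l * (L * Real.exp (l * t)))
      ≤ ∫ z in (0:ℝ)..x, -(L * Real.exp (l * t)) * Real.exp (-(l / c) * (x - z)) := by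
        rw [intervalIntegral.integral_const_mul, neg_mul, neg_le_neg_iff, mul_comm (c / l)]
        refine mul_le_mul_of_nonneg_left ?_ (by positivity)
        simpa using integral_exp_line_le (x := x) (div_pos hl hc)
    _ ≤ _ := by
        refine intervalIntegral.integral_mono_on hx.1 i ((hG.intervalIntegrable_line c ω t x).sub
          (hG.intervalIntegrable_line c ω s x)) fun z hz => ?_
        have hxz : 0 ≤ x - z := by linarith [hz.2]
        have ha : 0 ≤ (x - z) / c := div_nonneg hxz hc.le
        have h1 := h (s - (x - z) / c) (t - (x - z) / c) (by linarith) (by linarith) z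
          ⟨hz.1, hz.2.trans hx.2⟩
        have he : Real.exp (l * (t - (x - z) / c)) =
            Real.exp (l * t) * Real.exp (-(l / c) * (x - z)) := by
          rw [← Real.exp_add]; ring_nf
        rw [he] at h1
        have h2 : Real.exp (-(ω / c) * (x - z)) ≤ 1 := Real.exp_le_one_iff.2 (by
          rw [neg_mul]; exact neg_nonpos.2 (by positivity))
        have h3 : 0 ≤ L * (Real.exp (l * t) * Real.exp (-(l / c) * (x - z))) := by positivity
        rw [← mul_sub]
        nlinarith [mul_le_mul_of_nonneg_left h1 (Real.exp_pos (-(ω / c) * (x - z))).le]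

/-- The attenuated transport of boundary values `v` at `x = 0` into the domain. -/
noncomputable def bdry (c ω : ℝ) (v : ℝ → ℝ) (t x : ℝ) : ℝ :=
  Real.exp (-(ω / c) * x) * v (t - x / c)

section bdry

variable {c ω : ℝ} {v : ℝ → ℝ}

theorem sepReg_bdry (hv : Continuous v) : SepReg (bdry c ω v) := by
  refine SepReg.of_continuous ?_
  unfold bdry Function.uncurry
  fun_prop

theorem bdry_eq_zero (v0 : ∀ t ≤ 0, v t = 0) (hc : 0 < c) {t x : ℝ} (ht : t ≤ 0) (hx : 0 ≤ x) :
    bdry c ω v t x = 0 := by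
  have : 0 ≤ x / c := div_nonneg hx hc.le
  rw [bdry, v0 _ (by linarith), mul_zero]

theorem abs_bdry_le {B : ℝ} (hc : 0 < c) (hω : 0 < ω) (hB : ∀ t, |v t| ≤ B) {x : ℝ} (hx : 0 ≤ x)
    (t : ℝ) : |bdry c ω v t x| ≤ B := by
  rw [bdry, abs_mul, Real.abs_exp]
  refine (mul_le_of_le_one_left (abs_nonneg _) (Real.exp_le_one_iff.2 ?_)).trans (hB _)
  rw [neg_mul]
  exact neg_nonpos.2 (by positivity)

theorem tprim_bdry (hv : Continuous v) (v0 : ∀ t ≤ 0, v t = 0) (hc : 0 < c) {x : ℝ} (hx : 0 ≤ x)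
    (t : ℝ) : tprim (bdry c ω v) t x = bdry c ω (fun t => ∫ s in (0:ℝ)..t, v s) t x := by
  have hxc : 0 ≤ x / c := div_nonneg hx hc.le
  have h2 := tprim_eq_zero (f := fun t _ => v t) (fun t ht _ => v0 t ht) (t := 0 - x / c)
    (by linarith) 0
  unfold bdry
  unfold tprim at h2 ⊢
  rw [intervalIntegral.integral_symm, neg_eq_zero] at h2
  rw [intervalIntegral.integral_const_mul, intervalIntegral.integral_comp_sub_right (f := v),
    ← intervalIntegral.integral_add_adjacent_intervals (hv.intervalIntegrable _ 0)
      (hv.intervalIntegrable 0 _), h2, zero_add]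

theorem xDeriv_bdry (hv : Continuous v) (v0 : ∀ t ≤ 0, v t = 0) (hc : 0 < c) (T : ℝ) :
    XDeriv T (tprim (bdry c ω v))
      fun t x => (-bdry c ω v t x - ω * tprim (bdry c ω v) t x) / c := by
  intro t _ x hx
  set V : ℝ → ℝ := fun t => ∫ s in (0:ℝ)..t, v s with hV
  have hVd : ∀ t, HasDerivAt V (v t) t := fun t =>
    intervalIntegral.integral_hasDerivAt_right (hv.intervalIntegrable _ _)
      (hv.stronglyMeasurableAtFilter _ _) hv.continuousAt
  have hVc : Continuous V := continuous_iff_continuousAt.2 fun t => (hVd t).continuousAt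
  have hα : ∀ z : ℝ, HasDerivAt (fun z => t - z / c) (-(1 / c)) z := fun z => by
    simpa using (((hasDerivAt_id z).div_const c).const_sub t)
  have hexp : ∀ z : ℝ, HasDerivAt (fun z => Real.exp (-(ω / c) * z))
      (Real.exp (-(ω / c) * z) * -(ω / c)) z := fun z => by
    simpa using ((hasDerivAt_id z).const_mul (-(ω / c))).exp
  have hd : ∀ z ∈ uIcc 0 x, HasDerivAt (fun z => bdry c ω V t z)
      ((-bdry c ω v t z - ω * bdry c ω V t z) / c) z := fun z _ => by
    refine ((hexp z).mul ((hVd _).comp z (hα z))).congr_deriv ?_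
    simp only [bdry, Function.comp_apply]
    ring
  rw [tprim_bdry hv v0 hc hx.1, tprim_bdry hv v0 hc le_rfl,
    ← intervalIntegral.integral_eq_sub_of_hasDerivAt hd]
  · refine intervalIntegral.integral_congr fun z hz => ?_
    rw [uIcc_of_le hx.1] at hz
    simp only [tprim_bdry hv v0 hc hz.1 t]
    rfl
  · exact ((((sepReg_bdry hv).right t).neg.sub
      (continuous_const.mul ((sepReg_bdry hVc).right t))).div_const c).intervalIntegrable _ _

end bdry

theorem XDeriv.sub_eq {T : ℝ} {f p : ℝ → ℝ → ℝ} (h : XDeriv T f p) (hp : SepReg p) {t x y : ℝ}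
    (ht : t ≤ T) (hx : x ∈ Icc (0:ℝ) 1) (hy : y ∈ Icc (0:ℝ) 1) :
    f t y - f t x = ∫ z in x..y, p t z := by
  rw [← intervalIntegral.integral_interval_sub_left (hp.intRight t 0 y) (hp.intRight t 0 x),
    ← h t ht x hx, ← h t ht y hy]
  ring

theorem XDeriv.abs_slope_le {T P : ℝ} {f p : ℝ → ℝ → ℝ} (h : XDeriv T f p) (hp : SepReg p)
    {t x y : ℝ} (hP : ∀ z ∈ Icc (0:ℝ) 1, |p t z| ≤ P)
    (ht : t ≤ T) (hx : x ∈ Icc (0:ℝ) 1) (hy : y ∈ Icc (0:ℝ) 1) :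
    |slope (f t) x y| ≤ P := by
  have hP0 : 0 ≤ P := (abs_nonneg _).trans (hP x hx)
  rw [slope_def_field, h.sub_eq hp ht hx hy, abs_div]
  refine div_le_of_le_mul₀ (abs_nonneg _) hP0 ?_
  refine intervalIntegral.norm_integral_le_of_norm_le_const (f := p t) fun z hz => hP z ?_
  have := uIoc_subset_uIcc hz
  exact (uIcc_subset_Icc hx hy) this

/-- Integration of the closed form `V dV'` over `[0, T] × [0, 1]`. -/
theorem stokes_tprim {T : ℝ} (hT : 0 ≤ T) {w w' p p' : ℝ → ℝ → ℝ} (hw : SepReg w) (hw' : SepReg w')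
    (hp : SepReg p) (hp' : SepReg p') (hV : XDeriv T (tprim w) p) (hV' : XDeriv T (tprim w') p') :
    (∫ x in (0:ℝ)..1, ((∫ t in (0:ℝ)..T, (p t x * w' t x - w t x * p' t x)) +
      tprim w T x * p' T x)) =
      (∫ t in (0:ℝ)..T, tprim w t 1 * w' t 1) - ∫ t in (0:ℝ)..T, tprim w t 0 * w' t 0 := by
  have sV := hw.sepReg_tprim
  have sV' := hw'.sepReg_tprim
  have sI : SepReg fun t x => p t x * w' t x - w t x * p' t x := (hp.mul hw').sub (hw.mul hp')
  obtain ⟨P, hP⟩ := hp.bdd (max T 1)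
  obtain ⟨P', hP'⟩ := hp'.bdd (max T 1)
  obtain ⟨B, hB⟩ := hw.bdd (max T 1)
  obtain ⟨B', hB'⟩ := hw'.bdd (max T 1)
  have hz : ∀ z ∈ Icc (0:ℝ) 1, |z| ≤ max T 1 := fun z hz => by
    rw [abs_of_nonneg hz.1]; exact hz.2.trans (le_max_right _ _)
  have ht' : ∀ t ∈ Icc (0:ℝ) T, |t| ≤ max T 1 := fun z hz => by
    rw [abs_of_nonneg hz.1]; exact hz.2.trans (le_max_left _ _)
  refine intervalIntegral.integral_eq_sub_of_hasDerivAt_of_le zero_le_one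
    (f := fun x => ∫ t in (0:ℝ)..T, tprim w t x * w' t x)
    ((sV.mul hw').swap.continuous_integral 0 T).continuousOn (fun x hx => ?_)
    (((sI.swap.continuous_integral 0 T).add ((sV.mul hp').right T)).intervalIntegrable _ _)
  have hxI := Ioo_subset_Icc_self hx
  have hslope : ∀ y, y ≠ x → slope (fun x => ∫ t in (0:ℝ)..T, tprim w t x * w' t x) x y =
      (∫ t in (0:ℝ)..T, (slope (tprim w t) x y * w' t y - w t x * slope (tprim w' t) x y)) +
        tprim w T x * slope (tprim w' T) x y := by
    intro y hy
    have parts := intervalIntegral.integral_mul_deriv_eq_deriv_mul (a := 0) (b := T)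
      (u := fun t => tprim w t x) (u' := fun t => w t x)
      (v := fun t => tprim w' t y - tprim w' t x) (v' := fun t => w' t y - w' t x)
      (fun t _ => hw.hasDerivAt_tprim t x)
      (fun t _ => (hw'.hasDerivAt_tprim t y).sub (hw'.hasDerivAt_tprim t x))
      (hw.intLeft _ _ _) ((hw'.intLeft _ _ _).sub (hw'.intLeft _ _ _))
    simp only [tprim_zero, zero_mul, sub_zero] at parts
    simp only [slope_def_field]
    have e : ∀ t, (tprim w t y - tprim w t x) / (y - x) * w' t y -
        w t x * ((tprim w' t y - tprim w' t x) / (y - x)) =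
        ((tprim w t y - tprim w t x) * w' t y - w t x * (tprim w' t y - tprim w' t x)) / (y - x) :=
      fun t => by ring
    simp only [e, intervalIntegral.integral_div]
    rw [← mul_div_assoc, ← add_div]
    congr 1
    have i1 : IntervalIntegrable (fun t => (tprim w t y - tprim w t x) * w' t y) volume 0 T :=
      (((sV.left y).sub (sV.left x)).mul (hw'.left y)).intervalIntegrable _ _
    have i2 : IntervalIntegrable (fun t => w t x * (tprim w' t y - tprim w' t x)) volume 0 T :=
      ((hw.left x).mul ((sV'.left y).sub (sV'.left x))).intervalIntegrable _ _
    have i3 : IntervalIntegrable (fun t => tprim w t x * (w' t y - w' t x)) volume 0 T :=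
      ((sV.left x).mul ((hw'.left y).sub (hw'.left x))).intervalIntegrable _ _
    rw [intervalIntegral.integral_sub i1 i2,
      ← intervalIntegral.integral_sub ((sV.mul hw').intLeft y 0 T) ((sV.mul hw').intLeft x 0 T)]
    have : ∫ t in (0:ℝ)..T, (tprim w t y * w' t y - tprim w t x * w' t x) =
        (∫ t in (0:ℝ)..T, (tprim w t y - tprim w t x) * w' t y) +
        ∫ t in (0:ℝ)..T, tprim w t x * (w' t y - w' t x) := by
      rw [← intervalIntegral.integral_add i1 i3]
      exact intervalIntegral.integral_congr fun t _ => by ring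
    rw [this, parts]
    ring
  rw [hasDerivAt_iff_tendsto_slope]
  refine Tendsto.congr' (f₁ := fun y => (∫ t in (0:ℝ)..T,
      (slope (tprim w t) x y * w' t y - w t x * slope (tprim w' t) x y)) +
        tprim w T x * slope (tprim w' T) x y) ?_ ?_
  · filter_upwards [self_mem_nhdsWithin] with y hy using (hslope y hy).symm
  refine Tendsto.add ?_ (tendsto_const_nhds.mul
    (hasDerivAt_iff_tendsto_slope.1 (hV'.hasDerivAt hp' le_rfl hx)))
  refine intervalIntegral.tendsto_integral_filter_of_dominated_convergence
    (fun _ => P * B' + B * P') (.of_forall fun y => ?_) ?_ (by simp) (.of_forall fun t ht => ?_)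
  · have c1 : Continuous fun t => slope (tprim w t) x y := by
      simp only [slope_def_field]
      exact ((sV.left y).sub (sV.left x)).div_const _
    have c2 : Continuous fun t => slope (tprim w' t) x y := by
      simp only [slope_def_field]
      exact ((sV'.left y).sub (sV'.left x)).div_const _
    exact ((c1.mul (hw'.left y)).sub ((hw.left x).mul c2)).aestronglyMeasurable
  · filter_upwards [mem_nhdsWithin_of_mem_nhds (Ioo_mem_nhds hx.1 hx.2)] with y hy
    refine .of_forall fun t ht => ?_
    rw [uIoc_of_le hT] at ht
    have htI := Ioc_subset_Icc_self ht
    have hyI := Ioo_subset_Icc_self hy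
    have s1 := hV.abs_slope_le hp (fun z h => hP t z (ht' t htI) (hz z h)) ht.2 hxI hyI
    have s2 := hV'.abs_slope_le hp' (fun z h => hP' t z (ht' t htI) (hz z h)) ht.2 hxI hyI
    refine (abs_sub _ _).trans (add_le_add ?_ ?_) <;> rw [abs_mul]
    · exact mul_le_mul s1 (hB' t y (ht' t htI) (hz y hyI)) (abs_nonneg _) ((abs_nonneg _).trans s1)
    · have s3 := hB t x (ht' t htI) (hz x hxI)
      exact mul_le_mul s3 s2 (abs_nonneg _) ((abs_nonneg _).trans s3)
  · rw [uIoc_of_le hT] at ht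
    exact ((hasDerivAt_iff_tendsto_slope.1 (hV.hasDerivAt hp ht.2 hx)).mul
      (((hw'.right t).tendsto x).mono_left nhdsWithin_le_nhds)).sub (tendsto_const_nhds.mul
        (hasDerivAt_iff_tendsto_slope.1 (hV'.hasDerivAt hp' ht.2 hx)))

/-- A scattered wave in direction `μ` at frequency `ω`: `w_t + μ ω w_x = -ω w + S_t`,
integrated once in time, with a priori bounds. -/
structure Wave (T μ ω B D : ℝ) (w S : ℝ → ℝ → ℝ) : Prop where
  hT : 0 < T
  hμ : μ ∈ Ioc (0:ℝ) 1
  hω : 0 < ω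
  hw : SepReg w
  hS : SepReg S
  wB : ∀ t, ∀ x ∈ Icc (0:ℝ) 1, |w t x| ≤ B
  VB : ∀ t ≤ T, ∀ x ∈ Icc (0:ℝ) 1, |tprim w t x| ≤ D
  SB : ∀ t x, |S t x| ≤ ω * D
  xd : XDeriv T (tprim w) fun t z => (S t z - w t z - ω * tprim w t z) / (μ * ω)

theorem abs_integral_le_of_le {f : ℝ → ℝ} {a b C : ℝ} (hab : a ≤ b)
    (h : ∀ x ∈ Icc a b, |f x| ≤ C) : |∫ x in a..b, f x| ≤ C * (b - a) := by
  have := intervalIntegral.norm_integral_le_of_norm_le_const (a := a) (b := b) (f := f) (C := C)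
    fun x hx => h x (uIcc_of_le hab ▸ uIoc_subset_uIcc hx)
  rwa [abs_of_nonneg (sub_nonneg.2 hab)] at this

theorem integral_affine_comb {f g e : ℝ → ℝ} (hf : Continuous f) (hg : Continuous g)
    (he : Continuous e) {a b k m : ℝ} : ∫ x in a..b, (k * (f x + m * g x) + e x) =
      k * ((∫ x in a..b, f x) + m * ∫ x in a..b, g x) + ∫ x in a..b, e x := by
  have i1 : IntervalIntegrable (fun x => m * g x) volume a b :=
    (continuous_const.mul hg).intervalIntegrable _ _
  have i2 : IntervalIntegrable (fun x => k * (f x + m * g x)) volume a b :=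
    (continuous_const.mul (hf.add (continuous_const.mul hg))).intervalIntegrable _ _
  rw [intervalIntegral.integral_add i2 (he.intervalIntegrable _ _),
    intervalIntegral.integral_const_mul,
    intervalIntegral.integral_add (hf.intervalIntegrable _ _) i1,
    intervalIntegral.integral_const_mul]

theorem Wave.orthogonal {T μ μ' ω B D : ℝ} {w w' S S' : ℝ → ℝ → ℝ} (h : Wave T μ ω B D w S)
    (h' : Wave T μ' ω B D w' S') :
    |μ - μ'| * |∫ x in (0:ℝ)..1, ∫ t in (0:ℝ)..T, w t x * w' t x| ≤
      D * (1 + ω) * (6 * T * B + 2 * D + B) := by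
  obtain ⟨hT, ⟨hμ, hμ1⟩, hω, hw, hS, wB, VB, SB, xd⟩ := h
  obtain ⟨-, ⟨hμ', hμ1'⟩, -, hw', hS', wB', VB', SB', xd'⟩ := h'
  have hD : 0 ≤ D := (abs_nonneg _).trans (VB 0 hT.le 0 (by simp))
  have hB : 0 ≤ B := (abs_nonneg _).trans (wB 0 0 (by simp))
  have sV := hw.sepReg_tprim
  have sV' := hw'.sepReg_tprim
  have sp : SepReg fun t z => (S t z - w t z - ω * tprim w t z) / (μ * ω) := by
    simpa [div_eq_inv_mul] using ((hS.sub hw).sub (sV.const_mul ω)).const_mul (μ * ω)⁻¹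
  have sp' : SepReg fun t z => (S' t z - w' t z - ω * tprim w' t z) / (μ' * ω) := by
    simpa [div_eq_inv_mul] using ((hS'.sub hw').sub (sV'.const_mul ω)).const_mul (μ' * ω)⁻¹
  have key := stokes_tprim hT.le hw hw' sp sp' xd xd'
  have se : SepReg fun t x => μ' * (S t x - ω * tprim w t x) * w' t x -
      μ * (S' t x - ω * tprim w' t x) * w t x := by
    exact (((hS.sub (sV.const_mul ω)).const_mul μ').mul hw').sub
      (((hS'.sub (sV'.const_mul ω)).const_mul μ).mul hw)
  have hq : ∀ t x, (S t x - w t x - ω * tprim w t x) / (μ * ω) * w' t x -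
      w t x * ((S' t x - w' t x - ω * tprim w' t x) / (μ' * ω)) =
      (μ * μ' * ω)⁻¹ * ((μ' * (S t x - ω * tprim w t x) * w' t x -
      μ * (S' t x - ω * tprim w' t x) * w t x) + (μ - μ') * (w t x * w' t x)) := by
    intro t x
    field_simp
    ring
  have hI : ∀ x, ∫ t in (0:ℝ)..T, ((S t x - w t x - ω * tprim w t x) / (μ * ω) * w' t x -
      w t x * ((S' t x - w' t x - ω * tprim w' t x) / (μ' * ω))) =
      (μ * μ' * ω)⁻¹ * ((∫ t in (0:ℝ)..T, (μ' * (S t x - ω * tprim w t x) * w' t x -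
      μ * (S' t x - ω * tprim w' t x) * w t x)) +
        (μ - μ') * ∫ t in (0:ℝ)..T, w t x * w' t x) := by
    intro x
    simp only [hq]
    rw [intervalIntegral.integral_const_mul, intervalIntegral.integral_add (se.intLeft x 0 T)
      (((hw.mul hw').const_mul _).intLeft x 0 T), intervalIntegral.integral_const_mul]
  simp only [hI] at key
  have c1 : Continuous fun x => ∫ t in (0:ℝ)..T, (μ' * (S t x - ω * tprim w t x) * w' t x -
      μ * (S' t x - ω * tprim w' t x) * w t x) := se.swap.continuous_integral 0 T
  have c2 : Continuous fun x => ∫ t in (0:ℝ)..T, w t x * w' t x :=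
    (hw.mul hw').swap.continuous_integral 0 T
  have c3 : Continuous fun x => tprim w T x *
      ((S' T x - w' T x - ω * tprim w' T x) / (μ' * ω)) := (sV.mul sp').right T
  rw [integral_affine_comb c1 c2 c3] at key
  have eV : ∀ t ∈ Icc 0 T, ∀ x ∈ Icc (0:ℝ) 1, |S t x - ω * tprim w t x| ≤ 2 * ω * D :=
    fun t ht x hx => (abs_sub _ _).trans (by
      rw [abs_mul, abs_of_pos hω]
      linarith [SB t x, mul_le_mul_of_nonneg_left (VB t ht.2 x hx) hω.le])
  have eV' : ∀ t ∈ Icc 0 T, ∀ x ∈ Icc (0:ℝ) 1, |S' t x - ω * tprim w' t x| ≤ 2 * ω * D :=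
    fun t ht x hx => (abs_sub _ _).trans (by
      rw [abs_mul, abs_of_pos hω]
      linarith [SB' t x, mul_le_mul_of_nonneg_left (VB' t ht.2 x hx) hω.le])
  have b1 : |∫ x in (0:ℝ)..1, ∫ t in (0:ℝ)..T, (μ' * (S t x - ω * tprim w t x) * w' t x -
      μ * (S' t x - ω * tprim w' t x) * w t x)| ≤ 4 * ω * D * B * T := by
    have := abs_integral_le_of_le (f := fun x => ∫ t in (0:ℝ)..T,
      (μ' * (S t x - ω * tprim w t x) * w' t x - μ * (S' t x - ω * tprim w' t x) * w t x))
      zero_le_one (C := 4 * ω * D * B * T) fun x hx => ?_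
    · simpa using this
    have := abs_integral_le_of_le hT.le (C := 4 * ω * D * B) (f := fun t =>
      μ' * (S t x - ω * tprim w t x) * w' t x - μ * (S' t x - ω * tprim w' t x) * w t x)
      fun t ht => ?_
    · simpa using this
    refine (abs_sub _ _).trans ?_
    have aux : ∀ {m e v : ℝ}, 0 < m → m ≤ 1 → |e| ≤ 2 * ω * D → |v| ≤ B →
        |m * e * v| ≤ 2 * ω * D * B := fun {m e v} h1 h2 h3 h4 => by
      rw [abs_mul, abs_mul, abs_of_pos h1]
      exact mul_le_mul ((mul_le_of_le_one_left (abs_nonneg _) h2).trans h3) h4 (abs_nonneg _)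
        ((abs_nonneg _).trans h3)
    linarith [aux hμ' hμ1' (eV t ht x hx) (wB' t x hx), aux hμ hμ1 (eV' t ht x hx) (wB t x hx)]
  have b2 : |∫ x in (0:ℝ)..1, tprim w T x *
      ((S' T x - w' T x - ω * tprim w' T x) / (μ' * ω))| ≤ D * ((2 * ω * D + B) / (μ' * ω)) := by
    have := abs_integral_le_of_le (f := fun x => tprim w T x *
      ((S' T x - w' T x - ω * tprim w' T x) / (μ' * ω))) zero_le_one
      (C := D * ((2 * ω * D + B) / (μ' * ω))) fun x hx => ?_
    · simpa using this
    have hpos : 0 < μ' * ω := by positivity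
    rw [abs_mul, abs_div, abs_of_pos hpos]
    have e : |S' T x - w' T x - ω * tprim w' T x| ≤ 2 * ω * D + B := by
      have : S' T x - w' T x - ω * tprim w' T x = (S' T x - ω * tprim w' T x) - w' T x := by ring
      rw [this]
      exact (abs_sub _ _).trans (add_le_add (eV' T ⟨hT.le, le_rfl⟩ x hx) (wB' T x hx))
    have := VB T le_rfl x hx
    gcongr
  have b3 : ∀ x ∈ Icc (0:ℝ) 1, |∫ t in (0:ℝ)..T, tprim w t x * w' t x| ≤ D * B * T := by
    intro x hx
    have := abs_integral_le_of_le hT.le (C := D * B) (f := fun t => tprim w t x * w' t x)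
      fun t ht => ?_
    · simpa using this
    rw [abs_mul]
    exact mul_le_mul (VB t ht.2 x hx) (wB' t x hx) (abs_nonneg _) hD
  set I := ∫ x in (0:ℝ)..1, ∫ t in (0:ℝ)..T, w t x * w' t x with hIdef
  set E1 := ∫ x in (0:ℝ)..1, ∫ t in (0:ℝ)..T, (μ' * (S t x - ω * tprim w t x) * w' t x -
      μ * (S' t x - ω * tprim w' t x) * w t x)
  set E2 := ∫ x in (0:ℝ)..1, tprim w T x * ((S' T x - w' T x - ω * tprim w' T x) / (μ' * ω))
  set F1 := ∫ t in (0:ℝ)..T, tprim w t 1 * w' t 1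
  set F0 := ∫ t in (0:ℝ)..T, tprim w t 0 * w' t 0
  have h1 := b3 1 (by simp)
  have h0 := b3 0 (by simp)
  have hk : (μ - μ') * I = μ * μ' * ω * (F1 - F0 - E2) - E1 := by
    have : (μ * μ' * ω)⁻¹ * (E1 + (μ - μ') * I) = F1 - F0 - E2 := by linarith
    rw [inv_mul_eq_iff_eq_mul₀ (by positivity)] at this
    linarith
  rw [← abs_mul, hk]
  have hb : |F1 - F0| ≤ 2 * (D * B * T) := (abs_sub _ _).trans (by linarith)
  have hm : μ * μ' * ω ≤ ω := mul_le_of_le_one_left hω.le (mul_le_one₀ hμ1 hμ'.le hμ1')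
  have t1 : |μ * μ' * ω * (F1 - F0)| ≤ ω * (2 * (D * B * T)) := by
    rw [abs_mul, abs_of_pos (by positivity)]
    exact mul_le_mul hm hb (abs_nonneg _) hω.le
  have t2 : |μ * μ' * ω * E2| ≤ D * (2 * ω * D + B) := by
    rw [abs_mul, abs_of_pos (by positivity)]
    calc μ * μ' * ω * |E2| ≤ μ * μ' * ω * (D * ((2 * ω * D + B) / (μ' * ω))) := by gcongr
      _ = μ * (D * (2 * ω * D + B)) := by field_simp
      _ ≤ _ := mul_le_of_le_one_left (by positivity) hμ1
  have : μ * μ' * ω * (F1 - F0 - E2) - E1 = μ * μ' * ω * (F1 - F0) - μ * μ' * ω * E2 - E1 := by ring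
  rw [this]
  have hDB : 0 ≤ D * B := mul_nonneg hD hB
  have hDBT : 0 ≤ D * B * T := mul_nonneg hDB hT.le
  nlinarith [abs_sub (μ * μ' * ω * (F1 - F0) - μ * μ' * ω * E2) E1,
    abs_sub (μ * μ' * ω * (F1 - F0)) (μ * μ' * ω * E2), mul_nonneg hDB hω.le, mul_nonneg hD hD]

/-- The scattered part at `x = 1`, transported back into the domain after reflection. -/
noncomputable def reflW (c ω : ℝ) (y : ℝ → ℝ → ℝ) : ℝ → ℝ → ℝ :=
  bdry c ω fun t => scat c ω y t 1

theorem scat_eq_sub_bdry (c ω : ℝ) (y : ℝ → ℝ → ℝ) :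
    scat c ω y = fun t x => y t x - bdry c ω (fun t => y t 0) t x := rfl

namespace Transp

variable {T c μ ω M B K : ℝ} {y G : ℝ → ℝ → ℝ}

theorem sepReg_scat (h : Transp T c ω M B K y G) : SepReg (scat c ω y) :=
  h.hy.sub (sepReg_bdry (h.hy.left 0))

theorem scat_eq_zero (h : Transp T c ω M B K y G) {t x : ℝ} (ht : t ≤ 0) (hx : 0 ≤ x) :
    scat c ω y t x = 0 := by
  rw [scat_eq_sub_bdry]
  simp only [h.y0 t ht x, bdry_eq_zero (fun t ht => h.y0 t ht 0) h.hc ht hx, sub_zero]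

theorem abs_scat_le (h : Transp T c ω M B K y G) (t : ℝ) {x : ℝ} (hx : 0 ≤ x) :
    |scat c ω y t x| ≤ 2 * B := by
  rw [scat_eq_sub_bdry]
  refine (abs_sub _ _).trans ?_
  linarith [h.yB t x, abs_bdry_le h.hc h.hω (fun t => h.yB t 0) hx t]

theorem abs_tprim_scat_le (h : Transp T c ω M B K y G) {t x : ℝ} (ht : t ≤ T)
    (hx : x ∈ Icc (0:ℝ) 1) : |tprim (scat c ω y) t x| ≤ M * K / ω := by
  have hc := h.hc
  have hω := h.hω
  have hM := h.hM
  rw [h.tprim_scat ht hx, abs_mul, abs_of_nonneg (by positivity)]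
  calc M / c * |lineInt c ω G t x| ≤ M / c * (K * (c / ω)) := by
        gcongr
        exact abs_lineInt_le hc hω h.GB hx.1
    _ = _ := by field_simp

theorem tprim_scat_sub_ge (h : Transp T c ω M B K y G) {L l s t x : ℝ} (hl : 0 < l) (hL : 0 ≤ L)
    (hG : ∀ s t, s ≤ t → t ≤ T → ∀ z ∈ Icc (0:ℝ) 1, -(L * Real.exp (l * t)) ≤ G t z - G s z)
    (hst : s ≤ t) (ht : t ≤ T) (hx : x ∈ Icc (0:ℝ) 1) :
    -(M / l * (L * Real.exp (l * t))) ≤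
      tprim (scat c ω y) t x - tprim (scat c ω y) s x := by
  have hc := h.hc
  have hM := h.hM
  rw [h.tprim_scat ht hx, h.tprim_scat (hst.trans ht) hx, ← mul_sub]
  calc -(M / l * (L * Real.exp (l * t))) = M / c * -(c / l * (L * Real.exp (l * t))) := by
        field_simp
    _ ≤ _ := by
        gcongr
        exact lineInt_sub_ge h.hG hc h.hω hl hL hG hst ht hx

theorem tprim_reflW (h : Transp T c ω M B K y G) {x : ℝ} (hx : 0 ≤ x) (t : ℝ) :
    tprim (reflW c ω y) t x = bdry c ω (fun t => tprim (scat c ω y) t 1) t x :=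
  tprim_bdry (h.continuous_scat_left 1) (fun _ ht => h.scat_eq_zero ht zero_le_one) h.hc hx t

theorem tprim_reflW_sub_ge (h : Transp T c ω M B K y G) {L l s t x : ℝ} (hl : 0 < l) (hL : 0 ≤ L)
    (hG : ∀ s t, s ≤ t → t ≤ T → ∀ z ∈ Icc (0:ℝ) 1, -(L * Real.exp (l * t)) ≤ G t z - G s z)
    (hst : s ≤ t) (ht : t ≤ T) (hx : x ∈ Icc (0:ℝ) 1) :
    -(M / l * (L * Real.exp (l * t))) ≤
      tprim (reflW c ω y) t x - tprim (reflW c ω y) s x := by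
  have hc := h.hc
  have hM := h.hM
  have hω := h.hω
  have hxc : 0 ≤ x / c := div_nonneg hx.1 hc.le
  rw [h.tprim_reflW hx.1, h.tprim_reflW hx.1, bdry, bdry, ← mul_sub]
  have h1 := h.tprim_scat_sub_ge hl hL hG (s := s - x / c) (t := t - x / c) (x := 1) (by linarith)
    (by linarith) (by simp)
  have h2 : Real.exp (-(ω / c) * x) ≤ 1 := Real.exp_le_one_iff.2 (by
    rw [neg_mul]; have := hx.1; exact neg_nonpos.2 (by positivity))
  have h3 : Real.exp (l * (t - x / c)) ≤ Real.exp (l * t) :=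
    Real.exp_le_exp.2 (mul_le_mul_of_nonneg_left (by linarith) hl.le)
  have h4 : M / l * (L * Real.exp (l * (t - x / c))) ≤ M / l * (L * Real.exp (l * t)) := by gcongr
  have h5 : 0 ≤ M / l * (L * Real.exp (l * t)) := by positivity
  nlinarith [Real.exp_pos (-(ω / c) * x)]

theorem tprim_sub {f g : ℝ → ℝ → ℝ} (hf : SepReg f) (hg : SepReg g) (t x : ℝ) :
    tprim (fun t x => f t x - g t x) t x = tprim f t x - tprim g t x :=
  intervalIntegral.integral_sub (hf.intLeft _ _ _) (hg.intLeft _ _ _)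

theorem wave_scat (h : Transp T (μ * ω) ω M B K y G) (hμ : μ ∈ Ioc (0:ℝ) 1) :
    Wave T μ ω (2 * B) (M * K / ω) (scat (μ * ω) ω y) fun t x => M * G t x where
  hT := h.hT
  hμ := hμ
  hω := h.hω
  hw := h.sepReg_scat
  hS := h.hG.const_mul M
  wB t x hx := h.abs_scat_le t hx.1
  VB t ht x hx := h.abs_tprim_scat_le ht hx
  SB t x := by
    rw [abs_mul, abs_of_nonneg h.hM, mul_div_cancel₀ _ h.hω.ne']
    exact mul_le_mul_of_nonneg_left (h.GB t x) h.hM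
  xd t ht x hx := by
    have hb := sepReg_bdry (c := μ * ω) (ω := ω) (h.hy.left 0)
    have hV := h.hy.sepReg_tprim
    have h1 := h.tp t ht x hx
    have h2 := xDeriv_bdry (c := μ * ω) (ω := ω) (h.hy.left 0) (fun t ht => h.y0 t ht 0) h.hc T t ht
      x hx
    simp only [scat_eq_sub_bdry, tprim_sub h.hy hb]
    rw [sub_sub_sub_comm, h1, h2, ← intervalIntegral.integral_sub]
    · exact intervalIntegral.integral_congr fun z _ => by ring
    · exact ((((continuous_const.mul (h.hG.right t)).sub (h.hy.right t)).sub
        (continuous_const.mul (hV.right t))).div_const _).intervalIntegrable _ _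
    · exact (((hb.right t).neg.sub
        (continuous_const.mul (hb.sepReg_tprim.right t))).div_const _).intervalIntegrable _ _

theorem wave_reflW (h : Transp T (μ * ω) ω M B K y G) (hμ : μ ∈ Ioc (0:ℝ) 1) :
    Wave T μ ω (2 * B) (M * K / ω) (reflW (μ * ω) ω y) fun _ _ => 0 where
  hT := h.hT
  hμ := hμ
  hω := h.hω
  hw := sepReg_bdry (h.continuous_scat_left 1)
  hS := SepReg.const 0
  wB t x hx := abs_bdry_le h.hc h.hω (fun t => h.abs_scat_le t zero_le_one) hx.1 t
  VB t ht x hx := by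
    have hω := h.hω
    have hc := h.hc
    have hx0 := hx.1
    have hxc : 0 ≤ x / (μ * ω) := div_nonneg hx.1 hc.le
    rw [h.tprim_reflW hx.1, bdry, abs_mul, Real.abs_exp]
    refine (mul_le_of_le_one_left (abs_nonneg _) (Real.exp_le_one_iff.2 ?_)).trans
      (h.abs_tprim_scat_le (by linarith) (by simp))
    rw [neg_mul]
    exact neg_nonpos.2 (by positivity)
  SB t x := by
    have hK : 0 ≤ K := (abs_nonneg _).trans (h.GB 0 0)
    have := h.hM
    have := h.hω
    rw [abs_zero]
    positivity
  xd := by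
    simpa using! xDeriv_bdry (c := μ * ω) (ω := ω) (h.continuous_scat_left 1)
      (fun _ ht => h.scat_eq_zero ht zero_le_one) h.hc T

end Transp

theorem prod_restrict_band_le (δ : ℝ) :
    ((volume.restrict (Ioc (0:ℝ) 1)).prod (volume.restrict (Ioc (0:ℝ) 1))).real
      {p | |p.1 - p.2| ≤ δ} ≤ 2 * max δ 0 := by
  have hm : MeasurableSet {p : ℝ × ℝ | |p.1 - p.2| ≤ δ} :=
    (isClosed_le (by fun_prop) continuous_const).measurableSet
  have key : ((volume.restrict (Ioc (0:ℝ) 1)).prod (volume.restrict (Ioc (0:ℝ) 1)))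
      {p | |p.1 - p.2| ≤ δ} ≤ ENNReal.ofReal (2 * δ) := by
    rw [Measure.prod_apply hm]
    calc _ ≤ ∫⁻ _ in Ioc (0:ℝ) 1, ENNReal.ofReal (2 * δ) := by
          refine lintegral_mono fun x => (Measure.restrict_apply_le _ _).trans ?_
          have : (Prod.mk x ⁻¹' {p : ℝ × ℝ | |p.1 - p.2| ≤ δ}) = Metric.closedBall x δ := by
            ext y
            simp [Real.dist_eq, abs_sub_comm]
          rw [this, Real.volume_closedBall]
      _ = _ := by simp
  rw [measureReal_def]
  refine (ENNReal.toReal_mono ENNReal.ofReal_ne_top key).trans ?_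
  rw [ENNReal.toReal_ofReal']
  rcases le_total δ 0 with h | h
  · simp [h]; linarith
  · simp [h]

theorem integral_abs_average_le {β : Type*} [MeasurableSpace β] (ν : Measure β) [IsFiniteMeasure ν]
    {W : ℝ → β → ℝ} (hW : Measurable (Function.uncurry W)) {b P δ α : ℝ}
    (hb : ∀ μ z, |W μ z| ≤ b)
    (hP : ∀ μ ∈ Ioc (0:ℝ) 1, ∀ μ' ∈ Ioc (0:ℝ) 1, |μ - μ'| * |∫ z, W μ z * W μ' z ∂ν| ≤ P)
    (hδ : 0 < δ) (hα : 0 < α) :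
    ∫ z, |∫ μ in Ioc (0:ℝ) 1, W μ z| ∂ν ≤
      (α * ν.real univ + (2 * δ * (b ^ 2 * ν.real univ) + P / δ) / α) / 2 := by
  set m := volume.restrict (Ioc (0:ℝ) 1) with hm
  have : IsFiniteMeasure m := by rw [hm]; infer_instance
  have hm1 : m.real univ = 1 := by simp [hm]
  set ρ : β → ℝ := fun z => ∫ μ, W μ z ∂m with hρ
  have hρm : StronglyMeasurable ρ :=
    (hW.comp measurable_swap).stronglyMeasurable.integral_prod_right' (ν := m)
  have hρb : ∀ z, |ρ z| ≤ b := fun z => by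
    have := norm_integral_le_of_norm_le_const (μ := m) (f := fun μ => W μ z) (C := b)
      (Eventually.of_forall fun μ => hb μ z)
    rwa [hm1, mul_one] at this
  have hρi : Integrable ρ ν := Integrable.of_bound hρm.aestronglyMeasurable b
    (Eventually.of_forall hρb)
  have hρ2 : Integrable (fun z => ρ z ^ 2) ν :=
    Integrable.of_bound (hρm.pow 2).aestronglyMeasurable (b ^ 2) (Eventually.of_forall fun z => by
      rw [norm_pow]
      exact pow_le_pow_left₀ (norm_nonneg _) (hρb z) 2)
  have hP0 : 0 ≤ P := by simpa using hP 1 (by simp) 1 (by simp)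
  have hWW : Measurable fun q : β × ℝ × ℝ => W q.2.1 q.1 * W q.2.2 q.1 :=
    (hW.comp (f := fun q : β × ℝ × ℝ => (q.2.1, q.1)) (by fun_prop)).mul
      (hW.comp (f := fun q : β × ℝ × ℝ => (q.2.2, q.1)) (by fun_prop))
  have hWb : ∀ a a' z, ‖W a z * W a' z‖ ≤ b ^ 2 := fun a a' z => by
    rw [norm_mul, sq]
    exact mul_le_mul (hb _ _) (hb _ _) (norm_nonneg _) ((abs_nonneg _).trans (hb a z))
  have hsq : ∫ z, ρ z ^ 2 ∂ν ≤ 2 * δ * (b ^ 2 * ν.real univ) + P / δ := by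
    have e1 : ∀ z, ρ z ^ 2 = ∫ p, W p.1 z * W p.2 z ∂(m.prod m) := fun z => by
      rw [integral_prod_mul (fun a => W a z) (fun a => W a z), sq]
    simp only [e1]
    rw [integral_integral_swap (f := fun z (p : ℝ × ℝ) => W p.1 z * W p.2 z)
      (Integrable.of_bound hWW.aestronglyMeasurable (b ^ 2)
        (Eventually.of_forall fun q => hWb _ _ _))]
    have hband : MeasurableSet {p : ℝ × ℝ | |p.1 - p.2| ≤ δ} :=
      (isClosed_le (by fun_prop) continuous_const).measurableSet
    have hmem : ∀ᵐ p ∂(m.prod m), p.1 ∈ Ioc (0:ℝ) 1 ∧ p.2 ∈ Ioc (0:ℝ) 1 := by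
      rw [hm, Measure.prod_restrict]
      exact ae_restrict_mem (measurableSet_Ioc.prod measurableSet_Ioc)
    have hle : ∀ᵐ p ∂(m.prod m), ‖∫ z, W p.1 z * W p.2 z ∂ν‖ ≤
        {p : ℝ × ℝ | |p.1 - p.2| ≤ δ}.indicator (fun _ => b ^ 2 * ν.real univ) p + P / δ := by
      filter_upwards [hmem] with p hp
      by_cases h : |p.1 - p.2| ≤ δ
      · rw [indicator_of_mem (by exact h)]
        have := norm_integral_le_of_norm_le_const (μ := ν) (f := fun z => W p.1 z * W p.2 z)
          (C := b ^ 2) (Eventually.of_forall fun z => hWb _ _ _)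
        have : 0 ≤ P / δ := by positivity
        linarith
      · rw [indicator_of_notMem (by exact h), zero_add, le_div_iff₀ hδ]
        push Not at h
        have := hP _ hp.1 _ hp.2
        rw [Real.norm_eq_abs, mul_comm]
        exact (mul_le_mul_of_nonneg_right h.le (abs_nonneg _)).trans this
    have hind : Integrable ({p : ℝ × ℝ | |p.1 - p.2| ≤ δ}.indicator
        (fun _ => b ^ 2 * ν.real univ)) (m.prod m) := (integrable_const _).indicator hband
    refine (le_abs_self _).trans ((norm_integral_le_of_norm_le
      (hind.add (integrable_const _)) hle).trans ?_)
    simp only [Pi.add_apply]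
    rw [integral_add hind (integrable_const _), integral_indicator_const _ hband]
    have h1 := prod_restrict_band_le δ
    rw [max_eq_left hδ.le] at h1
    have h2 : (m.prod m).real univ = 1 := by
      rw [← univ_prod_univ, measureReal_prod_prod, hm1, one_mul]
    rw [integral_const, h2, one_smul, smul_eq_mul]
    gcongr
  calc ∫ z, |ρ z| ∂ν ≤ ∫ z, (α + ρ z ^ 2 / α) / 2 ∂ν := by
        refine integral_mono hρi.abs (((integrable_const _).add (hρ2.div_const _)).div_const _)
          fun z => ?_
        have h := sq_nonneg (|ρ z| - α)
        have h' : 2 * |ρ z| ≤ α + ρ z ^ 2 / α := by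
          rw [← sub_nonneg]
          have : α + ρ z ^ 2 / α - 2 * |ρ z| = (|ρ z| - α) ^ 2 / α := by
            field_simp
            rw [← sq_abs (ρ z)]
            ring
          rw [this]
          positivity
        show |ρ z| ≤ (α + ρ z ^ 2 / α) / 2
        linarith
    _ = (α * ν.real univ + (∫ z, ρ z ^ 2 ∂ν) / α) / 2 := by
        rw [integral_div, integral_add (integrable_const _) (hρ2.div_const _), integral_div,
          integral_const, smul_eq_mul, mul_comm α]
    _ ≤ _ := by gcongr

/-- The points `(μ, ω, x, t)` with `0 < μ ≤ 1`, `0 < ω`, `0 ≤ x ≤ 1` and `t ≤ T`. -/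
def phaseDom (T : ℝ) : Set (ℝ × ℝ × ℝ × ℝ) :=
  {p | (p.1 ∈ Ioc (0:ℝ) 1 ∧ 0 < p.2.1) ∧ p.2.2.1 ∈ Icc (0:ℝ) 1 ∧ p.2.2.2 ≤ T}

theorem measurableSet_phaseDom (T : ℝ) : MeasurableSet (phaseDom T) := by
  refine MeasurableSet.inter (MeasurableSet.inter ?_ ?_) (MeasurableSet.inter ?_ ?_)
  · exact measurable_fst measurableSet_Ioc
  · exact measurableSet_lt measurable_const (measurable_fst.comp measurable_snd)
  · exact (show Measurable fun p : ℝ × ℝ × ℝ × ℝ => p.2.2.1 by fun_prop) measurableSet_Icc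
  · exact measurableSet_le (measurable_snd.comp (measurable_snd.comp measurable_snd)) measurable_const

/-- A family `w μ ω t x`, extended by zero, as a function of `(μ, ω, x, t)`. -/
noncomputable def phaseInd (T : ℝ) (w : ℝ → ℝ → ℝ → ℝ → ℝ) : ℝ × ℝ × ℝ × ℝ → ℝ :=
  (phaseDom T).indicator fun p => w p.1 p.2.1 p.2.2.2 p.2.2.1

theorem abs_phaseInd_le {T B : ℝ} {w : ℝ → ℝ → ℝ → ℝ → ℝ} (hB : 0 ≤ B)
    (h : ∀ μ ∈ Ioc (0:ℝ) 1, ∀ ω, 0 < ω → ∀ t, ∀ x ∈ Icc (0:ℝ) 1, |w μ ω t x| ≤ B)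
    (p : ℝ × ℝ × ℝ × ℝ) : |phaseInd T w p| ≤ B := by
  by_cases hp : p ∈ phaseDom T
  · rw [phaseInd, indicator_of_mem hp]
    exact h _ hp.1.1 _ hp.1.2 _ _ hp.2.1
  · rwa [phaseInd, indicator_of_notMem hp, abs_zero]

/-- The angular integral over `0 < μ ≤ 1` of the family `w`, as a function of `(ω, x, t)`. -/
noncomputable def density (T : ℝ) (w : ℝ → ℝ → ℝ → ℝ → ℝ) (q : ℝ × ℝ × ℝ) : ℝ :=
  ∫ μ in Ioc (0:ℝ) 1, phaseInd T w (μ, q)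

theorem measurable_density {T : ℝ} {w : ℝ → ℝ → ℝ → ℝ → ℝ} (h : Measurable (phaseInd T w)) :
    Measurable (density T w) :=
  ((h.comp measurable_swap).stronglyMeasurable.integral_prod_right'
    (ν := volume.restrict (Ioc (0:ℝ) 1))).measurable

theorem integral_abs_density_le {T B K ω : ℝ} {w S : ℝ → ℝ → ℝ → ℝ → ℝ} {D : ℝ → ℝ}
    (hB : 0 ≤ B) (hK : 0 ≤ K) (hD : D ω ≤ K * Real.exp (-ω / 2)) (hω : 0 < ω)
    (hw : ∀ μ ∈ Ioc (0:ℝ) 1, ∀ ω, 0 < ω → Wave T μ ω B (D ω) (w μ ω) (S μ ω))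
    (hm : Measurable (phaseInd T w)) :
    ∫ z in Ioc (0:ℝ) 1 ×ˢ Ioc (0:ℝ) T, |density T w (ω, z)| ≤
      (T + 2 * (B ^ 2 * T) + 4 * K * (6 * T * B + 2 * K + B)) / 2 * Real.exp (-ω / 16) := by
  have h1 := hw 1 (by simp) ω hω
  have hT := h1.hT
  have hD0 : 0 ≤ D ω := (abs_nonneg _).trans (h1.VB 0 hT.le 0 (by simp))
  have hvol : (volume.restrict (Ioc (0:ℝ) 1 ×ˢ Ioc (0:ℝ) T)).real univ = T := by
    rw [measureReal_restrict_apply_univ, measureReal_def, Measure.volume_eq_prod,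
      Measure.prod_prod]
    simp [hT.le]
  have : IsFiniteMeasure (volume.restrict (Ioc (0:ℝ) 1 ×ˢ Ioc (0:ℝ) T)) :=
    ⟨by
      rw [Measure.restrict_apply_univ, Measure.volume_eq_prod, Measure.prod_prod]
      simp⟩
  set P := 4 * K * (6 * T * B + 2 * K + B) * Real.exp (-ω / 4) with hPdef
  have hE : Real.exp (-ω / 2) ≤ 1 := Real.exp_le_one_iff.2 (by linarith)
  have hDK : D ω ≤ K := hD.trans (mul_le_of_le_one_right hK hE)
  have hP : D ω * (1 + ω) * (6 * T * B + 2 * D ω + B) ≤ P := by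
    have e1 : 1 + ω ≤ 4 * Real.exp (ω / 4) := by linarith [Real.add_one_le_exp (ω / 4)]
    calc D ω * (1 + ω) * (6 * T * B + 2 * D ω + B)
        ≤ K * Real.exp (-ω / 2) * (4 * Real.exp (ω / 4)) * (6 * T * B + 2 * K + B) := by
          gcongr
      _ = 4 * K * (6 * T * B + 2 * K + B) * (Real.exp (-ω / 2) * Real.exp (ω / 4)) := by ring
      _ = P := by rw [← Real.exp_add, hPdef]; ring_nf
  have key := integral_abs_average_le (volume.restrict (Ioc (0:ℝ) 1 ×ˢ Ioc (0:ℝ) T))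
    (W := fun μ z => phaseInd T w (μ, ω, z)) (b := B) (P := P) (δ := Real.exp (-ω / 8))
    (α := Real.exp (-ω / 16)) (hm.comp (f := fun p : ℝ × ℝ × ℝ => (p.1, ω, p.2)) (by fun_prop))
    (fun μ z => abs_phaseInd_le hB (fun μ hμ ω hω => (hw μ hμ ω hω).wB) _) ?_
    (Real.exp_pos _) (Real.exp_pos _)
  · refine key.trans (le_of_eq ?_)
    rw [hvol, hPdef]
    have e1 : Real.exp (-ω / 8) = Real.exp (-ω / 16) ^ 2 := by
      rw [← Real.exp_nat_mul]; ring_nf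
    have e2 : Real.exp (-ω / 4) = Real.exp (-ω / 16) ^ 4 := by
      rw [← Real.exp_nat_mul]; ring_nf
    rw [e1, e2]
    have := Real.exp_pos (-ω / 16)
    field_simp
    ring
  · intro μ hμ μ' hμ'
    refine le_trans (le_of_eq ?_) (((hw μ hμ ω hω).orthogonal (hw μ' hμ' ω hω)).trans hP)
    congr 2
    have hreg := (hw μ hμ ω hω).hw.mul (hw μ' hμ' ω hω).hw
    rw [intervalIntegral.integral_of_le zero_le_one]
    simp only [intervalIntegral.integral_of_le hT.le]
    rw [← setIntegral_prod (fun z : ℝ × ℝ => w μ ω z.2 z.1 * w μ' ω z.2 z.1)]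
    · refine setIntegral_congr_fun (measurableSet_Ioc.prod measurableSet_Ioc) fun z hz => ?_
      have hz1 : z.1 ∈ Icc (0:ℝ) 1 := Ioc_subset_Icc_self hz.1
      have a1 : (μ, ω, z) ∈ phaseDom T := ⟨⟨hμ, hω⟩, hz1, hz.2.2⟩
      have a2 : (μ', ω, z) ∈ phaseDom T := ⟨⟨hμ', hω⟩, hz1, hz.2.2⟩
      simp only [phaseInd, indicator_of_mem a1, indicator_of_mem a2]
    · exact (hreg.swap.integrableOn_prod 0 1 0 T).mono_set
        (Set.prod_mono Ioc_subset_Icc_self Ioc_subset_Icc_self)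

theorem measurable_lineInt {G : ℝ → ℝ → ℝ} (hG : SepReg G) :
    ∃ L : ℝ × ℝ × ℝ × ℝ → ℝ, Measurable L ∧
      ∀ c ω x t, 0 ≤ x → L (c, ω, x, t) = lineInt c ω G t x := by
  refine ⟨fun p => ∫ z, (Ioc (0:ℝ) p.2.2.1).indicator (fun z =>
    Real.exp (-(p.2.1 / p.1) * (p.2.2.1 - z)) * G (p.2.2.2 - (p.2.2.1 - z) / p.1) z) z, ?_, ?_⟩
  · have hS : MeasurableSet {q : (ℝ × ℝ × ℝ × ℝ) × ℝ | 0 < q.2 ∧ q.2 ≤ q.1.2.2.1} :=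
      (measurableSet_lt measurable_const measurable_snd).inter
        (measurableSet_le measurable_snd (by fun_prop))
    have hm : Measurable fun q : (ℝ × ℝ × ℝ × ℝ) × ℝ =>
        Real.exp (-(q.1.2.1 / q.1.1) * (q.1.2.2.1 - q.2)) *
          G (q.1.2.2.2 - (q.1.2.2.1 - q.2) / q.1.1) q.2 :=
      Measurable.mul (by fun_prop) (hG.measurable.comp
        (f := fun q : (ℝ × ℝ × ℝ × ℝ) × ℝ => (q.1.2.2.2 - (q.1.2.2.1 - q.2) / q.1.1, q.2))
        (by fun_prop))
    exact (hm.indicator hS).stronglyMeasurable.integral_prod_right'.measurable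
  · intro c ω x t hx
    rw [lineInt, intervalIntegral.integral_of_le hx]
    exact integral_indicator measurableSet_Ioc

theorem measurable_phaseInd_scat {T B K : ℝ} {M : ℝ → ℝ} {y : ℝ → ℝ → ℝ → ℝ → ℝ}
    {G : ℝ → ℝ → ℝ} (hM : Measurable M) (hG : SepReg G)
    (h : ∀ μ ∈ Ioc (0:ℝ) 1, ∀ ω, 0 < ω → Transp T (μ * ω) ω (M ω) B K (y μ ω) G) :
    Measurable (phaseInd T fun μ ω => scat (μ * ω) ω (y μ ω)) := by
  obtain ⟨L, hL, hLe⟩ := measurable_lineInt hG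
  have hu : ∀ n : ℕ, (0:ℝ) < 1 / ((n:ℝ) + 1) := fun n => by positivity
  refine measurable_of_tendsto_metrizable (f := fun (n : ℕ) => (phaseDom T).indicator
    fun p : ℝ × ℝ × ℝ × ℝ => (-(1 / ((n:ℝ) + 1)))⁻¹ *
      (M p.2.1 / (p.1 * p.2.1) * L (p.1 * p.2.1, p.2.1, p.2.2.1, p.2.2.2 + -(1 / ((n:ℝ) + 1))) -
      M p.2.1 / (p.1 * p.2.1) * L (p.1 * p.2.1, p.2.1, p.2.2.1, p.2.2.2))) ?_ ?_
  · intro n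
    refine Measurable.indicator ?_ (measurableSet_phaseDom T)
    have hM' : Measurable fun p : ℝ × ℝ × ℝ × ℝ => M p.2.1 / (p.1 * p.2.1) :=
      (hM.comp (measurable_fst.comp measurable_snd)).div (by fun_prop)
    refine measurable_const.mul ((hM'.mul (hL.comp ?_)).sub (hM'.mul (hL.comp ?_)))
    · fun_prop
    · fun_prop
  · rw [tendsto_pi_nhds]
    intro p
    by_cases hp : p ∈ phaseDom T
    · obtain ⟨μ, ω, x, t⟩ := p
      obtain ⟨⟨hμ, hω⟩, hx, ht⟩ := hp
      have hp : (μ, ω, x, t) ∈ phaseDom T := ⟨⟨hμ, hω⟩, hx, ht⟩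
      simp only [phaseInd, indicator_of_mem hp]
      dsimp only at hμ hω hx ht ⊢
      have hT := h μ hμ ω hω
      have hd := hasDerivAt_iff_tendsto_slope_zero.1 (hT.sepReg_scat.hasDerivAt_tprim t x)
      have hs : Tendsto (fun n : ℕ => -(1 / ((n:ℝ) + 1))) atTop (𝓝[≠] 0) := by
        refine tendsto_nhdsWithin_iff.2 ⟨?_, Eventually.of_forall fun n => ?_⟩
        · simpa using (tendsto_one_div_add_atTop_nhds_zero_nat (𝕜 := ℝ)).neg
        · exact (neg_neg_iff_pos.2 (hu n)).ne
      refine (hd.comp hs).congr fun n => ?_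
      have := hu n
      simp only [Function.comp, smul_eq_mul]
      rw [hT.tprim_scat ht hx, hT.tprim_scat (by linarith) hx, hLe _ _ _ _ hx.1,
        hLe _ _ _ _ hx.1]
    · simp only [phaseInd, indicator_of_notMem hp]
      exact tendsto_const_nhds

theorem measurable_phaseInd_reflW {T B K : ℝ} {M : ℝ → ℝ} {y : ℝ → ℝ → ℝ → ℝ → ℝ}
    {G : ℝ → ℝ → ℝ} (hM : Measurable M) (hG : SepReg G)
    (h : ∀ μ ∈ Ioc (0:ℝ) 1, ∀ ω, 0 < ω → Transp T (μ * ω) ω (M ω) B K (y μ ω) G) :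
    Measurable (phaseInd T fun μ ω => reflW (μ * ω) ω (y μ ω)) := by
  have hs := measurable_phaseInd_scat hM hG h
  have e : (phaseInd T fun μ ω => reflW (μ * ω) ω (y μ ω)) = (phaseDom T).indicator fun p =>
      Real.exp (-(p.2.1 / (p.1 * p.2.1)) * p.2.2.1) *
        phaseInd T (fun μ ω => scat (μ * ω) ω (y μ ω))
          (p.1, p.2.1, 1, p.2.2.2 - p.2.2.1 / (p.1 * p.2.1)) := by
    refine indicator_congr fun p hp => ?_
    obtain ⟨⟨hμ, hω⟩, hx, ht⟩ := hp
    have hpos : 0 ≤ p.2.2.1 / (p.1 * p.2.1) := div_nonneg hx.1 (mul_pos hμ.1 hω).le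
    simp only [reflW, bdry]
    rw [phaseInd, indicator_of_mem]
    exact ⟨⟨hμ, hω⟩, by simp, by dsimp only; linarith⟩
  rw [e]
  refine Measurable.indicator ?_ (measurableSet_phaseDom T)
  refine Measurable.mul (by fun_prop) (hs.comp (by fun_prop))

theorem abs_density_le {T B : ℝ} {w : ℝ → ℝ → ℝ → ℝ → ℝ} (hB : 0 ≤ B)
    (h : ∀ μ ∈ Ioc (0:ℝ) 1, ∀ ω, 0 < ω → ∀ t, ∀ x ∈ Icc (0:ℝ) 1, |w μ ω t x| ≤ B)
    (q : ℝ × ℝ × ℝ) : |density T w q| ≤ B := by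
  have := norm_integral_le_of_norm_le_const (μ := volume.restrict (Ioc (0:ℝ) 1))
    (f := fun μ => phaseInd T w (μ, q)) (C := B)
    (Eventually.of_forall fun μ => abs_phaseInd_le hB h _)
  simpa using! this

theorem intervalIntegrable_density {T B : ℝ} {w : ℝ → ℝ → ℝ → ℝ → ℝ} (hB : 0 ≤ B)
    (h : ∀ μ ∈ Ioc (0:ℝ) 1, ∀ ω, 0 < ω → ∀ t, ∀ x ∈ Icc (0:ℝ) 1, |w μ ω t x| ≤ B)
    (hm : Measurable (phaseInd T w)) (ω x s t : ℝ) :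
    IntervalIntegrable (fun r => density T w (ω, x, r)) volume s t := by
  refine (intervalIntegrable_const (c := B)).mono_fun
    ((measurable_density hm).comp (by fun_prop)).aestronglyMeasurable
    (Eventually.of_forall fun r => ?_)
  simpa [abs_of_nonneg hB] using abs_density_le hB h _

theorem integral_density_ge {T B E ω s t x : ℝ} {w : ℝ → ℝ → ℝ → ℝ → ℝ} (hB : 0 ≤ B)
    (h : ∀ μ ∈ Ioc (0:ℝ) 1, ∀ ω, 0 < ω → ∀ t, ∀ x ∈ Icc (0:ℝ) 1, |w μ ω t x| ≤ B)
    (hm : Measurable (phaseInd T w)) (hω : 0 < ω) (hst : s ≤ t) (ht : t ≤ T)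
    (hx : x ∈ Icc (0:ℝ) 1) (hw : ∀ μ ∈ Ioc (0:ℝ) 1, SepReg (w μ ω))
    (hE : ∀ μ ∈ Ioc (0:ℝ) 1, -E ≤ tprim (w μ ω) t x - tprim (w μ ω) s x) :
    -E ≤ ∫ r in s..t, density T w (ω, x, r) := by
  have hint : Integrable (Function.uncurry fun r μ => phaseInd T w (μ, ω, x, r))
      ((volume.restrict (Ioc s t)).prod (volume.restrict (Ioc (0:ℝ) 1))) :=
    Integrable.of_bound (hm.comp (f := fun q : ℝ × ℝ => (q.2, ω, x, q.1))
      (by fun_prop)).aestronglyMeasurable B (Eventually.of_forall fun q => abs_phaseInd_le hB h _)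
  rw [intervalIntegral.integral_of_le hst]
  simp only [density]
  rw [integral_integral_swap hint]
  have e : ∀ μ ∈ Ioc (0:ℝ) 1, ∫ r in Ioc s t, phaseInd T w (μ, ω, x, r) =
      tprim (w μ ω) t x - tprim (w μ ω) s x := fun μ hμ => by
    rw [tprim, tprim, intervalIntegral.integral_interval_sub_left ((hw μ hμ).intLeft _ _ _)
      ((hw μ hμ).intLeft _ _ _), intervalIntegral.integral_of_le hst]
    refine setIntegral_congr_fun measurableSet_Ioc fun r hr => ?_
    have : (μ, ω, x, r) ∈ phaseDom T := ⟨⟨hμ, hω⟩, hx, hr.2.trans ht⟩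
    simp only [phaseInd, indicator_of_mem this]
  calc -E = ∫ _ in Ioc (0:ℝ) 1, -E := by simp
    _ ≤ _ := by
      refine setIntegral_mono_on (integrable_const _) hint.integral_prod_right measurableSet_Ioc
        fun μ hμ => ?_
      rw [e μ hμ]
      exact hE μ hμ

/-- A solution of the phonon transport equation on `[0,T] × [0,1]` extended to all times and
positions, with its integrated temperature source `G` and `G_t = F`. -/
structure Slab (T B K A : ℝ) (M η : ℝ → ℝ) (u : ℝ → ℝ → ℝ → ℝ → ℝ) (G F : ℝ → ℝ → ℝ) : Prop where
  hT : 0 < T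
  right : ∀ μ ∈ Ioc (0:ℝ) 1, ∀ ω, 0 < ω →
    Transp T (μ * ω) ω (M ω) B K (fun t x => u t x μ ω) G
  left : ∀ μ ∈ Ioc (0:ℝ) 1, ∀ ω, 0 < ω →
    Transp T (μ * ω) ω (M ω) B K (fun t x => u t (1 - x) (-μ) ω) fun t x => G t (1 - x)
  source : ∀ t ∈ Ioo (0:ℝ) T, ∀ x ∈ Icc (0:ℝ) 1, HasDerivAt (fun s => G s x) (F t x) t
  bracket_eq : ∀ t ∈ Icc (0:ℝ) T, ∀ x ∈ Icc (0:ℝ) 1,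
    F t x = ∫ ω in Ioi (0:ℝ), ω * ∫ μ in Icc (-1:ℝ) 1, u t x μ ω
  int_ω : ∀ t ∈ Icc (0:ℝ) T, ∀ x ∈ Icc (0:ℝ) 1,
    IntegrableOn (fun ω => ω * ∫ μ in Icc (-1:ℝ) 1, u t x μ ω) (Ioi (0:ℝ))
  int_μ : ∀ t ∈ Icc (0:ℝ) T, ∀ x ∈ Icc (0:ℝ) 1, ∀ ω, 0 < ω →
    IntegrableOn (fun μ => u t x μ ω) (Icc (-1:ℝ) 1)
  cont : ∀ x ∈ Icc (0:ℝ) 1, ∀ μ ∈ Icc (-1:ℝ) 1, ∀ ω, 0 < ω → Continuous fun t => u t x μ ω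
  bdd : ∀ t x μ ω, |u t x μ ω| ≤ B
  entering : ∀ t ≤ T, ∀ μ ∈ Ioc (0:ℝ) 1, ∀ ω, 0 < ω → 0 ≤ u t 0 μ ω
  reflected : ∀ t ≤ T, ∀ μ ∈ Ioc (0:ℝ) 1, ∀ ω, 0 < ω → η ω * u t 1 μ ω ≤ u t 1 (-μ) ω
  hη : ∀ ω, 0 < ω → η ω ∈ Icc (0:ℝ) 1
  hM : Measurable M
  MA : ∀ ω, 0 < ω → M ω ≤ ω * (A * Real.exp (-ω / 2))

namespace Slab

variable {T B K A : ℝ} {M η : ℝ → ℝ} {u : ℝ → ℝ → ℝ → ℝ → ℝ} {G F : ℝ → ℝ → ℝ}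

/-- The angular integral of the waves scattered into directions `0 < μ ≤ 1`. -/
noncomputable def rightDensity (T : ℝ) (u : ℝ → ℝ → ℝ → ℝ → ℝ) : ℝ × ℝ × ℝ → ℝ :=
  density T fun μ ω => scat (μ * ω) ω fun t x => u t x μ ω

/-- The angular integral of the waves scattered into directions `-1 ≤ μ < 0`, as a function of the
distance to `x = 1`. -/
noncomputable def leftDensity (T : ℝ) (u : ℝ → ℝ → ℝ → ℝ → ℝ) : ℝ × ℝ × ℝ → ℝ :=
  density T fun μ ω => scat (μ * ω) ω fun t x => u t (1 - x) (-μ) ω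

/-- The angular integral of the scattered waves that are fully reflected at `x = 1`, as a function
of the distance to `x = 1`. -/
noncomputable def reflDensity (T : ℝ) (u : ℝ → ℝ → ℝ → ℝ → ℝ) : ℝ × ℝ × ℝ → ℝ :=
  density T fun μ ω => reflW (μ * ω) ω fun t x => u t x μ ω

variable (h : Slab T B K A M η u G F)
include h

theorem B_nonneg : 0 ≤ B := (abs_nonneg _).trans (h.bdd 0 0 0 0)

theorem hG : SepReg G := (h.right 1 (by simp) 1 one_pos).hG

theorem abs_right_le : ∀ μ ∈ Ioc (0:ℝ) 1, ∀ ω, 0 < ω → ∀ t, ∀ x ∈ Icc (0:ℝ) 1,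
    |scat (μ * ω) ω (fun t x => u t x μ ω) t x| ≤ 2 * B :=
  fun μ hμ ω hω t _ hx => (h.right μ hμ ω hω).abs_scat_le t hx.1

theorem abs_left_le : ∀ μ ∈ Ioc (0:ℝ) 1, ∀ ω, 0 < ω → ∀ t, ∀ x ∈ Icc (0:ℝ) 1,
    |scat (μ * ω) ω (fun t x => u t (1 - x) (-μ) ω) t x| ≤ 2 * B :=
  fun μ hμ ω hω t _ hx => (h.left μ hμ ω hω).abs_scat_le t hx.1

theorem abs_refl_le : ∀ μ ∈ Ioc (0:ℝ) 1, ∀ ω, 0 < ω → ∀ t, ∀ x ∈ Icc (0:ℝ) 1,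
    |reflW (μ * ω) ω (fun t x => u t x μ ω) t x| ≤ 2 * B :=
  fun μ hμ ω hω t x hx => ((h.right μ hμ ω hω).wave_reflW hμ).wB t x hx

theorem measurable_right :
    Measurable (phaseInd T fun μ ω => scat (μ * ω) ω fun t x => u t x μ ω) :=
  measurable_phaseInd_scat h.hM h.hG h.right

theorem measurable_left :
    Measurable (phaseInd T fun μ ω => scat (μ * ω) ω fun t x => u t (1 - x) (-μ) ω) :=
  measurable_phaseInd_scat h.hM (h.left 1 (by simp) 1 one_pos).hG h.left

theorem measurable_refl :
    Measurable (phaseInd T fun μ ω => reflW (μ * ω) ω fun t x => u t x μ ω) :=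
  measurable_phaseInd_reflW h.hM h.hG h.right

theorem right_le {t x μ ω : ℝ} (ht : t ≤ T) (hx : x ∈ Icc (0:ℝ) 1) (hμ : μ ∈ Ioc (0:ℝ) 1)
    (hω : 0 < ω) : scat (μ * ω) ω (fun t x => u t x μ ω) t x ≤ u t x μ ω := by
  have hx' : 0 ≤ x / (μ * ω) := div_nonneg hx.1 (mul_pos hμ.1 hω).le
  exact sub_le_self _ (mul_nonneg (Real.exp_pos _).le (h.entering _ (by linarith) μ hμ ω hω))

theorem left_le {t x μ ω : ℝ} (ht : t ≤ T) (hx : x ∈ Icc (0:ℝ) 1) (hμ : μ ∈ Ioc (0:ℝ) 1)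
    (hω : 0 < ω) : scat (μ * ω) ω (fun t x => u t (1 - x) (-μ) ω) t (1 - x) +
      η ω * reflW (μ * ω) ω (fun t x => u t x μ ω) t (1 - x) ≤ u t x (-μ) ω := by
  have hx' : 0 ≤ (1 - x) / (μ * ω) := div_nonneg (by linarith [hx.2]) (mul_pos hμ.1 hω).le
  have ht' : t - (1 - x) / (μ * ω) ≤ T := by linarith
  have h1 := h.reflected _ ht' μ hμ ω hω
  have h2 := mul_le_mul_of_nonneg_left (h.right_le ht' (x := 1) (by simp) hμ hω) (h.hη ω hω).1
  have h3 := mul_le_mul_of_nonneg_left (h2.trans h1)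
    (Real.exp_pos (-(ω / (μ * ω)) * (1 - x))).le
  simp only [reflW, bdry]
  rw [scat]
  simp only [sub_sub_cancel, sub_zero]
  linarith

theorem integrable_phaseInd {w : ℝ → ℝ → ℝ → ℝ → ℝ}
    (hb : ∀ μ ∈ Ioc (0:ℝ) 1, ∀ ω, 0 < ω → ∀ t, ∀ x ∈ Icc (0:ℝ) 1, |w μ ω t x| ≤ 2 * B)
    (hm : Measurable (phaseInd T w)) (q : ℝ × ℝ × ℝ) :
    IntegrableOn (fun μ => phaseInd T w (μ, q)) (Ioc (0:ℝ) 1) := by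
  have := h.B_nonneg
  exact Integrable.of_bound (hm.comp (f := fun μ : ℝ => (μ, q)) (by fun_prop)).aestronglyMeasurable
    (2 * B) (Eventually.of_forall fun μ => abs_phaseInd_le (by positivity) hb _)

theorem densities_le {t x ω : ℝ} (ht : t ∈ Icc (0:ℝ) T) (hx : x ∈ Icc (0:ℝ) 1) (hω : 0 < ω) :
    rightDensity T u (ω, x, t) + leftDensity T u (ω, 1 - x, t) +
      η ω * reflDensity T u (ω, 1 - x, t) ≤ ∫ μ in Icc (-1:ℝ) 1, u t x μ ω := by
  have hi := h.int_μ t ht x hx ω hω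
  have hI : IntervalIntegrable (fun μ => u t x μ ω) volume (-1) 1 := by
    rw [intervalIntegrable_iff_integrableOn_Icc_of_le (by norm_num)]
    exact hi
  have i1 : IntervalIntegrable (fun μ => u t x μ ω) volume (-1) 0 :=
    hI.mono_set (uIcc_subset_uIcc (by simp) (by simp))
  have i2 : IntervalIntegrable (fun μ => u t x μ ω) volume 0 1 :=
    hI.mono_set (uIcc_subset_uIcc (by simp) (by simp))
  have i3 : IntervalIntegrable (fun μ => u t x (-μ) ω) volume 0 1 := by
    simpa using (IntervalIntegrable.comp_sub_left i1 0).symm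
  have e : ∫ μ in Icc (-1:ℝ) 1, u t x μ ω =
      ∫ μ in Ioc (0:ℝ) 1, (u t x μ ω + u t x (-μ) ω) := by
    rw [integral_Icc_eq_integral_Ioc, ← intervalIntegral.integral_of_le (by norm_num),
      ← intervalIntegral.integral_add_adjacent_intervals i1 i2,
      ← intervalIntegral.integral_of_le zero_le_one, intervalIntegral.integral_add i2 i3,
      intervalIntegral.integral_comp_neg (fun μ => u t x μ ω)]
    simp [add_comm]
  have j1 := h.integrable_phaseInd h.abs_right_le h.measurable_right (ω, x, t)
  have j2 := h.integrable_phaseInd h.abs_left_le h.measurable_left (ω, 1 - x, t)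
  have j3 := (h.integrable_phaseInd h.abs_refl_le h.measurable_refl (ω, 1 - x, t)).const_mul (η ω)
  have j12 : IntegrableOn (fun μ =>
      phaseInd T (fun μ ω => scat (μ * ω) ω fun t x => u t x μ ω) (μ, ω, x, t) +
      phaseInd T (fun μ ω => scat (μ * ω) ω fun t x => u t (1 - x) (-μ) ω) (μ, ω, 1 - x, t))
      (Ioc (0:ℝ) 1) := j1.add j2
  rw [e, rightDensity, leftDensity, reflDensity, density, density, density, ← integral_const_mul,
    ← integral_add j1 j2]
  rw [← integral_add j12 j3]
  refine setIntegral_mono_on ((j1.add j2).add j3)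
    (((intervalIntegrable_iff_integrableOn_Ioc_of_le zero_le_one).1 i2).add
      ((intervalIntegrable_iff_integrableOn_Ioc_of_le zero_le_one).1 i3)) measurableSet_Ioc
    fun μ hμ => ?_
  have hx1 : 1 - x ∈ Icc (0:ℝ) 1 := ⟨by linarith [hx.2], by linarith [hx.1]⟩
  have a1 : (μ, ω, x, t) ∈ phaseDom T := ⟨⟨hμ, hω⟩, hx, ht.2⟩
  have a2 : (μ, ω, 1 - x, t) ∈ phaseDom T := ⟨⟨hμ, hω⟩, hx1, ht.2⟩
  simp only [phaseInd, indicator_of_mem a1, indicator_of_mem a2]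
  linarith [h.right_le ht.2 hx hμ hω, h.left_le ht.2 hx hμ hω]

end Slab

theorem integrableOn_mul_exp_neg {b : ℝ} (hb : 0 < b) :
    IntegrableOn (fun ω : ℝ => ω * Real.exp (-b * ω)) (Ioi 0) := by
  simpa using integrableOn_rpow_mul_exp_neg_mul_rpow (s := 1) (p := 1) (b := b) (by norm_num)
    one_pos hb

theorem ae_integrable_density {T B K : ℝ} {w S : ℝ → ℝ → ℝ → ℝ → ℝ} {D : ℝ → ℝ}
    (hB : 0 ≤ B) (hK : 0 ≤ K) (hD : ∀ ω, 0 < ω → D ω ≤ K * Real.exp (-ω / 2))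
    (hw : ∀ μ ∈ Ioc (0:ℝ) 1, ∀ ω, 0 < ω → Wave T μ ω B (D ω) (w μ ω) (S μ ω))
    (hm : Measurable (phaseInd T w)) :
    ∀ᵐ x ∂volume.restrict (Ioc (0:ℝ) 1), Integrable
      (fun p : ℝ × ℝ => p.1 * |density T w (p.1, x, p.2)|)
      ((volume.restrict (Ioi 0)).prod (volume.restrict (Ioc 0 T))) := by
  have hdm := measurable_density hm
  set C := (T + 2 * (B ^ 2 * T) + 4 * K * (6 * T * B + 2 * K + B)) / 2
  set f : ℝ → ℝ → ℝ → ENNReal := fun x ω t => ENNReal.ofReal (ω * |density T w (ω, x, t)|)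
  have hfm : Measurable fun q : ℝ × ℝ × ℝ => f q.2.1 q.1 q.2.2 :=
    (measurable_fst.mul hdm.abs).ennreal_ofReal
  have hbound : ∀ ω ∈ Ioi (0:ℝ), ∫⁻ x in Ioc (0:ℝ) 1, ∫⁻ t in Ioc 0 T, f x ω t ≤
      ENNReal.ofReal (C * (ω * Real.exp (-(1/16) * ω))) := fun ω hω => by
    have hω : 0 < ω := hω
    have hfin : IsFiniteMeasure (volume.restrict (Ioc (0:ℝ) 1 ×ˢ Ioc (0:ℝ) T)) :=
      ⟨by
        rw [Measure.restrict_apply_univ, Measure.volume_eq_prod, Measure.prod_prod]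
        simp⟩
    have hi : Integrable (fun z => ω * |density T w (ω, z)|)
        (volume.restrict (Ioc (0:ℝ) 1 ×ˢ Ioc (0:ℝ) T)) := by
      refine (Integrable.of_bound (hdm.comp (f := fun z : ℝ × ℝ => (ω, z))
        (by fun_prop)).aestronglyMeasurable B (Eventually.of_forall fun z => ?_)).abs.const_mul ω
      exact abs_density_le hB (fun μ hμ ω hω => (hw μ hμ ω hω).wB) _
    rw [← lintegral_prod (fun z : ℝ × ℝ => f z.1 ω z.2)
      (hfm.comp (f := fun z : ℝ × ℝ => (ω, z)) (by fun_prop)).aemeasurable,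
      Measure.prod_restrict, ← Measure.volume_eq_prod,
      ← ofReal_integral_eq_lintegral_ofReal hi (Eventually.of_forall fun z => by
        show 0 ≤ ω * _
        positivity)]
    refine ENNReal.ofReal_le_ofReal ?_
    rw [integral_const_mul]
    have := integral_abs_density_le hB hK (hD ω hω) hω hw hm
    calc _ ≤ ω * (C * Real.exp (-ω / 16)) := mul_le_mul_of_nonneg_left this hω.le
      _ = _ := by rw [show -ω / 16 = -(1/16) * ω by ring]; ring
  have htot : ∫⁻ x in Ioc (0:ℝ) 1, ∫⁻ ω in Ioi 0, ∫⁻ t in Ioc 0 T, f x ω t < ⊤ := by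
    rw [lintegral_lintegral_swap]
    · refine (setLIntegral_mono' measurableSet_Ioi hbound).trans_lt ?_
      exact ((integrableOn_mul_exp_neg (b := 1/16) (by norm_num)).const_mul C).lintegral_lt_top
    · exact (Measurable.lintegral_prod_right' (f := fun q : (ℝ × ℝ) × ℝ => f q.1.1 q.1.2 q.2)
        (hfm.comp (f := fun q : (ℝ × ℝ) × ℝ => (q.1.2, q.1.1, q.2)) (by fun_prop))).aemeasurable
  have hxm : Measurable fun x => ∫⁻ ω in Ioi 0, ∫⁻ t in Ioc 0 T, f x ω t :=
    Measurable.lintegral_prod_right' (f := fun q : ℝ × ℝ => ∫⁻ t in Ioc 0 T, f q.1 q.2 t)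
      (Measurable.lintegral_prod_right' (f := fun q : (ℝ × ℝ) × ℝ => f q.1.1 q.1.2 q.2)
        (hfm.comp (f := fun q : (ℝ × ℝ) × ℝ => (q.1.2, q.1.1, q.2)) (by fun_prop)))
  filter_upwards [ae_lt_top hxm htot.ne] with x hx
  have hpm : Measurable fun p : ℝ × ℝ => p.1 * |density T w (p.1, x, p.2)| :=
    measurable_fst.mul (hdm.comp (f := fun p : ℝ × ℝ => (p.1, x, p.2)) (by fun_prop)).abs
  refine ⟨hpm.aestronglyMeasurable, ?_⟩
  have hnn : 0 ≤ᵐ[(volume.restrict (Ioi 0)).prod (volume.restrict (Ioc 0 T))]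
      fun p : ℝ × ℝ => p.1 * |density T w (p.1, x, p.2)| := by
    rw [Measure.prod_restrict]
    refine (ae_restrict_iff' (measurableSet_Ioi.prod measurableSet_Ioc)).2
      (Eventually.of_forall fun p hp => ?_)
    have : 0 < p.1 := hp.1
    show 0 ≤ p.1 * _
    positivity
  rw [hasFiniteIntegral_iff_ofReal hnn, lintegral_prod _ hpm.ennreal_ofReal.aemeasurable]
  exact hx

namespace Slab

variable {T B K A : ℝ} {M η : ℝ → ℝ} {u : ℝ → ℝ → ℝ → ℝ → ℝ} {G F : ℝ → ℝ → ℝ}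

/-- A bound for the total angular density of the scattered waves at `(ω, x, t)`. -/
noncomputable def absDensity (T : ℝ) (u : ℝ → ℝ → ℝ → ℝ → ℝ) (ω x t : ℝ) : ℝ :=
  |rightDensity T u (ω, x, t)| + |leftDensity T u (ω, 1 - x, t)| +
    |reflDensity T u (ω, 1 - x, t)|

theorem absDensity_nonneg (T : ℝ) (u : ℝ → ℝ → ℝ → ℝ → ℝ) (ω x t : ℝ) :
    0 ≤ absDensity T u ω x t := by
  unfold absDensity
  positivity

variable (h : Slab T B K A M η u G F)
include h

theorem neg_absDensity_le {t x ω : ℝ} (ht : t ∈ Icc (0:ℝ) T) (hx : x ∈ Icc (0:ℝ) 1) (hω : 0 < ω) :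
    -absDensity T u ω x t ≤ ∫ μ in Icc (-1:ℝ) 1, u t x μ ω := by
  refine le_trans ?_ (h.densities_le ht hx hω)
  have h1 := neg_abs_le (rightDensity T u (ω, x, t))
  have h2 := neg_abs_le (leftDensity T u (ω, 1 - x, t))
  have h3 := neg_abs_le (reflDensity T u (ω, 1 - x, t))
  have h4 := abs_nonneg (reflDensity T u (ω, 1 - x, t))
  have h5 := h.hη ω hω
  have h6 : -|reflDensity T u (ω, 1 - x, t)| ≤ η ω * reflDensity T u (ω, 1 - x, t) := by
    nlinarith [h5.1, h5.2]
  unfold absDensity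
  linarith

theorem M_nonneg {ω : ℝ} (hω : 0 < ω) : 0 ≤ M ω := (h.right 1 (by simp) ω hω).hM

theorem K_nonneg : 0 ≤ K := (abs_nonneg _).trans ((h.right 1 (by simp) 1 one_pos).GB 0 0)

theorem A_nonneg : 0 ≤ A := by
  have := (h.M_nonneg one_pos).trans (h.MA 1 one_pos)
  rw [one_mul] at this
  exact nonneg_of_mul_nonneg_left this (Real.exp_pos _)

theorem source_bound_le {ω : ℝ} (hω : 0 < ω) : M ω * K / ω ≤ A * K * Real.exp (-ω / 2) := by
  rw [div_le_iff₀ hω]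
  have := mul_le_mul_of_nonneg_right (h.MA ω hω) h.K_nonneg
  linarith

theorem ae_integrable_absDensity : ∀ᵐ x, x ∈ Ioo (0:ℝ) 1 → Integrable
    (fun p : ℝ × ℝ => p.1 * absDensity T u p.1 x p.2)
    ((volume.restrict (Ioi 0)).prod (volume.restrict (Ioc 0 T))) := by
  have hB := h.B_nonneg
  have hAK := mul_nonneg h.A_nonneg h.K_nonneg
  have h1 := ae_integrable_density (B := 2 * B) (by positivity) hAK
    (fun ω hω => h.source_bound_le hω) (fun μ hμ ω hω => (h.right μ hμ ω hω).wave_scat hμ)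
    h.measurable_right
  have h2 := ae_integrable_density (B := 2 * B) (by positivity) hAK
    (fun ω hω => h.source_bound_le hω) (fun μ hμ ω hω => (h.left μ hμ ω hω).wave_scat hμ)
    h.measurable_left
  have h3 := ae_integrable_density (B := 2 * B) (by positivity) hAK
    (fun ω hω => h.source_bound_le hω) (fun μ hμ ω hω => (h.right μ hμ ω hω).wave_reflW hμ)
    h.measurable_refl
  rw [ae_restrict_iff' measurableSet_Ioc] at h1 h2 h3
  have q := (Measure.measurePreserving_sub_left (volume : Measure ℝ) 1).quasiMeasurePreserving
  filter_upwards [h1, q.ae h2, q.ae h3] with x i1 i2 i3 hx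
  have hx' : 1 - x ∈ Ioc (0:ℝ) 1 := ⟨by linarith [hx.2], by linarith [hx.1]⟩
  refine (((i1 (Ioo_subset_Ioc_self hx)).add (i2 hx')).add (i3 hx')).congr
    (Eventually.of_forall fun p => ?_)
  simp only [Pi.add_apply, absDensity, rightDensity, leftDensity, reflDensity]
  ring

end Slab

theorem aemeasurable_uncurry_of_continuous {Ω : Type*} [MeasurableSpace Ω] {ν : Measure Ω}
    [SFinite ν] {m : Measure ℝ} [SFinite m] {f : ℝ → Ω → ℝ}
    (hc : ∀ᵐ ω ∂ν, Continuous fun r => f r ω) (hm : ∀ r, AEMeasurable (f r) ν) :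
    AEMeasurable (Function.uncurry f) (m.prod ν) := by
  have hae : ∀ᵐ ω ∂ν, (Continuous fun r => f r ω) ∧ ∀ q : ℚ, f q ω = (hm q).mk _ ω :=
    hc.and (ae_all_iff.2 fun q => (hm q).ae_eq_mk)
  obtain ⟨N, hN, hNm, hN0⟩ := exists_measurable_superset_of_null (ae_iff.1 hae)
  have hgood : ∀ ω ∉ N, (Continuous fun r => f r ω) ∧ ∀ q : ℚ, f q ω = (hm q).mk _ ω :=
    fun ω hω => by
      by_contra hcon
      exact hω (hN hcon)
  set g : ℝ → Ω → ℝ := fun r => Nᶜ.indicator (f r) with hg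
  have hgc : ∀ ω, Continuous fun r => g r ω := fun ω => by
    by_cases hω : ω ∈ N
    · simp only [hg, indicator_of_notMem (show ω ∉ Nᶜ from fun h => h hω)]
      exact continuous_const
    · simp only [hg, indicator_of_mem (show ω ∈ Nᶜ from hω)]
      exact (hgood ω hω).1
  have hgq : ∀ q : ℚ, Measurable (g q) := fun q => by
    have : g q = Nᶜ.indicator ((hm q).mk _) := indicator_congr fun ω hω => (hgood ω hω).2 q
    rw [this]
    exact (hm q).measurable_mk.indicator hNm.compl
  have hgm : ∀ r, Measurable (g r) := fun r => by
    obtain ⟨q, hq⟩ := mem_closure_iff_seq_limit.1 (Rat.isDenseEmbedding_coe_real.dense r)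
    choose q' hq' using hq.1
    refine measurable_of_tendsto_metrizable (fun n => hgq (q' n)) ?_
    rw [tendsto_pi_nhds]
    intro ω
    have := (hgc ω).tendsto r |>.comp hq.2
    refine this.congr fun n => ?_
    simp only [Function.comp, hq']
  refine ⟨Function.uncurry g, measurable_uncurry_of_continuous_of_measurable hgc hgm, ?_⟩
  have : ∀ᵐ p ∂(m.prod ν), p.2 ∉ N :=
    Measure.quasiMeasurePreserving_snd.ae (measure_eq_zero_iff_ae_notMem.1 hN0)
  filter_upwards [this] with p hp
  simp only [Function.uncurry, hg, indicator_of_mem (show p.2 ∈ Nᶜ from hp)]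

theorem integral_le_sub_of_ae_le {g f φ : ℝ → ℝ} {s t : ℝ} (hst : s ≤ t)
    (hg : ContinuousOn g (Icc s t)) (hd : ∀ r ∈ Ioo s t, HasDerivAt g (f r) r)
    (hφ : IntegrableOn φ (Icc s t)) (hle : ∀ᵐ r ∂volume.restrict (Icc s t), φ r ≤ f r) :
    ∫ r in s..t, φ r ≤ g t - g s := by
  have e : φ =ᵐ[volume.restrict (Icc s t)] fun r => min (φ r) (f r) := by
    filter_upwards [hle] with r hr
    rw [min_eq_left hr]
  have := intervalIntegral.integral_le_sub_of_hasDeriv_right_of_le hst hg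
    (fun r hr => (hd r hr).hasDerivWithinAt) (hφ.congr e) fun r _ => min_le_right _ _
  refine le_trans (le_of_eq ?_) this
  rw [intervalIntegral.integral_of_le hst, intervalIntegral.integral_of_le hst]
  exact integral_congr_ae (ae_mono (Measure.restrict_mono Ioc_subset_Icc_self le_rfl) e)

namespace Slab

variable {T B K A : ℝ} {M η : ℝ → ℝ} {u : ℝ → ℝ → ℝ → ℝ → ℝ} {G F : ℝ → ℝ → ℝ}

/-- The angular integral of `u` at position `x` and frequency `ω`, with time clamped to `[0,T]`. -/
noncomputable def angular (T : ℝ) (u : ℝ → ℝ → ℝ → ℝ → ℝ) (x r ω : ℝ) : ℝ :=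
  ∫ μ in Icc (-1:ℝ) 1, u (max 0 (min r T)) x μ ω

/-- The angular integral below the frequency `R`, and a lower bound for it above `R`. -/
noncomputable def cutAngular (T : ℝ) (u : ℝ → ℝ → ℝ → ℝ → ℝ) (R x r ω : ℝ) : ℝ :=
  if ω ≤ R then angular T u x r ω else -absDensity T u ω x r

theorem angular_of_mem (u : ℝ → ℝ → ℝ → ℝ → ℝ) {x r : ℝ} (hr : r ∈ Icc (0:ℝ) T) (ω : ℝ) :
    angular T u x r ω = ∫ μ in Icc (-1:ℝ) 1, u r x μ ω := by
  rw [angular, min_eq_left hr.2, max_eq_right hr.1]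

variable (h : Slab T B K A M η u G F)
include h

theorem clamp_mem (r : ℝ) : max 0 (min r T) ∈ Icc (0:ℝ) T :=
  ⟨le_max_left _ _, max_le h.hT.le (min_le_right _ _)⟩

theorem continuous_angular {x ω : ℝ} (hx : x ∈ Icc (0:ℝ) 1) (hω : 0 < ω) :
    Continuous fun r => angular T u x r ω := by
  refine continuous_of_dominated (bound := fun _ => B)
    (fun r => (h.int_μ _ (h.clamp_mem r) x hx ω hω).aestronglyMeasurable)
    (fun r => Eventually.of_forall fun μ => h.bdd _ _ _ _) (integrable_const _) ?_
  refine (ae_restrict_iff' measurableSet_Icc).2 (Eventually.of_forall fun μ hμ => ?_)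
  exact (h.cont x hx μ hμ ω hω).comp (by fun_prop)

theorem abs_angular_le (x r ω : ℝ) : |angular T u x r ω| ≤ 2 * B := by
  have := norm_integral_le_of_norm_le_const (μ := volume.restrict (Icc (-1:ℝ) 1))
    (f := fun μ => u (max 0 (min r T)) x μ ω) (C := B)
    (Eventually.of_forall fun μ => h.bdd _ _ _ _)
  refine this.trans (le_of_eq ?_)
  rw [measureReal_restrict_apply_univ, Real.volume_real_Icc_of_le (by norm_num)]
  ring

theorem aemeasurable_angular {x : ℝ} (hx : x ∈ Icc (0:ℝ) 1) :
    AEMeasurable (Function.uncurry fun r ω => angular T u x r ω)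
      ((volume.restrict (Ioc 0 T)).prod (volume.restrict (Ioi 0))) := by
  refine aemeasurable_uncurry_of_continuous ?_ fun r => ?_
  · exact (ae_restrict_iff' measurableSet_Ioi).2
      (Eventually.of_forall fun ω hω => h.continuous_angular hx hω)
  · have := (h.int_ω _ (h.clamp_mem r) x hx).aemeasurable
    refine (measurable_id.inv.aemeasurable.mul this).congr
      ((ae_restrict_iff' measurableSet_Ioi).2 (Eventually.of_forall fun ω hω => ?_))
    have : ω ≠ 0 := (show 0 < ω from hω).ne'
    simp only [Pi.mul_apply, angular, id, Pi.inv_apply]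
    rw [inv_mul_cancel_left₀ this]

theorem integrable_cutAngular {x : ℝ} (hx : x ∈ Icc (0:ℝ) 1) {R : ℝ}
    (hi : Integrable (fun p : ℝ × ℝ => p.1 * absDensity T u p.1 x p.2)
      ((volume.restrict (Ioi 0)).prod (volume.restrict (Ioc 0 T)))) :
    Integrable (Function.uncurry fun r ω => ω * cutAngular T u R x r ω)
      ((volume.restrict (Ioc 0 T)).prod (volume.restrict (Ioi 0))) := by
  have hS : MeasurableSet {p : ℝ × ℝ | p.2 ≤ R} := measurableSet_le measurable_snd measurable_const
  have h1 : Integrable ({p : ℝ × ℝ | p.2 ≤ R}.indicator fun p => p.2 * angular T u x p.1 p.2)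
      ((volume.restrict (Ioc 0 T)).prod (volume.restrict (Ioi 0))) := by
    have hfin : Integrable ((Iic R).indicator fun _ => R * (2 * B)) (volume.restrict (Ioi 0)) := by
      rw [integrable_indicator_iff measurableSet_Iic, IntegrableOn,
        Measure.restrict_restrict measurableSet_Iic, Iic_inter_Ioi]
      exact integrable_const _
    refine (hfin.comp_snd (volume.restrict (Ioc 0 T))).mono'
      ((measurable_snd.aemeasurable.mul (h.aemeasurable_angular hx)).indicator
        hS).aestronglyMeasurable ?_
    rw [Measure.prod_restrict]
    refine (ae_restrict_iff' (measurableSet_Ioc.prod measurableSet_Ioi)).2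
      (Eventually.of_forall fun p hp => ?_)
    have hp2 : 0 < p.2 := hp.2
    by_cases hpR : p.2 ≤ R
    · rw [indicator_of_mem (by exact hpR), indicator_of_mem (by exact hpR), norm_mul,
        Real.norm_of_nonneg hp2.le]
      exact mul_le_mul hpR (h.abs_angular_le _ _ _) (norm_nonneg _) (hp2.le.trans hpR)
    · rw [indicator_of_notMem (by exact hpR), indicator_of_notMem (by exact hpR), norm_zero]
  have h2 := hi.swap.neg.indicator hS.compl
  refine (h1.add h2).congr (Eventually.of_forall fun p => ?_)
  simp only [Pi.add_apply, Function.uncurry, cutAngular]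
  by_cases hpR : p.2 ≤ R
  · rw [indicator_of_mem (by exact hpR), indicator_of_notMem (by simpa using hpR), if_pos hpR,
      add_zero]
  · rw [indicator_of_notMem (by exact hpR), indicator_of_mem (by simpa using hpR), if_neg hpR,
      zero_add]
    simp

theorem cutAngular_le {x r ω : ℝ} (R : ℝ) (hx : x ∈ Icc (0:ℝ) 1) (hr : r ∈ Icc (0:ℝ) T)
    (hω : 0 < ω) : cutAngular T u R x r ω ≤ ∫ μ in Icc (-1:ℝ) 1, u r x μ ω := by
  rw [cutAngular]
  split_ifs
  · rw [angular_of_mem u hr]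
  · exact h.neg_absDensity_le hr hx hω

theorem integral_cutAngular_le {x : ℝ} (hx : x ∈ Icc (0:ℝ) 1) {R s t : ℝ}
    (hi : Integrable (fun p : ℝ × ℝ => p.1 * absDensity T u p.1 x p.2)
      ((volume.restrict (Ioi 0)).prod (volume.restrict (Ioc 0 T))))
    (hs : 0 ≤ s) (hst : s ≤ t) (ht : t ≤ T) :
    ∫ r in s..t, ∫ ω in Ioi (0:ℝ), ω * cutAngular T u R x r ω ≤ G t x - G s x := by
  have hint := h.integrable_cutAngular hx (R := R) hi
  refine integral_le_sub_of_ae_le (f := fun r => F r x) hst (h.hG.left x).continuousOn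
    (fun r hr => h.source r ⟨hs.trans_lt hr.1, hr.2.trans_le ht⟩ x hx) ?_ ?_
  · rw [integrableOn_Icc_iff_integrableOn_Ioc]
    exact IntegrableOn.mono_set (t := Ioc 0 T) hint.integral_prod_left (Ioc_subset_Ioc hs ht)
  · rw [Measure.restrict_congr_set Ioc_ae_eq_Icc.symm]
    have := ae_mono (Measure.restrict_mono (Ioc_subset_Ioc hs ht) le_rfl) hint.prod_right_ae
    filter_upwards [this, ae_restrict_mem measurableSet_Ioc] with r hr hr'
    have hrT : r ∈ Icc (0:ℝ) T := ⟨hs.trans hr'.1.le, hr'.2.trans ht⟩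
    rw [h.bracket_eq r hrT x hx]
    exact setIntegral_mono_on hr (h.int_ω r hrT x hx) measurableSet_Ioi fun ω hω =>
      mul_le_mul_of_nonneg_left (h.cutAngular_le R hx hrT hω) (le_of_lt hω)

end Slab

namespace Slab

variable {T B K A : ℝ} {M η : ℝ → ℝ} {u : ℝ → ℝ → ℝ → ℝ → ℝ} {G F : ℝ → ℝ → ℝ}
  (h : Slab T B K A M η u G F)
include h

theorem integrable_mul_M : IntegrableOn (fun ω => ω * M ω) (Ioi 0) := by
  have h1 : IntegrableOn (fun ω : ℝ => A * (ω ^ (2:ℝ) * Real.exp (-(1/2) * ω ^ (1:ℝ)))) (Ioi 0) :=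
    (integrableOn_rpow_mul_exp_neg_mul_rpow (s := 2) (p := 1) (b := 1/2) (by norm_num)
      one_pos (by norm_num)).const_mul A
  refine h1.mono' (measurable_id.mul h.hM).aestronglyMeasurable
    ((ae_restrict_iff' measurableSet_Ioi).2 (Eventually.of_forall fun ω hω => ?_))
  have hω : 0 < ω := hω
  rw [norm_mul, Real.norm_of_nonneg hω.le, Real.norm_of_nonneg (h.M_nonneg hω), Real.rpow_one,
    Real.rpow_two]
  calc ω * M ω ≤ ω * (ω * (A * Real.exp (-ω / 2))) :=
        mul_le_mul_of_nonneg_left (h.MA ω hω) hω.le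
    _ = _ := by rw [show -ω / 2 = -(1/2) * ω by ring]; ring

theorem integral_angular_ge {L l s t x ω : ℝ} (hl : 0 < l) (hL : 0 ≤ L)
    (hG : ∀ s t, s ≤ t → t ≤ T → ∀ z ∈ Icc (0:ℝ) 1, -(L * Real.exp (l * t)) ≤ G t z - G s z)
    (hs : 0 ≤ s) (hst : s ≤ t) (ht : t ≤ T) (hx : x ∈ Icc (0:ℝ) 1) (hω : 0 < ω) :
    -(3 * (M ω / l * (L * Real.exp (l * t)))) ≤ ∫ r in s..t, angular T u x r ω := by
  have hB : 0 ≤ 2 * B := by linarith [h.B_nonneg]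
  have hx1 : 1 - x ∈ Icc (0:ℝ) 1 := ⟨by linarith [hx.2], by linarith [hx.1]⟩
  have hE : 0 ≤ M ω / l * (L * Real.exp (l * t)) := by
    have := h.M_nonneg hω
    positivity
  have hG' : ∀ s t, s ≤ t → t ≤ T → ∀ z ∈ Icc (0:ℝ) 1,
      -(L * Real.exp (l * t)) ≤ G t (1 - z) - G s (1 - z) := fun s t hst ht z hz =>
    hG s t hst ht (1 - z) ⟨by linarith [hz.2], by linarith [hz.1]⟩
  have b1 := integral_density_ge hB h.abs_right_le h.measurable_right hω hst ht hx
    (fun μ hμ => (h.right μ hμ ω hω).sepReg_scat)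
    (fun μ hμ => (h.right μ hμ ω hω).tprim_scat_sub_ge hl hL hG hst ht hx)
  have b2 := integral_density_ge hB h.abs_left_le h.measurable_left hω hst ht hx1
    (fun μ hμ => (h.left μ hμ ω hω).sepReg_scat)
    (fun μ hμ => (h.left μ hμ ω hω).tprim_scat_sub_ge hl hL hG' hst ht hx1)
  have b3 := integral_density_ge hB h.abs_refl_le h.measurable_refl hω hst ht hx1
    (fun μ hμ => ((h.right μ hμ ω hω).wave_reflW hμ).hw)
    (fun μ hμ => (h.right μ hμ ω hω).tprim_reflW_sub_ge hl hL hG hst ht hx1)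
  have j1 : IntervalIntegrable (fun r => rightDensity T u (ω, x, r)) volume s t :=
    intervalIntegrable_density hB h.abs_right_le h.measurable_right ω x s t
  have j2 : IntervalIntegrable (fun r => leftDensity T u (ω, 1 - x, r)) volume s t :=
    intervalIntegrable_density hB h.abs_left_le h.measurable_left ω (1 - x) s t
  have j3 : IntervalIntegrable (fun r => η ω * reflDensity T u (ω, 1 - x, r)) volume s t :=
    (intervalIntegrable_density hB h.abs_refl_le h.measurable_refl ω (1 - x) s t).const_mul _
  have hmono : ∫ r in s..t, (rightDensity T u (ω, x, r) + leftDensity T u (ω, 1 - x, r) +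
      η ω * reflDensity T u (ω, 1 - x, r)) ≤ ∫ r in s..t, angular T u x r ω := by
    refine intervalIntegral.integral_mono_on hst ((j1.add j2).add j3)
      ((h.continuous_angular hx hω).intervalIntegrable _ _) fun r hr => ?_
    have hrT : r ∈ Icc (0:ℝ) T := ⟨hs.trans hr.1, hr.2.trans ht⟩
    rw [angular_of_mem u hrT]
    exact h.densities_le hrT hx hω
  have j12 : IntervalIntegrable (fun r => rightDensity T u (ω, x, r) +
    leftDensity T u (ω, 1 - x, r)) volume s t := j1.add j2
  rw [intervalIntegral.integral_add j12 j3, intervalIntegral.integral_add j1 j2,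
    intervalIntegral.integral_const_mul] at hmono
  have h5 := h.hη ω hω
  set I := ∫ r in s..t, reflDensity T u (ω, 1 - x, r) with hI
  have b3' : -(M ω / l * (L * Real.exp (l * t))) ≤ I := b3
  have h6 : -(M ω / l * (L * Real.exp (l * t))) ≤ η ω * I := by nlinarith [h5.1, h5.2]
  have b1' : -(M ω / l * (L * Real.exp (l * t))) ≤ ∫ r in s..t, rightDensity T u (ω, x, r) := b1
  have b2' : -(M ω / l * (L * Real.exp (l * t))) ≤ ∫ r in s..t, leftDensity T u (ω, 1 - x, r) := b2
  linarith

theorem intervalIntegrable_absDensity (x ω s t : ℝ) :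
    IntervalIntegrable (fun r => absDensity T u ω x r) volume s t := by
  have hB : 0 ≤ 2 * B := by linarith [h.B_nonneg]
  exact ((intervalIntegrable_density hB h.abs_right_le h.measurable_right ω x s t).abs.add
    (intervalIntegrable_density hB h.abs_left_le h.measurable_left ω (1 - x) s t).abs).add
    (intervalIntegrable_density hB h.abs_refl_le h.measurable_refl ω (1 - x) s t).abs

theorem integral_cutAngular_ge {L l s t x ω : ℝ} (hl : 0 < l) (hL : 0 ≤ L)
    (hG : ∀ s t, s ≤ t → t ≤ T → ∀ z ∈ Icc (0:ℝ) 1, -(L * Real.exp (l * t)) ≤ G t z - G s z)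
    (hs : 0 ≤ s) (hst : s ≤ t) (ht : t ≤ T) (hx : x ∈ Icc (0:ℝ) 1) (R : ℝ) (hω : 0 < ω) :
    -(3 / l * (L * Real.exp (l * t)) * (ω * M ω)) -
      (Ioi R).indicator (fun ω => ∫ r in Ioc 0 T, ω * absDensity T u ω x r) ω ≤
      ∫ r in Ioc s t, ω * cutAngular T u R x r ω := by
  have hM := h.M_nonneg hω
  have hE : 0 ≤ 3 / l * (L * Real.exp (l * t)) * (ω * M ω) := by positivity
  by_cases hR : ω ≤ R
  · rw [indicator_of_notMem (by simpa using hR), sub_zero]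
    simp only [cutAngular, if_pos hR]
    rw [integral_const_mul, ← intervalIntegral.integral_of_le hst]
    have := mul_le_mul_of_nonneg_left (h.integral_angular_ge hl hL hG hs hst ht hx hω) hω.le
    refine le_trans (le_of_eq ?_) this
    field_simp
  · rw [indicator_of_mem (by simpa using hR)]
    simp only [cutAngular, if_neg hR]
    rw [integral_const_mul, integral_const_mul, integral_neg]
    have h1 : ∫ r in Ioc s t, absDensity T u ω x r ≤ ∫ r in Ioc 0 T, absDensity T u ω x r :=
      setIntegral_mono_set ((intervalIntegrable_iff_integrableOn_Ioc_of_le h.hT.le).1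
        (h.intervalIntegrable_absDensity x ω 0 T))
        (Eventually.of_forall fun r => absDensity_nonneg _ _ _ _ _)
        (Eventually.of_forall (Ioc_subset_Ioc hs ht))
    have := mul_le_mul_of_nonneg_left h1 hω.le
    linarith

theorem source_sub_ge {L l s t x : ℝ} (hl : 0 < l) (hL : 0 ≤ L)
    (hG : ∀ s t, s ≤ t → t ≤ T → ∀ z ∈ Icc (0:ℝ) 1, -(L * Real.exp (l * t)) ≤ G t z - G s z)
    (hs : 0 ≤ s) (hst : s ≤ t) (ht : t ≤ T) (hx : x ∈ Icc (0:ℝ) 1)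
    (hi : Integrable (fun p : ℝ × ℝ => p.1 * absDensity T u p.1 x p.2)
      ((volume.restrict (Ioi 0)).prod (volume.restrict (Ioc 0 T)))) :
    -(3 / l * (L * Real.exp (l * t)) * ∫ ω in Ioi (0:ℝ), ω * M ω) ≤ G t x - G s x := by
  set e : ℝ → ℝ := fun ω => ∫ r in Ioc 0 T, ω * absDensity T u ω x r with he
  have hei : IntegrableOn e (Ioi 0) := hi.integral_prod_left
  have hR : ∀ R : ℝ, -(3 / l * (L * Real.exp (l * t)) * ∫ ω in Ioi (0:ℝ), ω * M ω) -
      ∫ ω in Ioi (0:ℝ), (Ioi R).indicator e ω ≤ G t x - G s x := fun R => by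
    refine le_trans ?_ (h.integral_cutAngular_le hx (R := R) hi hs hst ht)
    have hint : Integrable (Function.uncurry fun r ω => ω * cutAngular T u R x r ω)
        ((volume.restrict (Ioc s t)).prod (volume.restrict (Ioi 0))) := by
      have := h.integrable_cutAngular hx (R := R) hi
      rw [Measure.prod_restrict] at this ⊢
      exact IntegrableOn.mono_set this (Set.prod_mono (Ioc_subset_Ioc hs ht) Subset.rfl)
    have i1 : IntegrableOn (fun ω => -(3 / l * (L * Real.exp (l * t)) * (ω * M ω))) (Ioi 0) :=
      (h.integrable_mul_M.const_mul _).neg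
    have i2 : IntegrableOn ((Ioi R).indicator e) (Ioi 0) := hei.indicator measurableSet_Ioi
    rw [intervalIntegral.integral_of_le hst, integral_integral_swap hint, ← integral_const_mul,
      ← integral_neg, ← integral_sub i1 i2]
    exact setIntegral_mono_on (i1.sub i2) hint.integral_prod_right measurableSet_Ioi
      fun ω hω => h.integral_cutAngular_ge hl hL hG hs hst ht hx R hω
  have hlim : Tendsto (fun n : ℕ => ∫ ω in Ioi (0:ℝ), (Ioi (n:ℝ)).indicator e ω) atTop (𝓝 0) := by
    have := tendsto_setIntegral_of_antitone (μ := volume.restrict (Ioi 0)) (f := e)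
      (s := fun n : ℕ => Ioi (n:ℝ)) (fun n => measurableSet_Ioi)
      (fun m n hmn => Ioi_subset_Ioi (by exact_mod_cast hmn)) ⟨0, hei.integrableOn⟩
    have hempty : ⋂ n : ℕ, Ioi (n:ℝ) = ∅ := by
      ext z
      obtain ⟨n, hn⟩ := exists_nat_ge z
      simp only [mem_iInter, mem_Ioi, mem_empty_iff_false, iff_false, not_forall, not_lt]
      exact ⟨n, hn⟩
    rw [hempty, setIntegral_empty] at this
    refine this.congr fun n => ?_
    rw [integral_indicator measurableSet_Ioi]
  have := le_of_tendsto (b := G t x - G s x) (tendsto_const_nhds.sub hlim)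
    (Eventually.of_forall fun n : ℕ => hR n)
  simpa using this

theorem monotone_step {L l : ℝ} (hl : 0 < l) (hL : 0 ≤ L)
    (hlM : 6 * ∫ ω in Ioi (0:ℝ), ω * M ω ≤ l)
    (hG : ∀ s t, s ≤ t → t ≤ T → ∀ z ∈ Icc (0:ℝ) 1, -(L * Real.exp (l * t)) ≤ G t z - G s z)
    {s t x : ℝ} (hs : 0 ≤ s) (hst : s ≤ t) (ht : t ≤ T) (hx : x ∈ Icc (0:ℝ) 1) :
    -(L / 2 * Real.exp (l * t)) ≤ G t x - G s x := by
  have hb : 3 / l * (L * Real.exp (l * t)) * ∫ ω in Ioi (0:ℝ), ω * M ω ≤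
      L / 2 * Real.exp (l * t) := by
    have : 0 ≤ L * Real.exp (l * t) := by positivity
    rw [div_mul_eq_mul_div, div_mul_eq_mul_div, div_le_iff₀ hl]
    nlinarith
  have hcont : Continuous fun x => min (G t x - G s x + L / 2 * Real.exp (l * t)) 0 :=
    (((h.hG.right t).sub (h.hG.right s)).add continuous_const).min continuous_const
  have hae : (fun x => min (G t x - G s x + L / 2 * Real.exp (l * t)) 0)
      =ᵐ[volume.restrict (Icc (0:ℝ) 1)] fun _ => 0 := by
    rw [Measure.restrict_congr_set Ioo_ae_eq_Icc.symm]
    refine (ae_restrict_iff' measurableSet_Ioo).2 ?_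
    filter_upwards [h.ae_integrable_absDensity] with x hix hx
    have := h.source_sub_ge hl hL hG hs hst ht (Ioo_subset_Icc_self hx) (hix hx)
    exact min_eq_right (by linarith)
  have := Measure.eqOn_Icc_of_ae_eq (μ := volume) zero_ne_one hae hcont.continuousOn
    continuousOn_const hx
  have := min_eq_right_iff.1 this
  linarith

theorem source_monotone {s t x : ℝ} (hst : s ≤ t) (ht : t ≤ T) (hx : x ∈ Icc (0:ℝ) 1) :
    G s x ≤ G t x := by
  have hK := h.K_nonneg
  set I := ∫ ω in Ioi (0:ℝ), ω * M ω
  set l := max (6 * I) 1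
  have hl : 0 < l := lt_max_of_lt_right one_pos
  have hzero : ∀ t ≤ 0, ∀ x, G t x = 0 := (h.right 1 (by simp) 1 one_pos).G0
  have hGB : ∀ t x, |G t x| ≤ K := (h.right 1 (by simp) 1 one_pos).GB
  have key : ∀ n : ℕ, ∀ s t, s ≤ t → t ≤ T → ∀ z ∈ Icc (0:ℝ) 1,
      -(2 * K / 2 ^ n * Real.exp (l * t)) ≤ G t z - G s z := by
    intro n
    induction n with
    | zero =>
      intro s t hst _ z _
      have h1 := abs_le.1 (hGB t z)
      have h2 := abs_le.1 (hGB s z)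
      rcases le_total t 0 with ht | ht
      · rw [hzero t ht, hzero s (hst.trans ht), sub_zero, Left.neg_nonpos_iff]
        positivity
      · have : 1 ≤ Real.exp (l * t) := Real.one_le_exp (by positivity)
        rw [pow_zero, div_one]
        nlinarith
    | succ n ih =>
      intro s t hst ht z hz
      have hL : (0:ℝ) ≤ 2 * K / 2 ^ n := by positivity
      rw [pow_succ, ← div_div]
      rcases le_total 0 s with hs | hs
      · exact h.monotone_step hl hL (le_max_left _ _) ih hs hst ht hz
      · rcases le_total 0 t with h0 | h0
        · have := h.monotone_step hl hL (le_max_left _ _) ih le_rfl h0 ht hz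
          rwa [hzero 0 le_rfl, ← hzero s hs z] at this
        · rw [hzero t h0, hzero s hs, sub_zero, Left.neg_nonpos_iff]
          positivity
  have hlim : Tendsto (fun n : ℕ => -(2 * K / 2 ^ n * Real.exp (l * t))) atTop (𝓝 0) := by
    have h1 : Tendsto (fun n : ℕ => 2 * K / (2:ℝ) ^ n) atTop (𝓝 0) :=
      tendsto_const_nhds.div_atTop (tendsto_pow_atTop_atTop_of_one_lt one_lt_two)
    simpa using (h1.mul_const (Real.exp (l * t))).neg
  have := le_of_tendsto hlim (Eventually.of_forall fun n : ℕ => key n s t hst ht x hx)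
  linarith

end Slab

theorem nonneg_of_hasDerivAt_of_monotoneOn_Iic {f : ℝ → ℝ} {f' t : ℝ}
    (hf : HasDerivAt f f' t) (hm : MonotoneOn f (Iic t)) : 0 ≤ f' :=
  hf.hasDerivWithinAt.nonneg_of_monotoneOn (accPt_iff_nhds.2 fun U hU => by
    obtain ⟨e, he, hU⟩ := Metric.mem_nhds_iff.1 hU
    refine ⟨t - e / 2, ⟨hU ?_, ?_⟩, by linarith⟩
    · rw [Metric.mem_ball, Real.dist_eq, show t - e / 2 - t = -(e / 2) by ring, abs_neg,
        abs_of_pos (by linarith)]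
      linarith
    · rw [mem_Iic]; linarith) hm

theorem Transp.nonneg {T c ω M B K : ℝ} {y G : ℝ → ℝ → ℝ} (h : Transp T c ω M B K y G)
    (hG : ∀ s t, s ≤ t → t ≤ T → ∀ z ∈ Icc (0:ℝ) 1, G s z ≤ G t z)
    (hb : ∀ t ≤ T, 0 ≤ y t 0) {t x : ℝ} (ht : t ≤ T) (hx : x ∈ Icc (0:ℝ) 1) : 0 ≤ y t x := by
  refine nonneg_of_hasDerivAt_of_monotoneOn_Iic (h.hy.hasDerivAt_tprim t x)
    fun s hs r hr hsr => ?_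
  have hr : r ≤ T := le_trans hr ht
  have hxc : 0 ≤ x / c := div_nonneg hx.1 h.hc.le
  have h1 : 0 ≤ lineInt c ω G r x - lineInt c ω G s x := by
    simpa using lineInt_sub_ge h.hG h.hc h.hω one_pos le_rfl
      (fun s t hst ht z hz => by simpa using hG s t hst ht z hz) hsr hr hx
  have h2 : tprim y (s - x / c) 0 ≤ tprim y (r - x / c) 0 := by
    have : tprim y (r - x / c) 0 - tprim y (s - x / c) 0 = ∫ q in (s - x / c)..(r - x / c), y q 0 :=
      intervalIntegral.integral_interval_sub_left (h.hy.intLeft 0 _ _) (h.hy.intLeft 0 _ _)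
    have := intervalIntegral.integral_nonneg (μ := volume) (f := fun q => y q 0) (by linarith :
      s - x / c ≤ r - x / c) fun q hq => hb q (by linarith [hq.2])
    linarith
  have hM := h.hM
  have hc := h.hc
  have h3 : 0 ≤ M / c * (lineInt c ω G r x - lineInt c ω G s x) := by positivity
  have h4 := mul_le_mul_of_nonneg_left h2 (Real.exp_pos (-(ω / c) * x)).le
  rw [h.tprim_eq (hsr.trans hr) hx, h.tprim_eq hr hx]
  linarith

namespace Slab

variable {T B K A : ℝ} {M η : ℝ → ℝ} {u : ℝ → ℝ → ℝ → ℝ → ℝ} {G F : ℝ → ℝ → ℝ}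
  (h : Slab T B K A M η u G F)
include h

theorem nonneg_right {t x μ ω : ℝ} (ht : t ≤ T) (hx : x ∈ Icc (0:ℝ) 1) (hμ : μ ∈ Ioc (0:ℝ) 1)
    (hω : 0 < ω) : 0 ≤ u t x μ ω :=
  (h.right μ hμ ω hω).nonneg (fun _ _ hst ht _ hz => h.source_monotone hst ht hz)
    (fun t ht => h.entering t ht μ hμ ω hω) ht hx

theorem nonneg_left {t x μ ω : ℝ} (ht : t ≤ T) (hx : x ∈ Icc (0:ℝ) 1) (hμ : μ ∈ Ioc (0:ℝ) 1)
    (hω : 0 < ω) : 0 ≤ u t x (-μ) ω := by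
  have := (h.left μ hμ ω hω).nonneg
    (fun _ _ hst ht z hz => h.source_monotone hst ht ⟨by linarith [hz.2], by linarith [hz.1]⟩)
    (fun t ht => by
      rw [sub_zero]
      exact (mul_nonneg (h.hη ω hω).1 (h.nonneg_right ht ⟨zero_le_one, le_rfl⟩ hμ hω)).trans
        (h.reflected t ht μ hμ ω hω)) ht (x := 1 - x) ⟨by linarith [hx.2], by linarith [hx.1]⟩
  simpa using this

theorem source_deriv_nonneg {t x : ℝ} (ht : t ∈ Ioo (0:ℝ) T) (hx : x ∈ Icc (0:ℝ) 1) :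
    0 ≤ F t x :=
  nonneg_of_hasDerivAt_of_monotoneOn_Iic (h.source t ht x hx)
    fun _ _ _ hr hsr => h.source_monotone hsr (le_trans hr ht.2.le) hx

end Slab

/-- Nonnegativity for `y' + a y ≥ 0` with zero initial value. -/
theorem nonneg_of_hasDerivAt_add_nonneg {y y' : ℝ → ℝ} {a T : ℝ} (h0 : 0 ≤ y 0)
    (hc : ContinuousOn y (Icc 0 T)) (hd : ∀ t ∈ Ioo 0 T, HasDerivAt y (y' t) t)
    (hn : ∀ t ∈ Ioo 0 T, 0 ≤ y' t + a * y t) {t : ℝ} (ht : t ∈ Icc 0 T) : 0 ≤ y t := by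
  have hd' : ∀ t ∈ Ioo 0 T, HasDerivAt (fun t => Real.exp (a * t) * y t)
      (Real.exp (a * t) * (y' t + a * y t)) t := fun t ht => by
    have h1 : HasDerivAt (fun t => Real.exp (a * t)) (Real.exp (a * t) * a) t := by
      simpa using ((hasDerivAt_id t).const_mul a).exp
    exact (h1.mul (hd t ht)).congr_deriv (by ring)
  have hm : MonotoneOn (fun t => Real.exp (a * t) * y t) (Icc 0 T) := by
    refine monotoneOn_of_deriv_nonneg (convex_Icc 0 T) (by fun_prop) ?_ ?_
    · rw [interior_Icc]
      exact fun t ht => (hd' t ht).differentiableAt.differentiableWithinAt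
    · rw [interior_Icc]
      intro t ht
      rw [(hd' t ht).deriv]
      exact mul_nonneg (Real.exp_pos _).le (hn t ht)
  have := hm ⟨le_rfl, ht.1.trans ht.2⟩ ht ht.1
  simp only [mul_zero, Real.exp_zero, one_mul] at this
  exact nonneg_of_mul_nonneg_right (h0.trans this) (Real.exp_pos _)

theorem gstar_pos {ω : ℝ} (hω : 0 < ω) : 0 < gstar ω := by
  have : 0 < Real.exp ω - 1 := by linarith [Real.add_one_lt_exp hω.ne']
  rw [gstar]
  positivity

theorem gstar_le {ω : ℝ} (hω : 0 < ω) : gstar ω ≤ 4 * Real.exp (-ω / 2) := by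
  have h1 : ω + 1 ≤ Real.exp ω := Real.add_one_le_exp ω
  have h2 : 1 + ω ≤ 2 * Real.exp (ω / 4) := by
    have := Real.quadratic_le_exp_of_nonneg (x := ω / 4) (by positivity)
    nlinarith [sq_nonneg (ω / 4 - 1)]
  have h3 : ω / 2 * Real.exp (3 * ω / 4) ≤ Real.exp ω - 1 := by
    have e1 : Real.exp ω = Real.exp (3 * ω / 4) * Real.exp (ω / 4) := by
      rw [← Real.exp_add]; ring_nf
    have h4 : ω * Real.exp ω ≤ (1 + ω) * (Real.exp ω - 1) := by linarith
    have h5 : (1 + ω) * (Real.exp ω - 1) ≤ 2 * Real.exp (ω / 4) * (Real.exp ω - 1) :=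
      mul_le_mul_of_nonneg_right h2 (by linarith)
    refine le_of_mul_le_mul_left ?_ (by positivity : 0 < 2 * Real.exp (ω / 4))
    refine le_trans (le_of_eq ?_) (h4.trans h5)
    rw [e1]; ring
  have hp : 0 < ω / 2 * Real.exp (3 * ω / 4) := by positivity
  have h6 := pow_le_pow_left₀ hp.le h3 2
  rw [gstar, div_le_iff₀ (pow_pos (hp.trans_le h3) 2)]
  refine le_trans (le_of_eq ?_) (mul_le_mul_of_nonneg_left h6 (by positivity))
  have e2 : Real.exp ω = Real.exp (-ω / 2) * Real.exp (3 * ω / 4) ^ 2 := by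
    rw [← Real.exp_nat_mul, ← Real.exp_add]
    congr 1
    push_cast
    ring
  rw [e2]; ring

theorem measurable_gstar : Measurable gstar := by
  unfold gstar
  fun_prop

theorem integrable_mul_gstar : IntegrableOn (fun ω => ω * gstar ω) (Ioi 0) := by
  refine ((integrableOn_mul_exp_neg (b := 1/2) (by norm_num)).const_mul 4).mono'
    (measurable_id.mul measurable_gstar).aestronglyMeasurable
    ((ae_restrict_iff' measurableSet_Ioi).2 (Eventually.of_forall fun ω hω => ?_))
  have hω : 0 < ω := hω
  rw [Real.norm_of_nonneg (mul_nonneg hω.le (gstar_pos hω).le)]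
  refine (mul_le_mul_of_nonneg_left (gstar_le hω) hω.le).trans (le_of_eq ?_)
  rw [show -ω / 2 = -(1/2) * ω by ring]; ring

theorem wgstar_pos : 0 < wgstar := by
  refine mul_pos two_pos ?_
  rw [setIntegral_pos_iff_support_of_nonneg_ae]
  · refine lt_of_lt_of_le (?_ : 0 < volume (Ioi (0:ℝ))) (measure_mono fun ω hω =>
      ⟨(mul_pos hω (gstar_pos hω)).ne', hω⟩)
    simp
  · exact (ae_restrict_iff' measurableSet_Ioi).2 (Eventually.of_forall fun ω hω =>
      (mul_pos hω (gstar_pos hω)).le)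
  · exact integrable_mul_gstar

theorem Mw_pos {ω : ℝ} (hω : 0 < ω) : 0 < Mw ω :=
  div_pos (mul_pos hω (gstar_pos hω)) wgstar_pos

theorem measurable_Mw : Measurable Mw :=
  (measurable_id.mul measurable_gstar).div_const _

theorem Mw_le {ω : ℝ} (hω : 0 < ω) : Mw ω ≤ ω * (4 / wgstar * Real.exp (-ω / 2)) := by
  rw [Mw, div_le_iff₀ wgstar_pos]
  refine (mul_le_mul_of_nonneg_left (gstar_le hω) hω.le).trans (le_of_eq ?_)
  field_simp [ne_of_gt wgstar_pos]

/-- The nearest point of `[0, T]`. -/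
noncomputable def clamp (T t : ℝ) : ℝ := max 0 (min T t)

theorem clamp_mem {T : ℝ} (hT : 0 ≤ T) (t : ℝ) : clamp T t ∈ Icc 0 T :=
  ⟨le_max_left _ _, max_le hT (min_le_left _ _)⟩

theorem clamp_of_mem {T t : ℝ} (ht : t ∈ Icc 0 T) : clamp T t = t := by
  rw [clamp, min_eq_right ht.2, max_eq_right ht.1]

theorem clamp_of_nonpos {T t : ℝ} (ht : t ≤ 0) : clamp T t = 0 :=
  max_eq_left ((min_le_right _ _).trans ht)

theorem continuous_clamp (T : ℝ) : Continuous (clamp T) :=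
  continuous_const.max (continuous_const.min continuous_id)

theorem abs_clamp_sub_le (T s t : ℝ) : |clamp T s - clamp T t| ≤ |s - t| := by
  refine (abs_max_sub_max_le_max _ _ _ _).trans ?_
  rw [sub_self, abs_zero, max_eq_right (abs_nonneg _)]
  refine (abs_min_sub_min_le_max _ _ _ _).trans ?_
  rw [sub_self, abs_zero, max_eq_right (abs_nonneg _)]

theorem exists_abs_sub_le_of_differentiableAt {f : ℝ → ℝ} {B t : ℝ} (hB : ∀ s, |f s| ≤ B)
    (hd : DifferentiableAt ℝ f t) : ∃ N, 0 ≤ N ∧ ∀ s, |f s - f t| ≤ N * |s - t| := by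
  obtain ⟨C, hC, h⟩ := hd.isBigO_sub.exists_pos
  obtain ⟨d, hd, h⟩ := Metric.eventually_nhds_iff.1 h.bound
  have hB0 : 0 ≤ B := (abs_nonneg _).trans (hB 0)
  refine ⟨C + 2 * B / d, by positivity, fun s => ?_⟩
  rw [add_mul]
  rcases lt_or_ge (dist s t) d with hs | hs
  · exact (h hs).trans (le_add_of_nonneg_right (by positivity))
  · rw [Real.dist_eq] at hs
    have h1 : |f s - f t| ≤ 2 * B := (abs_sub _ _).trans (by linarith [hB s, hB t])
    have h2 : 2 * B ≤ 2 * B / d * |s - t| := by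
      rw [div_mul_eq_mul_div, le_div_iff₀ hd]
      gcongr
    have h3 : 0 ≤ C * |s - t| := by positivity
    linarith

section clamped

variable {T B : ℝ} {w : ℝ → ℝ → ℝ} (hT : 0 ≤ T) (hB : ∀ t x, |w t x| ≤ B)
  (ht : ∀ t ∈ Icc 0 T, ∀ x ∈ Icc (0:ℝ) 1, DifferentiableAt ℝ (fun s => w s x) t)
  (hx : ∀ t ∈ Icc 0 T, ∀ x ∈ Icc (0:ℝ) 1, DifferentiableAt ℝ (fun y => w t y) x)
include hT hB ht hx

theorem sepReg_clamp : SepReg fun t x => w (clamp T t) (clamp 1 x) := by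
  have h1 := fun x => clamp_mem zero_le_one x
  have h2 := fun t => clamp_mem hT t
  refine SepReg.of_bounded (fun x => ?_) (fun t => ?_) B fun t x => hB _ _
  · exact ContinuousOn.comp_continuous (s := Icc 0 T) (g := fun s => w s (clamp 1 x))
      (fun t h => (ht t h _ (h1 x)).continuousAt.continuousWithinAt) (continuous_clamp T) h2
  · exact ContinuousOn.comp_continuous (s := Icc (0:ℝ) 1) (g := w (clamp T t))
      (fun x h => (hx _ (h2 t) x h).continuousAt.continuousWithinAt) (continuous_clamp 1) h1

theorem anchored_clamp (p : ℝ × ℝ) :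
    ∃ N, Anchored (fun t x => w (clamp T t) (clamp 1 x)) N p := by
  have h1 := clamp_mem zero_le_one p.2
  have h2 := clamp_mem hT p.1
  obtain ⟨N, hN, h3⟩ := exists_abs_sub_le_of_differentiableAt (fun s => hB s _) (ht _ h2 _ h1)
  obtain ⟨N', hN', h4⟩ := exists_abs_sub_le_of_differentiableAt (fun y => hB _ y) (hx _ h2 _ h1)
  refine ⟨max N N', fun s => ?_, fun y => ?_⟩
  · exact (h3 _).trans (mul_le_mul (le_max_left _ _) (abs_clamp_sub_le _ _ _) (abs_nonneg _)
      (hN.trans (le_max_left _ _)))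
  · exact (h4 _).trans (mul_le_mul (le_max_right _ _) (abs_clamp_sub_le _ _ _) (abs_nonneg _)
      (hN.trans (le_max_left _ _)))

end clamped

theorem clamp_eventuallyEq {T t : ℝ} (ht : t ∈ Ioo 0 T) : clamp T =ᶠ[𝓝 t] id := by
  filter_upwards [isOpen_Ioo.mem_nhds ht] with s hs
  exact clamp_of_mem (Ioo_subset_Icc_self hs)

theorem Anchored.sub {a b : ℝ → ℝ → ℝ} {N N' : ℝ} {p : ℝ × ℝ} (ha : Anchored a N p)
    (hb : Anchored b N' p) : Anchored (fun t x => a t x - b t x) (N + N') p := by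
  have key : ∀ {y₁ y₂ z₁ z₂ d : ℝ}, |y₁ - y₂| ≤ N * d → |z₁ - z₂| ≤ N' * d →
      |y₁ - z₁ - (y₂ - z₂)| ≤ (N + N') * d := fun {y₁ y₂ z₁ z₂ d} h1 h2 => by
    rw [show y₁ - z₁ - (y₂ - z₂) = (y₁ - y₂) - (z₁ - z₂) by ring]
    exact (abs_sub _ _).trans (by linarith)
  exact ⟨fun s => key (ha.1 s) (hb.1 s), fun y => key (ha.2 y) (hb.2 y)⟩

theorem Anchored.const_mul {a : ℝ → ℝ → ℝ} {N : ℝ} {p : ℝ × ℝ} (ha : Anchored a N p) (c : ℝ) :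
    Anchored (fun t x => c * a t x) (|c| * N) p := by
  have key : ∀ {y₁ y₂ d : ℝ}, |y₁ - y₂| ≤ N * d → |c * y₁ - c * y₂| ≤ |c| * N * d :=
    fun {y₁ y₂ d} h1 => by
      rw [← mul_sub, abs_mul, mul_assoc]
      exact mul_le_mul_of_nonneg_left h1 (abs_nonneg c)
  exact ⟨fun s => key (ha.1 s), fun y => key (ha.2 y)⟩

/-- A bounded solution of the transport equation with zero initial data, nonnegative incoming data,
and outgoing data at `x = 1` dominated by the reflected wave. -/
structure SuperSolution (T B : ℝ) (η : ℝ → ℝ) (u : ℝ → ℝ → ℝ → ℝ → ℝ) : Prop where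
  hT : 0 < T
  bdd : ∀ t x μ ω, |u t x μ ω| ≤ B
  integrable : BracketIntegrableSol T u
  pte : SatisfiesPTE T u
  initial : ∀ x ∈ Icc (0:ℝ) 1, ∀ μ ∈ Icc (-1:ℝ) 1, ∀ ω ∈ Ioi (0:ℝ), u 0 x μ ω = 0
  entering : ∀ t ∈ Icc (0:ℝ) T, ∀ μ ∈ Ioc (0:ℝ) 1, ∀ ω ∈ Ioi (0:ℝ), 0 ≤ u t 0 μ ω
  reflected : ∀ t ∈ Icc (0:ℝ) T, ∀ μ ∈ Ioc (0:ℝ) 1, ∀ ω ∈ Ioi (0:ℝ),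
    η ω * u t 1 μ ω ≤ u t 1 (-μ) ω
  hη : ∀ ω ∈ Ioi (0:ℝ), η ω ∈ Icc (0:ℝ) 1

/-- Extension of `u` by its values at the nearest point of `[0, T] × [0, 1]`. -/
noncomputable def clampExt (T : ℝ) (u : ℝ → ℝ → ℝ → ℝ → ℝ) (t x μ ω : ℝ) : ℝ :=
  u (clamp T t) (clamp 1 x) μ ω

/-- The bracket of `ω u`. -/
noncomputable def emission (u : ℝ → ℝ → ℝ → ℝ → ℝ) (t x : ℝ) : ℝ :=
  bracket fun μ ω => ω * u t x μ ω

/-- The wave travelling along the wall, normalised by the Maxwellian. -/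
noncomputable def grazing (T : ℝ) (u : ℝ → ℝ → ℝ → ℝ → ℝ) (t x : ℝ) : ℝ :=
  clampExt T u t x 0 1 / Mw 1

/-- The time primitive of the emission, recovered from the grazing wave. -/
noncomputable def emissionPrim (T : ℝ) (u : ℝ → ℝ → ℝ → ℝ → ℝ) (t x : ℝ) : ℝ :=
  grazing T u t x + tprim (grazing T u) (min t T) x

namespace SuperSolution

variable {T B : ℝ} {η : ℝ → ℝ} {u : ℝ → ℝ → ℝ → ℝ → ℝ} (h : SuperSolution T B η u)
include h

theorem B_nonneg : 0 ≤ B := (abs_nonneg _).trans (h.bdd 0 0 0 0)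

theorem sepReg_clampExt {μ ω : ℝ} (hμ : μ ∈ Icc (-1:ℝ) 1) (hω : 0 < ω) :
    SepReg fun t x => clampExt T u t x μ ω :=
  sepReg_clamp (w := fun t x => u t x μ ω) h.hT.le (fun t x => h.bdd t x μ ω)
    (fun t ht x hx => (h.pte t ht x hx μ hμ ω hω).1)
    (fun t ht x hx => (h.pte t ht x hx μ hμ ω hω).2.1)

theorem anchored_clampExt {μ ω : ℝ} (hμ : μ ∈ Icc (-1:ℝ) 1) (hω : 0 < ω) (p : ℝ × ℝ) :
    ∃ N, Anchored (fun t x => clampExt T u t x μ ω) N p :=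
  anchored_clamp (w := fun t x => u t x μ ω) h.hT.le (fun t x => h.bdd t x μ ω)
    (fun t ht x hx => (h.pte t ht x hx μ hμ ω hω).1)
    (fun t ht x hx => (h.pte t ht x hx μ hμ ω hω).2.1) p

omit h in
theorem clampExt_of_mem {t x : ℝ} (ht : t ∈ Icc 0 T) (hx : x ∈ Icc (0:ℝ) 1) (μ ω : ℝ) :
    clampExt T u t x μ ω = u t x μ ω := by
  rw [clampExt, clamp_of_mem ht, clamp_of_mem hx]

theorem clampExt_of_nonpos {t x μ ω : ℝ} (ht : t ≤ 0) (hμ : μ ∈ Icc (-1:ℝ) 1) (hω : 0 < ω) :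
    clampExt T u t x μ ω = 0 := by
  rw [clampExt, clamp_of_nonpos ht]
  exact h.initial _ (clamp_mem zero_le_one x) _ hμ _ hω

theorem hasDerivAt_time {t x μ ω : ℝ} (ht : t ∈ Ioo 0 T) (hx : x ∈ Icc (0:ℝ) 1)
    (hμ : μ ∈ Icc (-1:ℝ) 1) (hω : 0 < ω) :
    HasDerivAt (fun s => clampExt T u s x μ ω) (deriv (fun s => u s x μ ω) t) t := by
  refine (h.pte t (Ioo_subset_Icc_self ht) x hx μ hμ ω hω).1.hasDerivAt.congr_of_eventuallyEq ?_
  filter_upwards [clamp_eventuallyEq ht] with s hs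
  rw [clampExt, hs, clamp_of_mem hx, id]

theorem hasDerivAt_space {t x μ ω : ℝ} (ht : t ∈ Icc 0 T) (hx : x ∈ Ioo (0:ℝ) 1)
    (hμ : μ ∈ Icc (-1:ℝ) 1) (hω : 0 < ω) :
    HasDerivAt (fun y => clampExt T u t y μ ω) (deriv (fun y => u t y μ ω) x) x := by
  refine (h.pte t ht x (Ioo_subset_Icc_self hx) μ hμ ω hω).2.1.hasDerivAt.congr_of_eventuallyEq ?_
  filter_upwards [clamp_eventuallyEq hx] with s hs
  rw [clampExt, hs, clamp_of_mem ht, id]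

theorem deriv_time {t x μ ω : ℝ} (ht : t ∈ Icc 0 T) (hx : x ∈ Icc (0:ℝ) 1)
    (hμ : μ ∈ Icc (-1:ℝ) 1) (hω : 0 < ω) :
    deriv (fun s => u s x μ ω) t =
      -(μ * ω * deriv (fun y => u t y μ ω) x) - ω * u t x μ ω + Mw ω * emission u t x := by
  have := (h.pte t ht x hx μ hμ ω hω).2.2
  rw [coll] at this
  rw [emission]
  linarith

theorem hasDerivAt_grazing {t x : ℝ} (ht : t ∈ Ioo 0 T) (hx : x ∈ Icc (0:ℝ) 1) :
    HasDerivAt (fun s => grazing T u s x) (emission u t x - grazing T u t x) t := by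
  have hM := (Mw_pos one_pos).ne'
  refine ((h.hasDerivAt_time ht hx (μ := 0) (by simp) one_pos).div_const (Mw 1)).congr_deriv ?_
  have ht := Ioo_subset_Icc_self ht
  rw [h.deriv_time ht hx (by simp) one_pos, grazing, clampExt_of_mem ht hx]
  field_simp
  ring

theorem sepReg_grazing : SepReg (grazing T u) := by
  have := (h.sepReg_clampExt (μ := 0) (by simp) one_pos).const_mul (Mw 1)⁻¹
  convert this using 3
  rw [grazing, div_eq_inv_mul]

theorem anchored_grazing (p : ℝ × ℝ) : ∃ N, Anchored (grazing T u) N p := by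
  obtain ⟨N, hN⟩ := h.anchored_clampExt (μ := 0) (by simp) one_pos p
  refine ⟨|(Mw 1)⁻¹| * N, ?_⟩
  convert hN.const_mul (Mw 1)⁻¹ using 3
  rw [grazing, div_eq_inv_mul]

theorem abs_grazing_le (t x : ℝ) : |grazing T u t x| ≤ B / Mw 1 := by
  rw [grazing, abs_div, abs_of_pos (Mw_pos one_pos)]
  exact div_le_div_of_nonneg_right (h.bdd _ _ _ _) (Mw_pos one_pos).le

theorem grazing_of_nonpos {t : ℝ} (ht : t ≤ 0) (x : ℝ) : grazing T u t x = 0 := by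
  rw [grazing, h.clampExt_of_nonpos ht (by simp) one_pos, zero_div]

theorem sepReg_emissionPrim : SepReg (emissionPrim T u) :=
  h.sepReg_grazing.add (h.sepReg_grazing.sepReg_tprim.comp (u := fun t => min t T) (v := id)
    (by fun_prop) continuous_id)

theorem emissionPrim_of_nonpos {t : ℝ} (ht : t ≤ 0) (x : ℝ) : emissionPrim T u t x = 0 := by
  rw [emissionPrim, h.grazing_of_nonpos ht,
    tprim_eq_zero (fun t ht x => h.grazing_of_nonpos ht x) ((min_le_left _ _).trans ht), add_zero]

theorem abs_emissionPrim_le (t x : ℝ) : |emissionPrim T u t x| ≤ B / Mw 1 * (1 + T) := by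
  have hQ : 0 ≤ B / Mw 1 := (abs_nonneg _).trans (h.abs_grazing_le 0 0)
  have h1 : |tprim (grazing T u) (min t T) x| ≤ B / Mw 1 * T := by
    rcases le_total t 0 with ht | ht
    · rw [tprim_eq_zero (fun t ht x => h.grazing_of_nonpos ht x) ((min_le_left _ _).trans ht),
        abs_zero]
      exact mul_nonneg hQ h.hT.le
    · refine (intervalIntegral.norm_integral_le_of_norm_le_const (C := B / Mw 1)
        (f := fun s => grazing T u s x) fun s _ => h.abs_grazing_le s x).trans ?_
      rw [sub_zero, abs_of_nonneg (le_min ht h.hT.le)]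
      exact mul_le_mul_of_nonneg_left (min_le_right _ _) hQ
  refine (abs_add_le _ _).trans ?_
  linarith [h.abs_grazing_le t x]

theorem hasDerivAt_emissionPrim {t x : ℝ} (ht : t ∈ Ioo 0 T) (hx : x ∈ Icc (0:ℝ) 1) :
    HasDerivAt (fun s => emissionPrim T u s x) (emission u t x) t := by
  have h1 := (h.hasDerivAt_grazing ht hx).add (h.sepReg_grazing.hasDerivAt_tprim t x)
  rw [sub_add_cancel] at h1
  refine h1.congr_of_eventuallyEq ?_
  filter_upwards [isOpen_Iio.mem_nhds ht.2] with s hs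
  have hs : s ≤ T := le_of_lt (mem_Iio.1 hs)
  simp only [emissionPrim, min_eq_left hs, Pi.add_apply]

theorem transport_identity {t x₁ x₂ μ ω : ℝ} (ht : t ≤ T) (h1 : 0 ≤ x₁) (h12 : x₁ ≤ x₂)
    (h2 : x₂ ≤ 1) (hμ : μ ∈ Icc (-1:ℝ) 1) (hω : 0 < ω) :
    μ * ω * (tprim (fun t x => clampExt T u t x μ ω) t x₂ -
      tprim (fun t x => clampExt T u t x μ ω) t x₁) =
    ∫ z in x₁..x₂, (Mw ω * emissionPrim T u t z - clampExt T u t z μ ω -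
      ω * tprim (fun t x => clampExt T u t x μ ω) t z) := by
  set y : ℝ → ℝ → ℝ := fun t x => clampExt T u t x μ ω with hy
  have y0 : ∀ t ≤ 0, ∀ x, y t x = 0 := fun t ht x => h.clampExt_of_nonpos ht hμ hω
  rcases le_total t 0 with h0 | h0
  · rw [tprim_eq_zero y0 h0, tprim_eq_zero y0 h0, sub_zero, mul_zero,
      intervalIntegral.integral_congr (g := fun _ => 0)]
    · simp
    · intro z _
      simp [tprim_eq_zero y0 h0, h.emissionPrim_of_nonpos h0, h.clampExt_of_nonpos h0 hμ hω]
  set q := grazing T u with hq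
  have ry : SepReg y := h.sepReg_clampExt hμ hω
  have rq : SepReg q := h.sepReg_grazing
  have ra : SepReg fun t x => y t x - Mw ω * q t x := ry.sub (rq.const_mul _)
  have rb : SepReg fun t x => μ * ω * y t x := ry.const_mul _
  have rf : SepReg fun t x => Mw ω * q t x - ω * y t x := (rq.const_mul _).sub (ry.const_mul _)
  have hd : ∀ r ∈ Ioo 0 T, ∀ x ∈ Ioo (0:ℝ) 1, HasDerivAt (fun s => y s x - Mw ω * q s x)
      (deriv (fun s => u s x μ ω) r - Mw ω * (emission u r x - q r x)) r := fun r hr x hx =>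
    (h.hasDerivAt_time hr (Ioo_subset_Icc_self hx) hμ hω).sub
      ((h.hasDerivAt_grazing hr (Ioo_subset_Icc_self hx)).const_mul _)
  have hd' : ∀ r ∈ Ioo 0 T, ∀ x ∈ Ioo (0:ℝ) 1, HasDerivAt (fun z => μ * ω * y r z)
      (μ * ω * deriv (fun z => u r z μ ω) x) x := fun r hr x hx =>
    (h.hasDerivAt_space (Ioo_subset_Icc_self hr) hx hμ hω).const_mul _
  have key := rectDefect_eq_zero (A := 0) (B := T) (C := 0) (D := 1) ra rb rf
    (fun p => by
      obtain ⟨N, hN⟩ := h.anchored_clampExt hμ hω p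
      obtain ⟨N', hN'⟩ := h.anchored_grazing p
      exact ⟨_, hN.sub (hN'.const_mul _)⟩)
    (fun p => by
      obtain ⟨N, hN⟩ := h.anchored_clampExt hμ hω p
      exact ⟨_, hN.const_mul _⟩)
    (fun r hr x hx => (hd r hr x hx).differentiableAt)
    (fun r hr x hx => (hd' r hr x hx).differentiableAt)
    (fun r hr x hx => by
      have hr' := Ioo_subset_Icc_self hr
      have hx' := Ioo_subset_Icc_self hx
      rw [(hd r hr x hx).deriv, (hd' r hr x hx).deriv, h.deriv_time hr' hx' hμ hω]
      simp only [hy, clampExt_of_mem hr' hx']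
      ring)
    le_rfl h0 ht h1 h12 h2
  have e1 : ∫ s in (0:ℝ)..t, (μ * ω * y s x₂ - μ * ω * y s x₁) =
      μ * ω * (tprim y t x₂ - tprim y t x₁) := by
    rw [intervalIntegral.integral_sub (rb.intLeft x₂ _ _) (rb.intLeft x₁ _ _),
      intervalIntegral.integral_const_mul, intervalIntegral.integral_const_mul, mul_sub, tprim,
      tprim]
  have e2 : ∀ x, ∫ s in (0:ℝ)..t, (Mw ω * q s x - ω * y s x) =
      Mw ω * tprim q t x - ω * tprim y t x := fun x => by
    rw [intervalIntegral.integral_sub ((rq.intLeft x _ _).const_mul _)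
      ((ry.intLeft x _ _).const_mul _), intervalIntegral.integral_const_mul,
      intervalIntegral.integral_const_mul, tprim, tprim]
  rw [rectDefect, e1, rf.fubini h0 h12, intervalIntegral.integral_congr (fun x _ => e2 x)] at key
  have i1 := (ra.intRight t x₁ x₂).sub (ra.intRight 0 x₁ x₂)
  have i2 : IntervalIntegrable (fun x => Mw ω * tprim q t x - ω * tprim y t x) volume x₁ x₂ :=
    ((rq.sepReg_tprim.const_mul (Mw ω)).sub (ry.sepReg_tprim.const_mul ω)).intRight t x₁ x₂
  have e3 := intervalIntegral.integral_sub i2 i1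
  rw [show μ * ω * (tprim y t x₂ - tprim y t x₁) =
    (∫ x in x₁..x₂, (Mw ω * tprim q t x - ω * tprim y t x)) -
      ∫ x in x₁..x₂, (y t x - Mw ω * q t x - (y 0 x - Mw ω * q 0 x)) by linarith, ← e3]
  refine intervalIntegral.integral_congr fun z _ => ?_
  have hq0 : q 0 z = 0 := h.grazing_of_nonpos le_rfl z
  simp only [y0 0 le_rfl, hq0, emissionPrim, min_eq_left ht]
  rw [← hq]
  ring

theorem transp_right {μ ω : ℝ} (hμ : μ ∈ Ioc (0:ℝ) 1) (hω : 0 < ω) :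
    Transp T (μ * ω) ω (Mw ω) B (B / Mw 1 * (1 + T)) (fun t x => clampExt T u t x μ ω)
      (emissionPrim T u) where
  hT := h.hT
  hc := mul_pos hμ.1 hω
  hω := hω
  hM := (Mw_pos hω).le
  hy := h.sepReg_clampExt ⟨by linarith [hμ.1], hμ.2⟩ hω
  hG := h.sepReg_emissionPrim
  y0 t ht x := h.clampExt_of_nonpos ht ⟨by linarith [hμ.1], hμ.2⟩ hω
  G0 t ht x := h.emissionPrim_of_nonpos ht x
  yB t x := h.bdd _ _ _ _
  GB := h.abs_emissionPrim_le
  tp t ht x hx := by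
    have hc : μ * ω ≠ 0 := (mul_pos hμ.1 hω).ne'
    rw [intervalIntegral.integral_div, ← h.transport_identity ht le_rfl hx.1 hx.2
      ⟨by linarith [hμ.1], hμ.2⟩ hω, mul_div_cancel_left₀ _ hc]

theorem transp_left {μ ω : ℝ} (hμ : μ ∈ Ioc (0:ℝ) 1) (hω : 0 < ω) :
    Transp T (μ * ω) ω (Mw ω) B (B / Mw 1 * (1 + T))
      (fun t x => clampExt T u t (1 - x) (-μ) ω) (fun t x => emissionPrim T u t (1 - x)) where
  hT := h.hT
  hc := mul_pos hμ.1 hω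
  hω := hω
  hM := (Mw_pos hω).le
  hy := (h.sepReg_clampExt (μ := -μ) ⟨by linarith [hμ.2], by linarith [hμ.1]⟩ hω).comp
    (u := id) continuous_id (by fun_prop)
  hG := h.sepReg_emissionPrim.comp (u := id) continuous_id (by fun_prop)
  y0 t ht x := h.clampExt_of_nonpos ht ⟨by linarith [hμ.2], by linarith [hμ.1]⟩ hω
  G0 t ht x := h.emissionPrim_of_nonpos ht _
  yB t x := h.bdd _ _ _ _
  GB t x := h.abs_emissionPrim_le t _
  tp t ht x hx := by
    have hc : μ * ω ≠ 0 := (mul_pos hμ.1 hω).ne'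
    have key := h.transport_identity (μ := -μ) ht (sub_nonneg.2 hx.2) (sub_le_self 1 hx.1) le_rfl
      ⟨by linarith [hμ.2], by linarith [hμ.1]⟩ hω
    have e := intervalIntegral.integral_comp_sub_left (a := 0) (b := x) (fun z =>
      Mw ω * emissionPrim T u t z - clampExt T u t z (-μ) ω -
        ω * tprim (fun t x => clampExt T u t x (-μ) ω) t z) 1
    rw [sub_zero, ← key] at e
    rw [intervalIntegral.integral_div]
    change tprim (fun t x => clampExt T u t x (-μ) ω) t (1 - x) -
      tprim (fun t x => clampExt T u t x (-μ) ω) t (1 - 0) = _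
    rw [sub_zero, eq_div_iff hc]
    refine Eq.trans ?_ e.symm
    ring

theorem slab : Slab T B (B / Mw 1 * (1 + T)) (4 / wgstar) Mw η (clampExt T u) (emissionPrim T u)
    (emission u) where
  hT := h.hT
  right μ hμ ω hω := h.transp_right hμ hω
  left μ hμ ω hω := h.transp_left hμ hω
  source t ht x hx := h.hasDerivAt_emissionPrim ht hx
  bracket_eq t ht x hx := by
    simp only [emission, bracket, clampExt_of_mem ht hx, integral_const_mul]
  int_ω t ht x hx := by
    have := (h.integrable t ht x hx).2
    simpa only [clampExt_of_mem ht hx, integral_const_mul] using this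
  int_μ t ht x hx ω hω := by
    have := ((h.integrable t ht x hx).1 ω hω).const_mul ω⁻¹
    simp only [inv_mul_cancel_left₀ (ne_of_gt hω)] at this
    simp only [clampExt_of_mem ht hx]
    exact this
  cont x hx μ hμ ω hω := (h.sepReg_clampExt hμ hω).left x
  bdd t x μ ω := h.bdd _ _ _ _
  entering t ht μ hμ ω hω := by
    rw [clampExt, clamp_of_nonpos le_rfl]
    exact h.entering _ (clamp_mem h.hT.le t) μ hμ ω hω
  reflected t ht μ hμ ω hω := by
    simp only [clampExt, clamp_of_mem (T := 1) (t := 1) ⟨zero_le_one, le_rfl⟩]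
    exact h.reflected _ (clamp_mem h.hT.le t) μ hμ ω hω
  hη := h.hη
  hM := measurable_Mw
  MA ω hω := Mw_le hω

theorem nonneg {t x μ ω : ℝ} (ht : t ∈ Icc 0 T) (hx : x ∈ Icc (0:ℝ) 1) (hμ : μ ∈ Icc (-1:ℝ) 1)
    (hω : 0 < ω) : 0 ≤ u t x μ ω := by
  rw [← clampExt_of_mem (u := u) ht hx]
  rcases lt_trichotomy μ 0 with h0 | rfl | h0
  · simpa using h.slab.nonneg_left ht.2 hx (μ := -μ) ⟨by linarith, by linarith [hμ.1]⟩ hω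
  · refine nonneg_of_hasDerivAt_add_nonneg (a := ω) (T := T)
      (y := fun s => clampExt T u s x 0 ω) (h.clampExt_of_nonpos le_rfl hμ hω).ge
      ((h.sepReg_clampExt hμ hω).left x).continuousOn
      (fun s hs => h.hasDerivAt_time hs hx hμ hω) (fun s hs => ?_) ht
    rw [h.deriv_time (Ioo_subset_Icc_self hs) hx hμ hω, clampExt_of_mem (Ioo_subset_Icc_self hs) hx]
    have := mul_nonneg (Mw_pos hω).le (h.slab.source_deriv_nonneg hs hx)
    linarith
  · exact h.slab.nonneg_right ht.2 hx ⟨h0, hμ.2⟩ hω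

end SuperSolution

theorem BracketIntegrable.sub {f g : ℝ → ℝ → ℝ} (hf : BracketIntegrable f)
    (hg : BracketIntegrable g) : BracketIntegrable fun μ ω => f μ ω - g μ ω := by
  refine ⟨fun ω hω => (hf.1 ω hω).sub (hg.1 ω hω), ?_⟩
  refine (hf.2.sub hg.2).congr_fun (fun ω hω => ?_) measurableSet_Ioi
  exact (integral_sub (hf.1 ω hω) (hg.1 ω hω)).symm

theorem bracket_sub {f g : ℝ → ℝ → ℝ} (hf : BracketIntegrable f) (hg : BracketIntegrable g) :
    bracket (fun μ ω => f μ ω - g μ ω) = bracket f - bracket g := by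
  rw [bracket, bracket, bracket, ← integral_sub hf.2 hg.2]
  exact setIntegral_congr_fun measurableSet_Ioi fun ω hω => integral_sub (hf.1 ω hω) (hg.1 ω hω)

theorem BracketIntegrableSol.sub {T : ℝ} {g₁ g₂ : ℝ → ℝ → ℝ → ℝ → ℝ}
    (h₁ : BracketIntegrableSol T g₁) (h₂ : BracketIntegrableSol T g₂) :
    BracketIntegrableSol T fun t x μ ω => g₁ t x μ ω - g₂ t x μ ω := fun t ht x hx => by
  simpa only [mul_sub] using (h₁ t ht x hx).sub (h₂ t ht x hx)

theorem SatisfiesPTE.sub {T : ℝ} {g₁ g₂ : ℝ → ℝ → ℝ → ℝ → ℝ} (h₁ : SatisfiesPTE T g₁)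
    (h₂ : SatisfiesPTE T g₂) (i₁ : BracketIntegrableSol T g₁) (i₂ : BracketIntegrableSol T g₂) :
    SatisfiesPTE T fun t x μ ω => g₁ t x μ ω - g₂ t x μ ω := fun t ht x hx μ hμ ω hω => by
  obtain ⟨a₁, b₁, e₁⟩ := h₁ t ht x hx μ hμ ω hω
  obtain ⟨a₂, b₂, e₂⟩ := h₂ t ht x hx μ hμ ω hω
  refine ⟨a₁.sub a₂, b₁.sub b₂, ?_⟩
  have hb := bracket_sub (i₁ t ht x hx) (i₂ t ht x hx)
  rw [(a₁.hasDerivAt.fun_sub a₂.hasDerivAt).deriv, (b₁.hasDerivAt.fun_sub b₂.hasDerivAt).deriv]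
  rw [coll] at e₁ e₂ ⊢
  simp only [mul_sub] at hb ⊢
  rw [hb]
  linarith

end

/-- Monotonicity of the solution in the reflection coefficient: if
`η₁ ≥ η₂` pointwise and `φ ≥ 0` is a bounded incoming datum, then the
corresponding bounded forward solutions satisfy `g₁ ≥ g₂` pointwise. -/
theorem solution_monotone_in_reflection (Tmax : ℝ) (hT : 0 < Tmax)
    (η₁ η₂ : ℝ → ℝ) (φ : ℝ → ℝ → ℝ → ℝ) (g₁ g₂ : ℝ → ℝ → ℝ → ℝ → ℝ)
    (hη₁ : ∀ ω ∈ Ioi (0:ℝ), η₁ ω ∈ Icc (0:ℝ) 1)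
    (hη₂ : ∀ ω ∈ Ioi (0:ℝ), η₂ ω ∈ Icc (0:ℝ) 1)
    (hmono : ∀ ω ∈ Ioi (0:ℝ), η₂ ω ≤ η₁ ω)
    (hφbdd : ∃ Cφ, ∀ t μ ω, |φ t μ ω| ≤ Cφ)
    (hφpos : ∀ t ∈ Icc (0:ℝ) Tmax, ∀ μ ∈ Ioc (0:ℝ) 1, ∀ ω ∈ Ioi (0:ℝ), 0 ≤ φ t μ ω)
    (hb₁ : BoundedFn g₁) (hb₂ : BoundedFn g₂)
    (hi₁ : BracketIntegrableSol Tmax g₁) (hi₂ : BracketIntegrableSol Tmax g₂)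
    (hs₁ : IsForwardSolution Tmax η₁ φ g₁) (hs₂ : IsForwardSolution Tmax η₂ φ g₂) :
    ∀ t ∈ Icc (0:ℝ) Tmax, ∀ x ∈ Icc (0:ℝ) 1, ∀ μ ∈ Icc (-1:ℝ) 1, ∀ ω ∈ Ioi (0:ℝ),
      g₂ t x μ ω ≤ g₁ t x μ ω := by
  obtain ⟨B₁, hB₁⟩ := hb₁
  obtain ⟨B₂, hB₂⟩ := hb₂
  obtain ⟨p₁, z₁, l₁, r₁⟩ := hs₁
  obtain ⟨p₂, z₂, l₂, r₂⟩ := hs₂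
  have neg_mem : ∀ μ ∈ Ioc (0:ℝ) 1, -μ ∈ Ico (-1:ℝ) 0 := fun μ hμ =>
    ⟨by linarith [hμ.2], by linarith [hμ.1]⟩
  have one_mem : (1:ℝ) ∈ Icc (0:ℝ) 1 := ⟨zero_le_one, le_rfl⟩
  have s₂ : SuperSolution Tmax B₂ η₂ g₂ :=
    { hT := hT
      bdd := hB₂
      integrable := hi₂
      pte := p₂
      initial := z₂
      entering := fun t ht μ hμ ω hω => (l₂ t ht μ hμ ω hω).symm ▸ hφpos t ht μ hμ ω hω
      reflected := fun t ht μ hμ ω hω => by rw [r₂ t ht (-μ) (neg_mem μ hμ) ω hω, neg_neg]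
      hη := hη₂ }
  have s : SuperSolution Tmax (B₁ + B₂) η₁ fun t x μ ω => g₁ t x μ ω - g₂ t x μ ω :=
    { hT := hT
      bdd := fun t x μ ω => (abs_sub _ _).trans (add_le_add (hB₁ t x μ ω) (hB₂ t x μ ω))
      integrable := hi₁.sub hi₂
      pte := p₁.sub p₂ hi₁ hi₂
      initial := fun x hx μ hμ ω hω => by rw [z₁ x hx μ hμ ω hω, z₂ x hx μ hμ ω hω, sub_zero]
      entering := fun t ht μ hμ ω hω => by
        rw [l₁ t ht μ hμ ω hω, l₂ t ht μ hμ ω hω, sub_self]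
      reflected := fun t ht μ hμ ω hω => by
        rw [r₁ t ht (-μ) (neg_mem μ hμ) ω hω, r₂ t ht (-μ) (neg_mem μ hμ) ω hω, neg_neg]
        have := mul_le_mul_of_nonneg_right (hmono ω hω)
          (s₂.nonneg ht one_mem ⟨by linarith [hμ.1], hμ.2⟩ hω)
        linarith
      hη := hη₁ }
  exact fun t ht x hx μ hμ ω hω => sub_nonneg.1 (s.nonneg ht hx hμ hω)
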